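/- Let p be a trigonometric polynomial with ∫_0^1 p(x) dx = 0. Then for almost all x ∈ [A,B]: limsup_{N→∞} |Σ_{n=1}^N p(ξ x^{s_n})| / √(N log log N) = √2 · ‖p‖. -/

import Mathlib

open MeasureTheory Filter

/-- The `L²` norm of `f` over `[A,B]`. -/
noncomputable def fnorm (A B : ℝ) (f : ℝ → ℝ) : ℝ :=
  Real.sqrt (∫ x in A..B, (f x) ^ 2)

/-- The natural logarithm, interpreted as `max {1, log x}`. -/
noncomputable def plog (x : ℝ) : ℝ := max 1 (Real.log x)

namespace LIL

lemma glue (F G : ℝ → ℝ) (hF : ∀ a b, IntervalIntegrable F volume a b)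
    (hG : ∀ a b, IntervalIntegrable G volume a b) (h : ℝ → ℝ) (α β : ℝ)
    (hpos : ∀ u, α ≤ u → u ≤ β → 0 < h u) (hanti : AntitoneOn h (Set.Icc α β))
    (hloc : ∀ u w, α ≤ u → u ≤ w → w ≤ β → h u ≤ w - u → w - u ≤ 2 * h u →
      ∫ x in u..w, F x ≤ ∫ x in u..w, G x) :
    ∀ u w, α ≤ u → u ≤ w → w ≤ β → h u ≤ w - u → ∫ x in u..w, F x ≤ ∫ x in u..w, G x := by
  have key : ∀ n : ℕ, ∀ u w, α ≤ u → u ≤ w → w ≤ β → h u ≤ w - u → w - u ≤ n * h β →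
      ∫ x in u..w, F x ≤ ∫ x in u..w, G x := by
    intro n
    induction n with
    | zero =>
      intro u w hu huw hw h1 h2
      have := hpos u hu (by linarith)
      simp at h2
      linarith
    | succ n ih =>
      intro u w hu huw hw h1 h2
      have hp := hpos u hu (by linarith)
      by_cases hc : w - u ≤ 2 * h u
      · exact hloc u w hu huw hw h1 hc
      · push Not at hc
        have hz1 : α ≤ u + h u := by linarith
        have hz2 : u + h u ≤ w := by linarith
        have ha : h (u + h u) ≤ h u :=
          hanti ⟨hu, by linarith⟩ ⟨hz1, by linarith⟩ (by linarith)
        have hb : h β ≤ h u :=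
          hanti ⟨hu, by linarith⟩ ⟨by linarith, le_refl _⟩ (by linarith)
        have e1 := hloc u (u + h u) hu (by linarith) (by linarith) (by linarith) (by linarith)
        have e2 := ih (u + h u) w hz1 hz2 hw (by linarith) (by push_cast at h2; linarith)
        rw [← intervalIntegral.integral_add_adjacent_intervals (hF u (u + h u)) (hF (u + h u) w),
          ← intervalIntegral.integral_add_adjacent_intervals (hG u (u + h u)) (hG (u + h u) w)]
        linarith
  intro u w hu huw hw h1
  have hb := hpos β (by linarith) le_rfl
  obtain ⟨n, hn⟩ := exists_nat_ge ((w - u) / h β)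
  exact key n u w hu huw hw h1 (by rwa [div_le_iff₀ hb] at hn)

/-- indicator of a set as a real function -/
noncomputable def ind (E : Set ℝ) : ℝ → ℝ := E.indicator (fun _ => (1:ℝ))

lemma ind_ii {E : Set ℝ} (hE : MeasurableSet E) (a b : ℝ) :
    IntervalIntegrable (ind E) volume a b := by
  constructor <;>
  exact (integrableOn_const (by simp) : IntegrableOn (fun _ => (1:ℝ)) _ volume).indicator hE

lemma ind_le_one (E : Set ℝ) (x : ℝ) : ind E x ≤ 1 := by
  unfold ind; by_cases h : x ∈ E <;> simp [h]

lemma ind_nonneg (E : Set ℝ) (x : ℝ) : 0 ≤ ind E x := by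
  unfold ind; by_cases h : x ∈ E <;> simp [h]

lemma ind_mem {E : Set ℝ} {x : ℝ} (h : x ∈ E) : ind E x = 1 := by
  unfold ind; simp [h]

lemma ind_nmem {E : Set ℝ} {x : ℝ} (h : x ∉ E) : ind E x = 0 := by
  unfold ind; simp [h]

lemma const_ii (c a b : ℝ) : IntervalIntegrable (fun _ : ℝ => c) volume a b :=
  intervalIntegrable_const

lemma int_mono_const_right {F : ℝ → ℝ} (hF : ∀ a b, IntervalIntegrable F volume a b) {u w c : ℝ}
    (huw : u ≤ w) (h : ∀ x ∈ Set.Icc u w, F x ≤ c) : ∫ x in u..w, F x ≤ (w - u) * c := by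
  have := intervalIntegral.integral_mono_on huw (hF u w) (const_ii c u w) h
  simpa using this

lemma int_mono_const_left {F : ℝ → ℝ} (hF : ∀ a b, IntervalIntegrable F volume a b) {u w c : ℝ}
    (huw : u ≤ w) (h : ∀ x ∈ Set.Icc u w, c ≤ F x) : (w - u) * c ≤ ∫ x in u..w, F x := by
  have := intervalIntegral.integral_mono_on huw (const_ii c u w) (hF u w) h
  simpa using this

section chain
variable (X : ℕ → ℝ → ℝ) (hX : ∀ i, Continuous (X i)) (H : ℕ → ℝ → ℝ) (α β : ℝ)
  (hpos : ∀ i u, α ≤ u → u ≤ β → 0 < H i u) (hanti : ∀ i, AntitoneOn (H i) (Set.Icc α β))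
  (hmono : ∀ i u, α ≤ u → u ≤ β → H (i + 1) u ≤ H i u)

lemma chainMax_meas (hX : ∀ i, Continuous (X i)) (m i : ℕ) (t : ℝ) :
    MeasurableSet {x | ∃ j < m, t ≤ ∑ l ∈ Finset.range (j + 1), X (i + l) x} := by
  have : {x | ∃ j < m, t ≤ ∑ l ∈ Finset.range (j + 1), X (i + l) x} =
      ⋃ j ∈ Finset.range m, {x | t ≤ ∑ l ∈ Finset.range (j + 1), X (i + l) x} := by
    ext x; simp
  rw [this]
  refine Finset.measurableSet_biUnion _ (fun j _ => ?_)
  exact measurableSet_le measurable_const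
    (continuous_finsetSum _ (fun l _ => hX (i + l))).measurable

include hX hpos hanti hmono in
lemma chainMax (δ κ : ℝ) (hδ : 0 ≤ δ) (hκ : 0 ≤ κ)
    (hosc : ∀ i u w, α ≤ u → w ≤ β → w - u ≤ 2 * H (i + 1) u →
      ∀ x ∈ Set.Icc u w, ∀ y ∈ Set.Icc u w, |X i x - X i y| ≤ δ)
    (hexp : ∀ i u w, α ≤ u → u ≤ w → w ≤ β → H i u ≤ w - u →
      ∫ x in u..w, Real.exp (X i x) ≤ (w - u) * Real.exp κ) (m : ℕ) :
    ∀ i t u w, α ≤ u → u ≤ w → w ≤ β → H i u ≤ w - u →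
      ∫ x in u..w, ind {x | ∃ j < m, t ≤ ∑ l ∈ Finset.range (j + 1), X (i + l) x} x ≤
        (w - u) * Real.exp (-t + m * (κ + 2 * δ)) := by
  induction m with
  | zero =>
    intro i t u w hu huw hw hH
    simp [ind]
    have := Real.exp_pos (-t)
    have : 0 ≤ w - u := by linarith
    positivity
  | succ m ih =>
    intro i t u w hu huw hw hH
    have hcG : Continuous (fun x => Real.exp (X i x + (2 * δ - t + m * (κ + 2 * δ)))) :=
      Real.continuous_exp.comp ((hX i).add continuous_const)
    have h1 := glue (ind {x | ∃ j < m + 1, t ≤ ∑ l ∈ Finset.range (j + 1), X (i + l) x})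
      (fun x => Real.exp (X i x + (2 * δ - t + m * (κ + 2 * δ))))
      (ind_ii (chainMax_meas X hX _ _ _)) (fun a b => hcG.intervalIntegrable a b)
      (H (i + 1)) α β (hpos (i + 1)) (hanti (i + 1)) ?_ u w hu huw hw
      ((hmono i u hu (by linarith)).trans hH)
    · refine h1.trans ?_
      have h2 := hexp i u w hu huw hw hH
      simp_rw [Real.exp_add (X i _)]
      rw [intervalIntegral.integral_mul_const]
      calc _ ≤ (w - u) * Real.exp κ * Real.exp (2 * δ - t + m * (κ + 2 * δ)) := by gcongr
        _ = _ := by rw [mul_assoc, ← Real.exp_add]; congr 2; push_cast; ring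
    · intro u w hu huw hw hh1 hh2
      have ho := hosc i u w hu hw hh2
      have huI : u ∈ Set.Icc u w := ⟨le_rfl, huw⟩
      have hlow : (w - u) * Real.exp (X i u + δ - t + m * (κ + 2 * δ)) ≤
          ∫ x in u..w, Real.exp (X i x + (2 * δ - t + m * (κ + 2 * δ))) := by
        refine int_mono_const_left (fun a b => hcG.intervalIntegrable a b) huw (fun x hx => ?_)
        have := abs_le.1 (ho x hx u huI)
        apply Real.exp_le_exp.2
        linarith [this.1]
      refine le_trans ?_ hlow
      by_cases hc : t ≤ X i u + δ
      · refine int_mono_const_right (ind_ii (chainMax_meas X hX _ _ _)) huw (fun x hx => ?_)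
        refine (ind_le_one _ x).trans (Real.one_le_exp ?_)
        have : 0 ≤ m * (κ + 2 * δ) := by positivity
        linarith
      · push Not at hc
        have h3 := ih (i + 1) (t - X i u - δ) u w hu huw hw hh1
        have e : -(t - X i u - δ) + m * (κ + 2 * δ) = X i u + δ - t + m * (κ + 2 * δ) := by ring
        rw [e] at h3
        refine le_trans ?_ h3
        refine intervalIntegral.integral_mono_on huw (ind_ii (chainMax_meas X hX _ _ _) _ _)
          (ind_ii (chainMax_meas X hX _ _ _) _ _) (fun x hx => ?_)
        by_cases hm : x ∈ {x | ∃ j < m + 1, t ≤ ∑ l ∈ Finset.range (j + 1), X (i + l) x}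
        · rw [ind_mem hm, ind_mem]
          obtain ⟨j, hj, hjt⟩ := hm
          have hx2 := (abs_le.1 (ho x hx u huI)).2
          rw [Finset.sum_range_succ'] at hjt
          simp only [add_zero] at hjt
          rcases j with _ | j
          · simp at hjt; linarith
          · refine ⟨j, by omega, ?_⟩
            have : ∑ l ∈ Finset.range (j + 1), X (i + 1 + l) x =
              ∑ l ∈ Finset.range (j + 1), X (i + (l + 1)) x :=
              Finset.sum_congr rfl (fun l _ => by congr 1; ring)
            rw [this]; linarith
        · rw [ind_nmem hm]; exact ind_nonneg _ _

lemma sum_shift (m i : ℕ) (x : ℝ) : ∑ l ∈ Finset.range (m + 1), X (i + l) x =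
    X i x + ∑ l ∈ Finset.range m, X (i + 1 + l) x := by
  rw [Finset.sum_range_succ', add_comm]
  simp only [add_zero]
  congr 1
  exact Finset.sum_congr rfl (fun l _ => by congr 1; ring)

lemma cont_expsum (hX : ∀ i, Continuous (X i)) (m i : ℕ) :
    Continuous (fun x => Real.exp (∑ l ∈ Finset.range m, X (i + l) x)) :=
  Real.continuous_exp.comp (continuous_finsetSum _ (fun l _ => hX (i + l)))

include hX hpos hanti hmono in
lemma chainUp (δ κ : ℝ)
    (hosc : ∀ i u w, α ≤ u → w ≤ β → w - u ≤ 2 * H (i + 1) u →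
      ∀ x ∈ Set.Icc u w, ∀ y ∈ Set.Icc u w, |X i x - X i y| ≤ δ)
    (hexp : ∀ i u w, α ≤ u → u ≤ w → w ≤ β → H i u ≤ w - u →
      ∫ x in u..w, Real.exp (X i x) ≤ (w - u) * Real.exp κ) (m : ℕ) :
    ∀ i u w, α ≤ u → u ≤ w → w ≤ β → H i u ≤ w - u →
      ∫ x in u..w, Real.exp (∑ l ∈ Finset.range m, X (i + l) x) ≤
        (w - u) * Real.exp (m * (κ + 2 * δ)) := by
  induction m with
  | zero =>
    intro i u w hu huw hw hH
    simp
  | succ m ih =>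
    intro i u w hu huw hw hH
    have hcG : Continuous (fun x => Real.exp (X i x + (2 * δ + m * (κ + 2 * δ)))) :=
      Real.continuous_exp.comp ((hX i).add continuous_const)
    have h1 := glue (fun x => Real.exp (∑ l ∈ Finset.range (m + 1), X (i + l) x))
      (fun x => Real.exp (X i x + (2 * δ + m * (κ + 2 * δ))))
      (fun a b => (cont_expsum X hX _ _).intervalIntegrable a b)
      (fun a b => hcG.intervalIntegrable a b)
      (H (i + 1)) α β (hpos (i + 1)) (hanti (i + 1)) ?_ u w hu huw hw
      ((hmono i u hu (by linarith)).trans hH)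
    · refine h1.trans ?_
      have h2 := hexp i u w hu huw hw hH
      simp_rw [Real.exp_add (X i _)]
      rw [intervalIntegral.integral_mul_const]
      calc _ ≤ (w - u) * Real.exp κ * Real.exp (2 * δ + m * (κ + 2 * δ)) := by gcongr
        _ = _ := by rw [mul_assoc, ← Real.exp_add]; congr 2; push_cast; ring
    · intro u w hu huw hw hh1 hh2
      have ho := hosc i u w hu hw hh2
      have huI : u ∈ Set.Icc u w := ⟨le_rfl, huw⟩
      have hlow : (w - u) * Real.exp (X i u + δ + m * (κ + 2 * δ)) ≤
          ∫ x in u..w, Real.exp (X i x + (2 * δ + m * (κ + 2 * δ))) := by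
        refine int_mono_const_left (fun a b => hcG.intervalIntegrable a b) huw (fun x hx => ?_)
        have := abs_le.1 (ho x hx u huI)
        apply Real.exp_le_exp.2
        linarith [this.1]
      refine le_trans ?_ hlow
      have h3 := ih (i + 1) u w hu huw hw hh1
      calc _ ≤ ∫ x in u..w, Real.exp (X i u + δ) *
              Real.exp (∑ l ∈ Finset.range m, X (i + 1 + l) x) := by
            refine intervalIntegral.integral_mono_on huw
              ((cont_expsum X hX _ _).intervalIntegrable _ _)
              (((cont_expsum X hX _ _).intervalIntegrable _ _).const_mul _) (fun x hx => ?_)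
            rw [← Real.exp_add, sum_shift]
            have := abs_le.1 (ho x hx u huI)
            apply Real.exp_le_exp.2
            linarith [this.2]
        _ ≤ Real.exp (X i u + δ) * ((w - u) * Real.exp (m * (κ + 2 * δ))) := by
            rw [intervalIntegral.integral_const_mul]
            gcongr
        _ = _ := by rw [Real.exp_add (X i u + δ)]; ring

include hX hpos hanti hmono in
lemma chainLow (δ κ : ℝ)
    (hosc : ∀ i u w, α ≤ u → w ≤ β → w - u ≤ 2 * H (i + 1) u →
      ∀ x ∈ Set.Icc u w, ∀ y ∈ Set.Icc u w, |X i x - X i y| ≤ δ)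
    (hexp : ∀ i u w, α ≤ u → u ≤ w → w ≤ β → H i u ≤ w - u →
      (w - u) * Real.exp κ ≤ ∫ x in u..w, Real.exp (X i x)) (m : ℕ) :
    ∀ i u w, α ≤ u → u ≤ w → w ≤ β → H i u ≤ w - u →
        (w - u) * Real.exp (m * (κ - 2 * δ)) ≤
      ∫ x in u..w, Real.exp (∑ l ∈ Finset.range m, X (i + l) x) := by
  induction m with
  | zero =>
    intro i u w hu huw hw hH
    simp
  | succ m ih =>
    intro i u w hu huw hw hH
    have hcG : Continuous (fun x => Real.exp (X i x + (-2 * δ + m * (κ - 2 * δ)))) :=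
      Real.continuous_exp.comp ((hX i).add continuous_const)
    have h1 := glue 
      (fun x => Real.exp (X i x + (-2 * δ + m * (κ - 2 * δ))))
      (fun x => Real.exp (∑ l ∈ Finset.range (m + 1), X (i + l) x))
      (fun a b => hcG.intervalIntegrable a b)
      (fun a b => (cont_expsum X hX _ _).intervalIntegrable a b)
      (H (i + 1)) α β (hpos (i + 1)) (hanti (i + 1)) ?_ u w hu huw hw
      ((hmono i u hu (by linarith)).trans hH)
    · refine le_trans ?_ h1
      have h2 := hexp i u w hu huw hw hH
      simp_rw [Real.exp_add (X i _)]
      rw [intervalIntegral.integral_mul_const]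
      calc _ = (w - u) * Real.exp κ * Real.exp (-2 * δ + m * (κ - 2 * δ)) := by
            rw [mul_assoc, ← Real.exp_add]; congr 2; push_cast; ring
        _ ≤ _ := by gcongr
    · intro u w hu huw hw hh1 hh2
      have ho := hosc i u w hu hw hh2
      have huI : u ∈ Set.Icc u w := ⟨le_rfl, huw⟩
      have hlow : ∫ x in u..w, Real.exp (X i x + (-2 * δ + m * (κ - 2 * δ))) ≤
          (w - u) * Real.exp (X i u - δ + m * (κ - 2 * δ)) := by
        refine int_mono_const_right (fun a b => hcG.intervalIntegrable a b) huw (fun x hx => ?_)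
        have := abs_le.1 (ho x hx u huI)
        apply Real.exp_le_exp.2
        linarith [this.2]
      refine le_trans hlow ?_
      have h3 := ih (i + 1) u w hu huw hw hh1
      calc _ = Real.exp (X i u - δ) * ((w - u) * Real.exp (m * (κ - 2 * δ))) := by
            rw [Real.exp_add (X i u - δ)]; ring
        _ ≤ ∫ x in u..w, Real.exp (X i u - δ) *
              Real.exp (∑ l ∈ Finset.range m, X (i + 1 + l) x) := by
            rw [intervalIntegral.integral_const_mul]
            gcongr
        _ ≤ _ := by
            refine intervalIntegral.integral_mono_on huw
              (((cont_expsum X hX _ _).intervalIntegrable _ _).const_mul _)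
              ((cont_expsum X hX _ _).intervalIntegrable _ _) (fun x hx => ?_)
            rw [← Real.exp_add, sum_shift]
            have := abs_le.1 (ho x hx u huI)
            apply Real.exp_le_exp.2
            linarith [this.1]

lemma chainBad_meas (hX : ∀ i, Continuous (X i)) (t : ℕ → ℝ) (m i : ℕ) :
    MeasurableSet {x | ∀ l < m, X (i + l) x < t (i + l)} := by
  have : {x | ∀ l < m, X (i + l) x < t (i + l)} =
      ⋂ l ∈ Finset.range m, {x | X (i + l) x < t (i + l)} := by
    ext x; simp
  rw [this]
  refine Finset.measurableSet_biInter _ (fun j _ => ?_)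
  exact measurableSet_lt (hX _).measurable measurable_const

include hX hpos hanti hmono in
lemma chainBad (t δ q : ℕ → ℝ) (hq : ∀ i, q i ≤ 1) 
    (hosc : ∀ i u w, α ≤ u → w ≤ β → w - u ≤ 2 * H (i + 1) u →
      ∀ x ∈ Set.Icc u w, ∀ y ∈ Set.Icc u w, |X i x - X i y| ≤ δ i)
    (hprob : ∀ i u w, α ≤ u → u ≤ w → w ≤ β → H i u ≤ w - u →
      ∫ x in u..w, ind {x | X i x < t i + δ i} x ≤ (w - u) * (1 - q i)) (m : ℕ) :
    ∀ i u w, α ≤ u → u ≤ w → w ≤ β → H i u ≤ w - u →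
      ∫ x in u..w, ind {x | ∀ l < m, X (i + l) x < t (i + l)} x ≤
        (w - u) * ∏ l ∈ Finset.range m, (1 - q (i + l)) := by
  have hms : ∀ i, MeasurableSet {x | X i x < t i + δ i} :=
    fun i => measurableSet_lt (hX _).measurable measurable_const
  induction m with
  | zero =>
    intro i u w hu huw hw hH
    simp [ind]
  | succ m ih =>
    intro i u w hu huw hw hH
    set K := ∏ l ∈ Finset.range m, (1 - q (i + 1 + l)) with hK
    have hK0 : 0 ≤ K := Finset.prod_nonneg (fun l _ => by linarith [hq (i + 1 + l)])
    have h1 := glue (ind {x | ∀ l < m + 1, X (i + l) x < t (i + l)})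
      (fun x => K * ind {x | X i x < t i + δ i} x)
      (ind_ii (chainBad_meas X hX _ _ _)) (fun a b => (ind_ii (hms i) a b).const_mul _)
      (H (i + 1)) α β (hpos (i + 1)) (hanti (i + 1)) ?_ u w hu huw hw
      ((hmono i u hu (by linarith)).trans hH)
    · refine h1.trans ?_
      have h2 := hprob i u w hu huw hw hH
      rw [intervalIntegral.integral_const_mul]
      calc _ ≤ K * ((w - u) * (1 - q i)) := by gcongr
        _ = _ := by
          rw [Finset.prod_range_succ', hK]
          simp only [add_zero]
          have : ∏ l ∈ Finset.range m, (1 - q (i + 1 + l)) =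
              ∏ l ∈ Finset.range m, (1 - q (i + (l + 1))) :=
            Finset.prod_congr rfl (fun l _ => by congr 2; ring)
          rw [this]; ring
    · intro u w hu huw hw hh1 hh2
      have ho := hosc i u w hu hw hh2
      rw [intervalIntegral.integral_const_mul]
      by_cases hc : ∃ x ∈ Set.Icc u w, t i + δ i ≤ X i x
      · obtain ⟨y, hy, hyt⟩ := hc
        have : ∫ x in u..w, ind {x | ∀ l < m + 1, X (i + l) x < t (i + l)} x ≤ (w - u) * 0 := by
          refine int_mono_const_right (ind_ii (chainBad_meas X hX _ _ _)) huw (fun x hx => ?_)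
          rw [ind_nmem]
          intro hbad
          have h0 := hbad 0 (by omega)
          simp only [add_zero] at h0
          linarith [(abs_le.1 (ho x hx y hy)).1]
        refine this.trans ?_
        rw [mul_zero]
        exact mul_nonneg hK0 (intervalIntegral.integral_nonneg huw (fun x _ => ind_nonneg _ _))
      · push Not at hc
        have h4 : (w - u) * 1 ≤ ∫ x in u..w, ind {x | X i x < t i + δ i} x := by
          refine int_mono_const_left (ind_ii (hms i)) huw (fun x hx => ?_)
          rw [ind_mem]; exact hc x hx
        calc _ ≤ ∫ x in u..w, ind {x | ∀ l < m, X (i + 1 + l) x < t (i + 1 + l)} x := by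
              refine intervalIntegral.integral_mono_on huw (ind_ii (chainBad_meas X hX _ _ _) _ _)
                (ind_ii (chainBad_meas X hX _ _ _) _ _) (fun x hx => ?_)
              by_cases hm : x ∈ {x | ∀ l < m + 1, X (i + l) x < t (i + l)}
              · rw [ind_mem hm, ind_mem]
                intro l hl
                have := hm (l + 1) (by omega)
                have e : i + (l + 1) = i + 1 + l := by ring
                rwa [e] at this
              · rw [ind_nmem hm]; exact ind_nonneg _ _
          _ ≤ (w - u) * K := ih (i + 1) u w hu huw hw hh1
          _ = K * ((w - u) * 1) := by ring
          _ ≤ _ := by gcongr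
end chain

/-- lower tail estimate via tilting -/
lemma tail (X : ℝ → ℝ) (hX : Continuous X) (u w lam V κ : ℝ) (huw : u ≤ w) (hl : 0 < lam)
    (hV : 0 < V) (hκ : 0 < κ) (hκ1 : κ < 1) (hW : 8 ≤ κ ^ 2 * (lam ^ 2 * V))
    (h0 : (w - u) * Real.exp (lam ^ 2 * V / 2 - 1) ≤ ∫ x in u..w, Real.exp (lam * X x))
    (h1 : ∫ x in u..w, Real.exp ((1 - κ) * lam * X x) ≤
      (w - u) * Real.exp (((1 - κ) * lam) ^ 2 * V / 2 + 1))
    (h2 : ∫ x in u..w, Real.exp ((1 + κ) * lam * X x) ≤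
      (w - u) * Real.exp (((1 + κ) * lam) ^ 2 * V / 2 + 1)) :
    ∫ x in u..w, ind {x | X x < (1 - κ) * lam * V} x ≤
      (w - u) * (1 - Real.exp (-(1 / 2 + κ) * (lam ^ 2 * V) - 2)) := by
  set W := lam ^ 2 * V with hWd
  have hms : MeasurableSet {x | X x < (1 - κ) * lam * V} :=
    measurableSet_lt hX.measurable measurable_const
  have hc : ∀ c, Continuous (fun x => Real.exp (c * X x)) := fun c =>
    Real.continuous_exp.comp (continuous_const.mul hX)
  have i1 : ∀ c a b, IntervalIntegrable (fun x => Real.exp (c * X x)) volume a b :=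
    fun c a b => (hc c).intervalIntegrable a b
  have hpt : ∀ x, Real.exp (lam * X x) ≤
      Real.exp (κ * (1 - κ) * W) * Real.exp ((1 - κ) * lam * X x) +
      Real.exp (-κ * (1 + κ) * W) * Real.exp ((1 + κ) * lam * X x) +
      Real.exp ((1 + κ) * W) * (1 - ind {x | X x < (1 - κ) * lam * V} x) := by
    intro x
    rw [← Real.exp_add, ← Real.exp_add]
    have p1 := Real.exp_pos (κ * (1 - κ) * W + (1 - κ) * lam * X x)
    have p2 := Real.exp_pos (-κ * (1 + κ) * W + (1 + κ) * lam * X x)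
    have p3 : 0 ≤ Real.exp ((1 + κ) * W) * (1 - ind {x | X x < (1 - κ) * lam * V} x) :=
      mul_nonneg (Real.exp_pos _).le (by linarith [ind_le_one {x | X x < (1 - κ) * lam * V} x])
    by_cases c1 : X x < (1 - κ) * lam * V
    · have : Real.exp (lam * X x) ≤ Real.exp (κ * (1 - κ) * W + (1 - κ) * lam * X x) := by
        apply Real.exp_le_exp.2
        have : κ * lam * X x ≤ κ * lam * ((1 - κ) * lam * V) := by gcongr
        rw [hWd]; nlinarith
      linarith
    · by_cases c2 : (1 + κ) * lam * V ≤ X x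
      · have : Real.exp (lam * X x) ≤ Real.exp (-κ * (1 + κ) * W + (1 + κ) * lam * X x) := by
          apply Real.exp_le_exp.2
          have : κ * lam * ((1 + κ) * lam * V) ≤ κ * lam * X x := by gcongr
          rw [hWd]; nlinarith
        linarith
      · push Not at c2
        rw [ind_nmem (by simpa using c1)]
        have : Real.exp (lam * X x) ≤ Real.exp ((1 + κ) * W) := by
          apply Real.exp_le_exp.2
          have : lam * X x ≤ lam * ((1 + κ) * lam * V) := by gcongr
          rw [hWd]; nlinarith
        linarith
  have hint := intervalIntegral.integral_mono_on huw (i1 lam u w)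
    ((((i1 ((1 - κ) * lam) u w).const_mul (Real.exp (κ * (1 - κ) * W))).add
      ((i1 ((1 + κ) * lam) u w).const_mul (Real.exp (-κ * (1 + κ) * W)))).add
      (((const_ii 1 u w).sub (ind_ii hms u w)).const_mul (Real.exp ((1 + κ) * W))))
    (fun x _ => hpt x)
  rw [intervalIntegral.integral_add
    (((i1 ((1 - κ) * lam) u w).const_mul (Real.exp (κ * (1 - κ) * W))).add
      ((i1 ((1 + κ) * lam) u w).const_mul (Real.exp (-κ * (1 + κ) * W))))
      (((const_ii 1 u w).sub (ind_ii hms u w)).const_mul (Real.exp ((1 + κ) * W))),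
    intervalIntegral.integral_add
    ((i1 ((1 - κ) * lam) u w).const_mul (Real.exp (κ * (1 - κ) * W)))
      ((i1 ((1 + κ) * lam) u w).const_mul (Real.exp (-κ * (1 + κ) * W))),
    intervalIntegral.integral_const_mul, intervalIntegral.integral_const_mul,
    intervalIntegral.integral_const_mul, intervalIntegral.integral_sub (const_ii 1 u w)
    (ind_ii hms u w)] at hint
  simp only [intervalIntegral.integral_const, smul_eq_mul, mul_one] at hint
  set Q := ∫ x in u..w, ind {x | X x < (1 - κ) * lam * V} x
  have e1 : Real.exp (κ * (1 - κ) * W) * (∫ x in u..w, Real.exp ((1 - κ) * lam * X x)) ≤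
      (w - u) * Real.exp (W / 2 - 3) := by
    calc _ ≤ Real.exp (κ * (1 - κ) * W) * ((w - u) *
        Real.exp (((1 - κ) * lam) ^ 2 * V / 2 + 1)) := by gcongr
      _ = (w - u) * Real.exp (κ * (1 - κ) * W + (((1 - κ) * lam) ^ 2 * V / 2 + 1)) := by
          rw [Real.exp_add (κ * (1 - κ) * W)]; ring
      _ ≤ _ := by
          have : 0 ≤ w - u := by linarith
          gcongr
          rw [hWd] at hW ⊢; nlinarith
  have e2 : Real.exp (-κ * (1 + κ) * W) * (∫ x in u..w, Real.exp ((1 + κ) * lam * X x)) ≤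
      (w - u) * Real.exp (W / 2 - 3) := by
    calc _ ≤ Real.exp (-κ * (1 + κ) * W) * ((w - u) *
        Real.exp (((1 + κ) * lam) ^ 2 * V / 2 + 1)) := by gcongr
      _ = (w - u) * Real.exp (-κ * (1 + κ) * W + (((1 + κ) * lam) ^ 2 * V / 2 + 1)) := by
          rw [Real.exp_add (-κ * (1 + κ) * W)]; ring
      _ ≤ _ := by
          have : 0 ≤ w - u := by linarith
          gcongr
          rw [hWd] at hW ⊢; nlinarith
  have h1e : 2 * Real.exp (W / 2 - 3) + Real.exp (W / 2 - 2) ≤ Real.exp (W / 2 - 1) := by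
    have a1 : Real.exp (W / 2 - 2) = Real.exp (W / 2 - 3) * Real.exp 1 := by
      rw [← Real.exp_add]; congr 1; ring
    have a2 : Real.exp (W / 2 - 1) = Real.exp (W / 2 - 3) * (Real.exp 1 * Real.exp 1) := by
      rw [← Real.exp_add, ← Real.exp_add]; congr 1; ring
    rw [a1, a2]
    have := Real.exp_one_gt_d9
    have := Real.exp_pos (W / 2 - 3)
    have : 2 + Real.exp 1 ≤ Real.exp 1 * Real.exp 1 := by nlinarith
    nlinarith
  have hlen : 0 ≤ w - u := by linarith
  have h3 : (w - u) * Real.exp (W / 2 - 2) ≤ Real.exp ((1 + κ) * W) * ((w - u) - Q) := by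
    have := mul_le_mul_of_nonneg_left h1e hlen
    linarith
  have e3 : Real.exp (W / 2 - 2) =
      Real.exp ((1 + κ) * W) * Real.exp (-(1 / 2 + κ) * W - 2) := by
    rw [← Real.exp_add]; congr 1; ring
  rw [e3] at h3
  have p := Real.exp_pos ((1 + κ) * W)
  have h4 : (w - u) * Real.exp (-(1 / 2 + κ) * W - 2) ≤ (w - u) - Q := by
    have : Real.exp ((1 + κ) * W) * ((w - u) * Real.exp (-(1 / 2 + κ) * W - 2)) ≤
      Real.exp ((1 + κ) * W) * ((w - u) - Q) := by linarith
    exact le_of_mul_le_mul_left this p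
  linarith

end LIL

namespace LIL

structure Sys where
  f : ℕ → ℝ → ℝ
  cf : ∀ n, Continuous (f n)
  α : ℝ
  β : ℝ
  hαβ : α < β
  C : ℝ
  hC : 1 ≤ C
  bd : ∀ n x, |f n x| ≤ C
  ρ : ℝ
  ρ0 : 0 < ρ
  ρ1 : ρ < 1
  v : ℝ
  v0 : 0 ≤ v
  n0 : ℕ
  H : ℕ → ℕ → ℝ → ℝ
  Hpos : ∀ a g u, α ≤ u → u ≤ β → 0 < H a g u
  Hanti : ∀ a g, AntitoneOn (H a g) (Set.Icc α β)
  Hmono : ∀ a a' g g' u, a ≤ a' → a + g' ≤ a' + g → α ≤ u → u ≤ β → H a' g' u ≤ H a g u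
  osc : ∀ a g n u w, n0 ≤ a → n + 2 * g ≤ a → α ≤ u → w ≤ β → w - u ≤ 2 * H a g u →
    ∀ x ∈ Set.Icc u w, ∀ y ∈ Set.Icc u w, |f n x - f n y| ≤ C * ρ ^ g
  i1 : ∀ a g n u w, n0 ≤ a → 2 * g ≤ a → a ≤ n → α ≤ u → u ≤ w → w ≤ β → H a g u ≤ w - u →
    |∫ x in u..w, f n x| ≤ C * ρ ^ g * (w - u)
  i2 : ∀ a g n m u w, n0 ≤ a → 2 * g ≤ a → a ≤ n → a ≤ m → α ≤ u → u ≤ w → w ≤ β →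
    H a g u ≤ w - u →
    |(∫ x in u..w, f n x * f m x) - (if n = m then v else 0) * (w - u)| ≤ C * ρ ^ g * (w - u)
  Hsmall : ∀ᶠ k : ℕ in atTop, ∀ a ≥ k ^ 4, H a (k ^ 2) α ≤ β - α

lemma expT (X : ℝ → ℝ) (hX : Continuous X) (D η ω u w : ℝ) (huw : u ≤ w) (hD : D ≤ 1)
    (hb : ∀ x, |X x| ≤ D) (h1 : |∫ x in u..w, X x| ≤ η * (w - u))
    (h2 : |(∫ x in u..w, X x ^ 2) - ω * (w - u)| ≤ η * (w - u)) :
    |(∫ x in u..w, Real.exp (X x)) - (1 + ω / 2) * (w - u)| ≤ (2 * η + D * (ω + η)) * (w - u) := by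
  have hpt : ∀ x, |Real.exp (X x) - (1 + X x + X x ^ 2 / 2)| ≤ D * X x ^ 2 := by
    intro x
    have := Real.exp_bound (x := X x) ((hb x).trans hD) (n := 3) (by norm_num)
    simp [Finset.sum_range_succ, Nat.factorial] at this
    refine this.trans ?_
    have h3 : |X x| ^ 3 = |X x| * X x ^ 2 := by rw [pow_succ', sq_abs]
    rw [h3]
    have := hb x
    have h4 := abs_nonneg (X x)
    have h5 := sq_nonneg (X x)
    have : |X x| * X x ^ 2 ≤ D * X x ^ 2 := by gcongr
    have : 0 ≤ |X x| * X x ^ 2 := by positivity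
    linarith
  have c1 : Continuous (fun x => Real.exp (X x)) := Real.continuous_exp.comp hX
  have c2 : Continuous (fun x => X x ^ 2) := hX.pow 2
  have ii1 := c1.intervalIntegrable u w (μ := volume)
  have ii2 := c2.intervalIntegrable u w (μ := volume)
  have ii3 := hX.intervalIntegrable u w (μ := volume)
  have up := intervalIntegral.integral_mono_on huw ii1
    (((const_ii 1 u w).add ii3).add (ii2.const_mul (1 / 2 + D))) (fun x _ => by
      have := (abs_le.1 (hpt x)).2
      show Real.exp (X x) ≤ 1 + X x + (1 / 2 + D) * X x ^ 2
      linarith)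
  have lo := intervalIntegral.integral_mono_on huw
    (((const_ii 1 u w).add ii3).add (ii2.const_mul (1 / 2 - D))) ii1 (fun x _ => by
      have := (abs_le.1 (hpt x)).1
      show 1 + X x + (1 / 2 - D) * X x ^ 2 ≤ Real.exp (X x)
      linarith)
  rw [intervalIntegral.integral_add ((const_ii 1 u w).add ii3) (ii2.const_mul _),
    intervalIntegral.integral_add (const_ii 1 u w) ii3, intervalIntegral.integral_const_mul] at up lo
  simp only [intervalIntegral.integral_const, smul_eq_mul, mul_one] at up lo
  have hD0 : 0 ≤ D := (abs_nonneg _).trans (hb 0)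
  set I1 := ∫ x in u..w, X x
  set I2 := ∫ x in u..w, X x ^ 2
  obtain ⟨a1, a2⟩ := abs_le.1 h1
  obtain ⟨b1, b2⟩ := abs_le.1 h2
  have hη : 0 ≤ η * (w - u) := (abs_nonneg _).trans h1
  have hDI : D * I2 ≤ D * (ω * (w - u) + η * (w - u)) := by
    gcongr; linarith
  rw [abs_le]
  constructor <;> nlinarith

namespace Sys
variable (S : Sys)

/-- block sums -/
noncomputable def T (M ℓ P i : ℕ) (x : ℝ) : ℝ := ∑ n ∈ Finset.range ℓ, S.f (M + i * P + n) x

lemma cT (M ℓ P i : ℕ) : Continuous (S.T M ℓ P i) :=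
  continuous_finsetSum _ (fun n _ => S.cf _)

lemma bT (M ℓ P i : ℕ) (x : ℝ) : |S.T M ℓ P i x| ≤ S.C * ℓ := by
  refine (Finset.abs_sum_le_sum_abs _ _).trans ?_
  refine (Finset.sum_le_sum (fun n _ => S.bd _ x)).trans ?_
  simp [mul_comm]

lemma oscT (M ℓ P i g : ℕ) (hM : S.n0 ≤ M) (hP : ℓ + 2 * g ≤ P) (u w : ℝ)
    (hu : S.α ≤ u) (hw : w ≤ S.β) (hH : w - u ≤ 2 * S.H (M + (i + 1) * P) g u) :
    ∀ x ∈ Set.Icc u w, ∀ y ∈ Set.Icc u w,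
      |S.T M ℓ P i x - S.T M ℓ P i y| ≤ ℓ * (S.C * S.ρ ^ g) := by
  intro x hx y hy
  unfold T
  rw [← Finset.sum_sub_distrib]
  refine (Finset.abs_sum_le_sum_abs _ _).trans ?_
  refine (Finset.sum_le_sum (g := fun _ => S.C * S.ρ ^ g) (fun n hn => ?_)).trans (by simp)
  refine S.osc (M + (i + 1) * P) g _ u w (by omega) ?_ hu hw hH x hx y hy
  have := Finset.mem_range.1 hn
  have : (i + 1) * P = i * P + P := by ring
  omega

lemma i1T (M ℓ P i g : ℕ) (hM : S.n0 ≤ M) (hg : 2 * g ≤ M) (u w : ℝ)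
    (hu : S.α ≤ u) (huw : u ≤ w) (hw : w ≤ S.β) (hH : S.H (M + i * P) g u ≤ w - u) :
    |∫ x in u..w, S.T M ℓ P i x| ≤ ℓ * (S.C * S.ρ ^ g) * (w - u) := by
  unfold T
  rw [intervalIntegral.integral_finsetSum
    (fun n _ => (S.cf _).intervalIntegrable _ _)]
  refine (Finset.abs_sum_le_sum_abs _ _).trans ?_
  refine (Finset.sum_le_sum (g := fun _ => S.C * S.ρ ^ g * (w - u)) (fun n hn => ?_)).trans
    (by simp; ring_nf; rfl)
  exact S.i1 (M + i * P) g _ u w (by omega) (by omega) (by omega) hu huw hw hH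

lemma i2T (M ℓ P i g : ℕ) (hM : S.n0 ≤ M) (hg : 2 * g ≤ M) (u w : ℝ)
    (hu : S.α ≤ u) (huw : u ≤ w) (hw : w ≤ S.β) (hH : S.H (M + i * P) g u ≤ w - u) :
    |(∫ x in u..w, S.T M ℓ P i x ^ 2) - S.v * ℓ * (w - u)| ≤
      (ℓ:ℝ) ^ 2 * (S.C * S.ρ ^ g) * (w - u) := by
  unfold T
  have e0 : ∀ x, (∑ n ∈ Finset.range ℓ, S.f (M + i * P + n) x) ^ 2 =
      ∑ n ∈ Finset.range ℓ, ∑ m ∈ Finset.range ℓ, S.f (M + i * P + n) x * S.f (M + i * P + m) x := by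
    intro x; rw [sq, Finset.sum_mul_sum]
  simp_rw [e0]
  have cc : ∀ n m, Continuous (fun x => S.f (M + i * P + n) x * S.f (M + i * P + m) x) :=
    fun n m => (S.cf _).mul (S.cf _)
  rw [intervalIntegral.integral_finsetSum
    (fun n _ => (continuous_finsetSum _ (fun m _ => cc n m)).intervalIntegrable _ _)]
  have e1 : S.v * ℓ * (w - u) = ∑ n ∈ Finset.range ℓ, ∑ m ∈ Finset.range ℓ,
      (if M + i * P + n = M + i * P + m then S.v else 0) * (w - u) := by
    rw [Finset.sum_congr rfl (g := fun _ => S.v * (w - u))]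
    · simp; ring
    · intro n hn
      simp [Finset.mem_range.1 hn]
  rw [e1, ← Finset.sum_sub_distrib]
  refine (Finset.abs_sum_le_sum_abs _ _).trans ?_
  refine (Finset.sum_le_sum (g := fun _ => ℓ * (S.C * S.ρ ^ g * (w - u))) (fun n hn => ?_)).trans
    (by simp; ring_nf; rfl)
  rw [intervalIntegral.integral_finsetSum (fun m _ => (cc n m).intervalIntegrable _ _),
    ← Finset.sum_sub_distrib]
  refine (Finset.abs_sum_le_sum_abs _ _).trans ?_
  refine (Finset.sum_le_sum (g := fun _ => S.C * S.ρ ^ g * (w - u)) (fun m hm => ?_)).trans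
    (by simp)
  exact S.i2 (M + i * P) g _ _ u w (by omega) (by omega) (by omega) (by omega) hu huw hw hH

/-- exponential estimates for a scaled block -/
lemma expBlock (M ℓ P i g : ℕ) (hM : S.n0 ≤ M) (hg : 2 * g ≤ M) (lam η : ℝ)
    (hD : |lam| * (S.C * ℓ) ≤ 1)
    (hη1 : |lam| * (ℓ * (S.C * S.ρ ^ g)) ≤ η)
    (hη2 : lam ^ 2 * ((ℓ:ℝ) ^ 2 * (S.C * S.ρ ^ g)) ≤ η)
    (u w : ℝ)
    (hu : S.α ≤ u) (huw : u ≤ w) (hw : w ≤ S.β) (hH : S.H (M + i * P) g u ≤ w - u) :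
    |(∫ x in u..w, Real.exp (lam * S.T M ℓ P i x)) - (1 + (lam ^ 2 * (S.v * ℓ)) / 2) * (w - u)|
      ≤ (2 * η + (|lam| * (S.C * ℓ)) * (lam ^ 2 * (S.v * ℓ) + η)) * (w - u) := by
  have hwu : 0 ≤ w - u := by linarith
  refine expT (fun x => lam * S.T M ℓ P i x) (continuous_const.mul (S.cT _ _ _ _)) _ η _ u w huw hD
    ?_ ?_ ?_
  · intro x
    rw [abs_mul]
    exact mul_le_mul_of_nonneg_left (S.bT _ _ _ _ _) (abs_nonneg _)
  · rw [intervalIntegral.integral_const_mul, abs_mul]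
    calc _ ≤ |lam| * (ℓ * (S.C * S.ρ ^ g) * (w - u)) :=
          mul_le_mul_of_nonneg_left (S.i1T M ℓ P i g hM hg u w hu huw hw hH) (abs_nonneg _)
      _ = |lam| * (ℓ * (S.C * S.ρ ^ g)) * (w - u) := by ring
      _ ≤ _ := by gcongr
  · simp_rw [mul_pow]
    rw [intervalIntegral.integral_const_mul, mul_assoc (lam ^ 2), ← mul_sub, abs_mul,
      abs_of_nonneg (sq_nonneg lam)]
    calc _ ≤ lam ^ 2 * ((ℓ:ℝ) ^ 2 * (S.C * S.ρ ^ g) * (w - u)) :=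
          mul_le_mul_of_nonneg_left (S.i2T M ℓ P i g hM hg u w hu huw hw hH) (sq_nonneg _)
      _ = lam ^ 2 * ((ℓ:ℝ) ^ 2 * (S.C * S.ρ ^ g)) * (w - u) := by ring
      _ ≤ _ := by gcongr

lemma one_add_ge (y : ℝ) (h1 : -(1/2) ≤ y) : Real.exp (y - 2 * y ^ 2) ≤ 1 + y := by
  have h0 : 0 < 1 + y := by linarith
  have h := Real.add_one_le_exp (-(y / (1 + y)))
  have e : -(y / (1 + y)) + 1 = (1 + y)⁻¹ := by field_simp; ring
  rw [e, Real.exp_neg] at h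
  have h2 := (inv_le_inv₀ h0 (Real.exp_pos _)).1 h
  refine le_trans (Real.exp_le_exp.2 ?_) h2
  rw [le_div_iff₀ h0]
  nlinarith [mul_nonneg (sq_nonneg y) (by linarith : (0:ℝ) ≤ 1 + 2 * y)]

/-- The full chain estimates with explicit errors. -/
lemma est1 (M ℓ P g m : ℕ) (hM : S.n0 ≤ M) (hg : 2 * g ≤ M) (hP : ℓ + 2 * g ≤ P) (lam η e : ℝ)
    (hD : |lam| * (S.C * ℓ) ≤ 1)
    (hη1 : |lam| * (ℓ * (S.C * S.ρ ^ g)) ≤ η)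
    (hη2 : lam ^ 2 * ((ℓ:ℝ) ^ 2 * (S.C * S.ρ ^ g)) ≤ η)
    (he : 2 * η + (|lam| * (S.C * ℓ)) * (lam ^ 2 * (S.v * ℓ) + η) ≤ e)
    (hsm : lam ^ 2 * (S.v * ℓ) + e ≤ 1 / 2)
    (hm : m * (e + 2 * (lam ^ 2 * (S.v * ℓ) + e) ^ 2 + 2 * η) ≤ 1)
    (u w : ℝ) (hu : S.α ≤ u) (huw : u ≤ w) (hw : w ≤ S.β) (hH : S.H M g u ≤ w - u) :
    (∀ t, ∫ x in u..w, ind {x | ∃ j < m, t ≤ ∑ l ∈ Finset.range (j + 1), lam * S.T M ℓ P l x} x ≤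
        (w - u) * Real.exp (-t + lam ^ 2 * (S.v * (m * ℓ)) / 2 + 1)) ∧
    (∫ x in u..w, Real.exp (∑ l ∈ Finset.range m, lam * S.T M ℓ P l x) ≤
        (w - u) * Real.exp (lam ^ 2 * (S.v * (m * ℓ)) / 2 + 1)) ∧
    ((w - u) * Real.exp (lam ^ 2 * (S.v * (m * ℓ)) / 2 - 1) ≤
      ∫ x in u..w, Real.exp (∑ l ∈ Finset.range m, lam * S.T M ℓ P l x)) := by
  set ω := lam ^ 2 * (S.v * ℓ) with hω
  have hω0 : 0 ≤ ω := by have := S.v0; positivity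
  have hC := S.hC
  have hρ := S.ρ0
  have hη0 : 0 ≤ η := le_trans (by positivity) hη1
  have he0 : 0 ≤ e := le_trans (by positivity) he
  have hwu : 0 ≤ w - u := by linarith
  have cX : ∀ i, Continuous (fun x => lam * S.T M ℓ P i x) :=
    fun i => continuous_const.mul (S.cT _ _ _ _)
  have hpos : ∀ i u, S.α ≤ u → u ≤ S.β → 0 < S.H (M + i * P) g u := fun i u => S.Hpos _ _ _
  have hanti : ∀ i, AntitoneOn (S.H (M + i * P) g) (Set.Icc S.α S.β) := fun i => S.Hanti _ _
  have hmono : ∀ i u, S.α ≤ u → u ≤ S.β → S.H (M + (i + 1) * P) g u ≤ S.H (M + i * P) g u := by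
    intro i u h1 h2
    have : (i + 1) * P = i * P + P := by ring
    exact S.Hmono _ _ _ _ _ (by omega) (by omega) h1 h2
  have hosc : ∀ i u w, S.α ≤ u → w ≤ S.β → w - u ≤ 2 * S.H (M + (i + 1) * P) g u →
      ∀ x ∈ Set.Icc u w, ∀ y ∈ Set.Icc u w, |lam * S.T M ℓ P i x - lam * S.T M ℓ P i y| ≤ η := by
    intro i u w hu hw hh x hx y hy
    rw [← mul_sub, abs_mul]
    exact (mul_le_mul_of_nonneg_left (S.oscT M ℓ P i g hM hP u w hu hw hh x hx y hy)
      (abs_nonneg _)).trans hη1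
  have hb : ∀ i u w, S.α ≤ u → u ≤ w → w ≤ S.β → S.H (M + i * P) g u ≤ w - u →
      |(∫ x in u..w, Real.exp (lam * S.T M ℓ P i x)) - (1 + ω / 2) * (w - u)| ≤ e * (w - u) := by
    intro i u w hu huw hw hh
    refine (S.expBlock M ℓ P i g hM hg lam η hD hη1 hη2 u w hu huw hw hh).trans ?_
    have : 0 ≤ w - u := by linarith
    gcongr
  have hexpU : ∀ i u w, S.α ≤ u → u ≤ w → w ≤ S.β → S.H (M + i * P) g u ≤ w - u →
      (∫ x in u..w, Real.exp (lam * S.T M ℓ P i x)) ≤ (w - u) * Real.exp (ω / 2 + e) := by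
    intro i u w hu huw hw hh
    have h1 := (abs_le.1 (hb i u w hu huw hw hh)).2
    have h2 := Real.add_one_le_exp (ω / 2 + e)
    have : 0 ≤ w - u := by linarith
    nlinarith
  have hexpL : ∀ i u w, S.α ≤ u → u ≤ w → w ≤ S.β → S.H (M + i * P) g u ≤ w - u →
      (w - u) * Real.exp (ω / 2 - e - 2 * (ω + e) ^ 2) ≤
      (∫ x in u..w, Real.exp (lam * S.T M ℓ P i x)) := by
    intro i u w hu huw hw hh
    have h1 := (abs_le.1 (hb i u w hu huw hw hh)).1
    have h2 := one_add_ge (ω / 2 - e) (by linarith)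
    have h3 : Real.exp (ω / 2 - e - 2 * (ω + e) ^ 2) ≤ Real.exp (ω / 2 - e - 2 * (ω / 2 - e) ^ 2) := by
      apply Real.exp_le_exp.2
      nlinarith
    have : 0 ≤ w - u := by linarith
    nlinarith
  have hH' : S.H (M + 0 * P) g u ≤ w - u := by simpa using hH
  have hsq : 0 ≤ (ω + e) ^ 2 := sq_nonneg _
  have hmm : (m:ℝ) * e + 2 * (m * (ω + e) ^ 2) + 2 * (m * η) ≤ 1 := by linarith
  have q1 : 0 ≤ (m:ℝ) * e := by positivity
  have q3 : 0 ≤ (m:ℝ) * η := by positivity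
  have q2 : 0 ≤ (m:ℝ) * (ω + e) ^ 2 := by positivity
  have eω : lam ^ 2 * (S.v * (m * ℓ)) = m * ω := by rw [hω]; ring
  rw [eω]
  refine ⟨fun t => ?_, ?_, ?_⟩
  · have := chainMax (fun i x => lam * S.T M ℓ P i x) cX (fun i => S.H (M + i * P) g) S.α S.β hpos
      hanti hmono η (ω / 2 + e) hη0 (by positivity) hosc hexpU m 0 t u w hu huw hw hH'
    simp only [zero_add] at this
    refine this.trans ?_
    gcongr ?_ * Real.exp ?_
    linarith
  · have := chainUp (fun i x => lam * S.T M ℓ P i x) cX (fun i => S.H (M + i * P) g) S.α S.β hpos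
      hanti hmono η (ω / 2 + e) hosc hexpU m 0 u w hu huw hw hH'
    simp only [zero_add] at this
    refine this.trans ?_
    gcongr ?_ * Real.exp ?_
    linarith
  · have := chainLow (fun i x => lam * S.T M ℓ P i x) cX (fun i => S.H (M + i * P) g) S.α S.β hpos
      hanti hmono η (ω / 2 - e - 2 * (ω + e) ^ 2) hosc hexpL m 0 u w hu huw hw hH'
    simp only [zero_add] at this
    refine le_trans ?_ this
    gcongr ?_ * Real.exp ?_
    linarith

end Sys
end LIL

namespace LIL
namespace Sys
variable (S : Sys)

lemma small_facts (θ ρ c0 : ℝ) (hθ : 1 < θ) (hρ0 : 0 < ρ) (hρ : ρ < 1) (hc : 0 < c0) :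
    ∀ᶠ k : ℕ in atTop, 2 ≤ k ∧ (k:ℝ) ^ 12 * ((Real.sqrt θ)⁻¹) ^ k ≤ c0 ∧
      2 * θ ^ (k + 1) * ρ ^ (k ^ 2) ≤ c0 := by
  have hs : 1 < Real.sqrt θ := by
    rw [Real.lt_sqrt] <;> linarith
  have h1 := tendsto_pow_const_mul_const_pow_of_abs_lt_one 12 (r := (Real.sqrt θ)⁻¹) (by
    rw [abs_of_pos (by positivity)]; exact inv_lt_one_of_one_lt₀ hs)
  have h2 : Tendsto (fun k : ℕ => θ * ρ ^ k) atTop (nhds (θ * 0)) :=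
    (tendsto_pow_atTop_nhds_zero_of_lt_one hρ0.le hρ).const_mul θ
  rw [mul_zero] at h2
  have h3 : Tendsto (fun k : ℕ => 2 * θ * (1/2:ℝ) ^ k) atTop (nhds (2 * θ * 0)) :=
    (tendsto_pow_atTop_nhds_zero_of_lt_one (by norm_num) (by norm_num)).const_mul _
  rw [mul_zero] at h3
  filter_upwards [eventually_ge_atTop 2, h1.eventually_le_const hc,
    h2.eventually_le_const (by norm_num : (0:ℝ) < 1 / 2), h3.eventually_le_const hc]
    with k k2 a1 a2 a3
  refine ⟨k2, a1, le_trans ?_ a3⟩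
  have : 2 * θ ^ (k + 1) * ρ ^ (k ^ 2) = 2 * θ * (θ * ρ ^ k) ^ k := by
    rw [mul_pow, ← pow_mul, sq]; ring
  rw [this]
  gcongr

lemma small_facts2 (θ ρ c0 : ℝ) (hθ : 1 < θ) (hρ0 : 0 < ρ) (hρ : ρ < 1) (hc : 0 < c0) :
    ∀ᶠ k : ℕ in atTop, 2 ≤ k ∧ ∀ N : ℕ, θ ^ k ≤ N → N ≤ 2 * θ ^ (k + 1) →
      1 ≤ (N:ℝ) ∧ (k / Real.sqrt N) * (k:ℝ) ^ 4 ≤ c0 ∧ (k / Real.sqrt N) ^ 2 * (k:ℝ) ^ 4 ≤ c0 ∧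
      N * ((k / Real.sqrt N) ^ 3 * (k:ℝ) ^ 8) ≤ c0 ∧ N * ((k / Real.sqrt N) ^ 4 * (k:ℝ) ^ 8) ≤ c0 ∧
      N * ρ ^ (k ^ 2) ≤ c0 := by
  filter_upwards [small_facts θ ρ c0 hθ hρ0 hρ hc] with k ⟨k2, h1, h2⟩
  refine ⟨k2, fun N hN1 hN2 => ?_⟩
  have hN : 1 ≤ (N:ℝ) := le_trans (one_le_pow₀ hθ.le) hN1
  have hk : (1:ℝ) ≤ k := by exact_mod_cast (by omega : 1 ≤ k)
  have hsN : 1 ≤ Real.sqrt N := by rw [Real.one_le_sqrt]; exact hN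
  set z := (Real.sqrt N)⁻¹ with hz
  have hz0 : 0 < z := by positivity
  have hz1 : z ≤ 1 := inv_le_one_of_one_le₀ hsN
  have hzN : N * z ^ 2 = 1 := by
    rw [hz, inv_pow, Real.sq_sqrt (by linarith)]; field_simp
  have hzr : z ≤ ((Real.sqrt θ)⁻¹) ^ k := by
    rw [inv_pow, hz]
    have h0 : 0 < Real.sqrt θ := Real.sqrt_pos.2 (by linarith)
    apply inv_anti₀ (by positivity)
    apply Real.le_sqrt_of_sq_le
    rw [← pow_mul, mul_comm, pow_mul, Real.sq_sqrt (by linarith)]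
    exact hN1
  have hkz : (k:ℝ) ^ 12 * z ≤ c0 := le_trans (by gcongr) h1
  have hle : ∀ a ≤ 12, (k:ℝ) ^ a * z ≤ c0 := fun a ha =>
    le_trans (by gcongr) hkz
  have hzz : z ^ 2 ≤ z := by nlinarith
  rw [div_eq_mul_inv, ← hz]
  refine ⟨hN, ?_, ?_, ?_, ?_, ?_⟩
  · calc k * z * (k:ℝ) ^ 4 = (k:ℝ) ^ 5 * z := by ring
      _ ≤ _ := hle 5 (by norm_num)
  · calc (k * z) ^ 2 * (k:ℝ) ^ 4 = (k:ℝ) ^ 6 * z ^ 2 := by ring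
      _ ≤ (k:ℝ) ^ 6 * z := by gcongr
      _ ≤ _ := hle 6 (by norm_num)
  · calc N * ((k * z) ^ 3 * (k:ℝ) ^ 8) = (k:ℝ) ^ 11 * z * (N * z ^ 2) := by ring
      _ ≤ _ := by rw [hzN, mul_one]; exact hle 11 (by norm_num)
  · calc N * ((k * z) ^ 4 * (k:ℝ) ^ 8) = (k:ℝ) ^ 12 * z ^ 2 * (N * z ^ 2) := by ring
      _ ≤ (k:ℝ) ^ 12 * z := by rw [hzN, mul_one]; gcongr
      _ ≤ _ := hkz
  · refine le_trans ?_ h2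
    gcongr

lemma numeric (C v r N Λ K a ℓ m c0 : ℝ) (hC : 1 ≤ C) (hv : 0 ≤ v) (hr : 0 ≤ r)
    (hc0p : 0 < c0) (hCc : C * c0 ≤ 1 / 100) (hvc : v * c0 ≤ 1 / 100)
    (hCvc : C * v * c0 ≤ 1 / 100) (hvvc : v ^ 2 * c0 ≤ 1 / 100) (hc1 : c0 ≤ 1 / 100)
    (hN : 1 ≤ N) (hK : 0 ≤ K)
    (fa : Λ * K ^ 4 ≤ c0) (fb : Λ ^ 2 * K ^ 4 ≤ c0) (fc : N * (Λ ^ 3 * K ^ 8) ≤ c0)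
    (fd : N * (Λ ^ 4 * K ^ 8) ≤ c0) (fe : N * r ≤ c0)
    (ha0 : 0 ≤ a) (hlam : a ≤ Λ) (hℓ0 : 0 ≤ ℓ) (hℓr : ℓ ≤ K ^ 4) (hm0 : 0 ≤ m) (hmr : m ≤ N) :
    ∃ η e : ℝ, a * (C * ℓ) ≤ 1 ∧ a * (ℓ * (C * r)) ≤ η ∧ a ^ 2 * (ℓ ^ 2 * (C * r)) ≤ η ∧
      2 * η + (a * (C * ℓ)) * (a ^ 2 * (v * ℓ) + η) ≤ e ∧ a ^ 2 * (v * ℓ) + e ≤ 1 / 2 ∧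
      m * (e + 2 * (a ^ 2 * (v * ℓ) + e) ^ 2 + 2 * η) ≤ 1 := by
  have hΛ0 : 0 ≤ Λ := ha0.trans hlam
  have haℓ : a * ℓ ≤ c0 := le_trans (by gcongr) fa
  have haℓ0 : 0 ≤ a * ℓ := by positivity
  obtain ⟨ε, hε⟩ : ∃ ε, ε = C * r := ⟨_, rfl⟩
  have hε0 : 0 ≤ ε := by rw [hε]; positivity
  have hNε : N * ε ≤ 1 / 100 := by
    calc N * ε = C * (N * r) := by rw [hε]; ring
      _ ≤ C * c0 := by gcongr
      _ ≤ _ := hCc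
  obtain ⟨ω, hω⟩ : ∃ ω, ω = a ^ 2 * (v * ℓ) := ⟨_, rfl⟩
  have hω0 : 0 ≤ ω := by rw [hω]; positivity
  have hω1 : ω ≤ 1 / 100 := by
    calc ω = v * (a ^ 2 * ℓ) := by rw [hω]; ring
      _ ≤ v * (Λ ^ 2 * K ^ 4) := by gcongr
      _ ≤ v * c0 := by gcongr
      _ ≤ _ := hvc
  have hNω2 : N * ω ^ 2 ≤ 1 / 100 := by
    calc N * ω ^ 2 = v ^ 2 * (N * (a ^ 4 * ℓ ^ 2)) := by rw [hω]; ring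
      _ ≤ v ^ 2 * (N * (Λ ^ 4 * (K ^ 4) ^ 2)) := by gcongr
      _ = v ^ 2 * (N * (Λ ^ 4 * (K ^ 8))) := by ring
      _ ≤ v ^ 2 * c0 := by gcongr
      _ ≤ _ := hvvc
  have hD : a * (C * ℓ) ≤ 1 := by
    calc a * (C * ℓ) = C * (a * ℓ) := by ring
      _ ≤ C * c0 := by gcongr
      _ ≤ 1 := by linarith
  obtain ⟨y, hy⟩ : ∃ y, y = a * (C * ℓ) * ω := ⟨_, rfl⟩
  have hy0 : 0 ≤ y := by rw [hy]; positivity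
  have hNy : N * y ≤ 1 / 100 := by
    calc N * y = C * v * (N * (a ^ 3 * ℓ ^ 2)) := by rw [hy, hω]; ring
      _ ≤ C * v * (N * (Λ ^ 3 * (K ^ 4) ^ 2)) := by gcongr
      _ = C * v * (N * (Λ ^ 3 * (K ^ 8))) := by ring
      _ ≤ C * v * c0 := by gcongr
      _ ≤ _ := hCvc
  have hy1 : y ≤ 1 / 100 := le_trans (le_mul_of_one_le_left hy0 hN) hNy
  have hε1 : ε ≤ 1 / 100 := le_trans (le_mul_of_one_le_left hε0 hN) hNε
  rw [← hε, ← hω]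
  refine ⟨ε, 3 * ε + y, hD, ?_, ?_, ?_, ?_, ?_⟩
  · calc a * (ℓ * ε) = (a * ℓ) * ε := by ring
      _ ≤ 1 * ε := by gcongr; linarith
      _ = ε := one_mul _
  · calc a ^ 2 * (ℓ ^ 2 * ε) = (a * ℓ) * (a * ℓ) * ε := by ring
      _ ≤ 1 * 1 * ε := by gcongr <;> linarith
      _ = ε := by ring
  · have : a * (C * ℓ) * ε ≤ 1 * ε := by gcongr
    rw [mul_add, ← hy]; linarith
  · linarith
  · have h1 : 2 * (ω + (3 * ε + y)) ^ 2 ≤ 4 * ω ^ 2 + (3 * ε + y) := by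
      have q : (3 * ε + y) ^ 2 ≤ (1 / 4) * (3 * ε + y) := by
        rw [sq]; gcongr; linarith
      nlinarith [sq_nonneg (ω - (3 * ε + y))]
    have h2 : m * (3 * ε + y + 2 * (ω + (3 * ε + y)) ^ 2 + 2 * ε) ≤
        N * (8 * ε + 2 * y + 4 * ω ^ 2) := by
      apply mul_le_mul hmr _ (by positivity) (by positivity)
      linarith
    refine h2.trans ?_
    linarith

lemma est2 (θ : ℝ) (hθ : 1 < θ) : ∀ᶠ k : ℕ in atTop, ∀ N : ℕ, θ ^ k ≤ N → N ≤ 2 * θ ^ (k + 1) →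
    ∀ M ℓ P m : ℕ, k ^ 4 ≤ M → ℓ ≤ k ^ 4 → ℓ + 2 * k ^ 2 ≤ P → m ≤ N → ∀ lam : ℝ,
    |lam| ≤ k / Real.sqrt N → ∀ u w : ℝ, S.α ≤ u → u ≤ w → w ≤ S.β → S.H M (k ^ 2) u ≤ w - u →
    (∀ t, ∫ x in u..w, ind {x | ∃ j < m, t ≤ ∑ l ∈ Finset.range (j + 1), lam * S.T M ℓ P l x} x ≤
        (w - u) * Real.exp (-t + lam ^ 2 * (S.v * (m * ℓ)) / 2 + 1)) ∧
    (∫ x in u..w, Real.exp (∑ l ∈ Finset.range m, lam * S.T M ℓ P l x) ≤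
        (w - u) * Real.exp (lam ^ 2 * (S.v * (m * ℓ)) / 2 + 1)) ∧
    ((w - u) * Real.exp (lam ^ 2 * (S.v * (m * ℓ)) / 2 - 1) ≤
      ∫ x in u..w, Real.exp (∑ l ∈ Finset.range m, lam * S.T M ℓ P l x)) := by
  have hC := S.hC
  have hv := S.v0
  have hρ := S.ρ0
  obtain ⟨Z, hZ⟩ : ∃ Z, Z = S.C + S.v + 1 := ⟨_, rfl⟩
  have hZ2 : 2 ≤ Z := by linarith
  obtain ⟨c0, hc0⟩ : ∃ c0, c0 = 1 / (100 * Z ^ 2) := ⟨_, rfl⟩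
  have hc0p : 0 < c0 := by rw [hc0]; positivity
  have hcZ2 : Z ^ 2 * c0 = 1 / 100 := by rw [hc0]; field_simp
  have hcZ : Z * c0 ≤ 1 / 100 := by rw [← hcZ2]; gcongr; nlinarith
  have hCc : S.C * c0 ≤ 1 / 100 := le_trans (by gcongr; linarith) hcZ
  have hvc : S.v * c0 ≤ 1 / 100 := le_trans (by gcongr; linarith) hcZ
  have hCvc : S.C * S.v * c0 ≤ 1 / 100 := by
    rw [← hcZ2, sq]; gcongr <;> linarith
  have hvvc : S.v ^ 2 * c0 ≤ 1 / 100 := by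
    rw [← hcZ2]; gcongr; linarith
  have hc1 : c0 ≤ 1 / 100 := le_trans (le_mul_of_one_le_left hc0p.le (by linarith)) hcZ
  filter_upwards [small_facts2 θ S.ρ c0 hθ S.ρ0 S.ρ1 hc0p, eventually_ge_atTop S.n0]
    with k ⟨k2, hk⟩ hkn N hN1 hN2 M ℓ P m hM hℓ hP hm lam hlam u w hu huw hw hH
  obtain ⟨hN, fa, fb, fc, fd, fe⟩ := hk N hN1 hN2
  have hn0 : S.n0 ≤ M := by
    calc S.n0 ≤ k := hkn
      _ ≤ k ^ 4 := Nat.le_self_pow (by norm_num) k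
      _ ≤ M := hM
  have hg : 2 * k ^ 2 ≤ M := by
    refine le_trans ?_ hM
    calc 2 * k ^ 2 ≤ k ^ 2 * k ^ 2 := by gcongr; nlinarith
      _ = k ^ 4 := by ring
  obtain ⟨η, e, g1, g2, g3, g4, g5, g6⟩ := numeric S.C S.v (S.ρ ^ (k ^ 2)) N (k / Real.sqrt N) k
    |lam| ℓ m c0 hC hv (by positivity) hc0p hCc hvc hCvc hvvc hc1 hN (by positivity) fa fb fc fd fe
    (abs_nonneg _) hlam (by positivity) (by exact_mod_cast hℓ) (by positivity)
    (by exact_mod_cast hm)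
  rw [sq_abs] at g3 g4 g5 g6
  exact S.est1 M ℓ P (k ^ 2) m hn0 hg hP lam η e g1 g2 g3 g4 g5 g6 u w hu huw hw hH

end Sys
end LIL

namespace LIL

lemma bc (α β : ℝ) (hαβ : α ≤ β) (E : ℕ → Set ℝ) (hE : ∀ k, MeasurableSet (E k)) (b : ℕ → ℝ)
    (hb : Summable b) (h : ∀ᶠ k in atTop, ∫ x in α..β, ind (E k) x ≤ b k) :
    ∀ᵐ x ∂volume, x ∈ Set.Icc α β → ∀ᶠ k in atTop, x ∉ E k := by
  obtain ⟨k0, hk0⟩ := eventually_atTop.1 h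
  have hfin : ∀ k, (volume.restrict (Set.Icc α β)) (E (k + k0)) ≤ ENNReal.ofReal (b (k + k0)) := by
    intro k
    have h1 := hk0 (k + k0) (by omega)
    rw [intervalIntegral.integral_of_le hαβ, ← integral_Icc_eq_integral_Ioc] at h1
    unfold ind at h1
    rw [integral_indicator (hE _)] at h1
    simp only [integral_const, smul_eq_mul, mul_one] at h1
    rw [Measure.restrict_restrict (hE _)] at h1
    rw [Measure.restrict_apply (hE _)]
    refine ENNReal.le_ofReal_iff_toReal_le ?_ ?_ |>.2 ?_
    · exact ((measure_mono Set.inter_subset_right).trans_lt (by simp)).ne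
    · refine le_trans ?_ h1
      exact measureReal_nonneg
    · simpa [Measure.real] using h1
  have hs : ∑' k, (volume.restrict (Set.Icc α β)) (E (k + k0)) ≠ ⊤ := by
    refine ne_top_of_le_ne_top ?_ (ENNReal.tsum_le_tsum hfin)
    exact ((summable_nat_add_iff k0).2 hb).tsum_ofReal_ne_top
  have := ae_eventually_notMem hs
  rw [ae_restrict_iff' measurableSet_Icc] at this
  filter_upwards [this] with x hx hxI
  obtain ⟨k1, hk1⟩ := eventually_atTop.1 (hx hxI)
  refine eventually_atTop.2 ⟨k1 + k0, fun k hk => ?_⟩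
  have := hk1 (k - k0) (by omega)
  rwa [Nat.sub_add_cancel (by omega)] at this

namespace Sys
variable (S : Sys)

lemma maxBC (θ : ℝ) (hθ : 1 < θ) (N M ℓ P m : ℕ → ℕ) (lam t : ℕ → ℝ)
    (hN1 : ∀ k, θ ^ k ≤ N k) (hN2 : ∀ k, N k ≤ 2 * θ ^ (k + 1))
    (hM : ∀ᶠ k in atTop, k ^ 4 ≤ M k) (hℓ : ∀ᶠ k in atTop, ℓ k ≤ k ^ 4)
    (hP : ∀ᶠ k in atTop, ℓ k + 2 * k ^ 2 ≤ P k) (hm : ∀ᶠ k in atTop, m k ≤ N k)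
    (hlam : ∀ᶠ k : ℕ in atTop, |lam k| ≤ k / Real.sqrt (N k))
    (b : ℕ → ℝ) (hb : Summable b)
    (hexp : ∀ᶠ k in atTop, Real.exp (-t k + (lam k) ^ 2 * (S.v * (m k * ℓ k)) / 2) ≤ b k) :
    ∀ᵐ x ∂volume, x ∈ Set.Icc S.α S.β → ∀ᶠ k in atTop, ∀ j < m k,
      ∑ l ∈ Finset.range (j + 1), lam k * S.T (M k) (ℓ k) (P k) l x < t k := by
  have := bc S.α S.β S.hαβ.le
    (fun k => {x | ∃ j < m k, t k ≤ ∑ l ∈ Finset.range (j + 1), lam k * S.T (M k) (ℓ k) (P k) l x})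
    (fun k => by
      have := chainMax_meas (fun l x => lam k * S.T (M k) (ℓ k) (P k) l x)
        (fun i => continuous_const.mul (S.cT _ _ _ _)) (m k) 0 (t k)
      simpa using this)
    (fun k => (S.β - S.α) * Real.exp 1 * b k) (hb.mul_left _) ?_
  · filter_upwards [this] with x hx hxI
    filter_upwards [hx hxI] with k hk j hj
    by_contra hcon
    push Not at hcon
    exact hk ⟨j, hj, hcon⟩
  · filter_upwards [hM, hℓ, hP, hm, hlam, S.est2 θ hθ, S.Hsmall, hexp] with k h1 h2 h3 h4 h5 h6 h7 h8
    have hba := S.hαβ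
    have := (h6 (N k) (hN1 k) (hN2 k) (M k) (ℓ k) (P k) (m k) h1 h2 h3 h4 (lam k) h5 S.α S.β
      le_rfl hba.le le_rfl (h7 _ h1)).1 (t k)
    refine this.trans ?_
    rw [Real.exp_add, mul_comm (Real.exp (-t k + _)), mul_assoc]
    have : 0 ≤ S.β - S.α := by linarith
    gcongr

/-- number cutoffs -/
noncomputable def Nk (θ : ℝ) (k : ℕ) : ℕ := ⌈θ ^ (k + 1)⌉₊

lemma Nk_ge (θ : ℝ) (k : ℕ) : θ ^ (k + 1) ≤ Nk θ k := Nat.le_ceil _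

lemma Nk_ge' (θ : ℝ) (hθ : 1 < θ) (k : ℕ) : θ ^ k ≤ Nk θ k :=
  le_trans (pow_le_pow_right₀ hθ.le (by omega)) (Nk_ge θ k)

lemma Nk_le (θ : ℝ) (hθ : 1 < θ) (k : ℕ) : (Nk θ k : ℝ) ≤ θ ^ (k + 1) + 1 :=
  (Nat.ceil_lt_add_one (by positivity)).le

lemma Nk_le' (θ : ℝ) (hθ : 1 < θ) (k : ℕ) : (Nk θ k : ℝ) ≤ 2 * θ ^ (k + 1) := by
  have := Nk_le θ hθ k
  have : (1:ℝ) ≤ θ ^ (k + 1) := one_le_pow₀ hθ.le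
  linarith

lemma Nk_pos (θ : ℝ) (hθ : 1 < θ) (k : ℕ) : (0:ℝ) < Nk θ k :=
  lt_of_lt_of_le (by positivity) (Nk_ge θ k)

lemma logk_tendsto : Tendsto (fun k : ℕ => Real.log k) atTop atTop :=
  Real.tendsto_log_atTop.comp tendsto_natCast_atTop_atTop

lemma mainBC1 (θ : ℝ) (hθ : 1 < θ) (M : ℕ → ℕ) (hM : ∀ᶠ k in atTop, k ^ 4 ≤ M k) (τ V sg : ℝ)
    (hτ : 0 < τ) (hV : 0 < V) (hvV : S.v ≤ V) (hτV : 2 * V < τ ^ 2) (hsg : |sg| = 1) :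
    ∀ᵐ x ∂volume, x ∈ Set.Icc S.α S.β → ∀ᶠ k in atTop, ∀ j < Nk θ k / (k ^ 4 + 2 * k ^ 2),
      sg * ∑ l ∈ Finset.range (j + 1), S.T (M k) (k ^ 4) (k ^ 4 + 2 * k ^ 2) l x <
        τ * Real.sqrt (Nk θ k * Real.log k) := by
  have hev : ∀ᶠ k : ℕ in atTop, 1 ≤ Real.log k := logk_tendsto.eventually_ge_atTop 1
  have hlk : ∀ᶠ k : ℕ in atTop, (τ / V) * Real.sqrt (Real.log k) ≤ k := by
    have h1 : Tendsto (fun k : ℕ => (τ / V) ^ 2 * (Real.log k / (k:ℝ))) atTop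
        (nhds ((τ / V) ^ 2 * 0)) := by
      refine Tendsto.const_mul _ ?_
      exact (Real.isLittleO_log_id_atTop.tendsto_div_nhds_zero).comp tendsto_natCast_atTop_atTop
    rw [mul_zero] at h1
    filter_upwards [h1.eventually_le_const one_pos, eventually_ge_atTop 1, hev] with k h2 h3 h4
    have hk : (1:ℝ) ≤ k := by exact_mod_cast h3
    have h5 : (τ / V) ^ 2 * Real.log k ≤ k := by
      rw [← mul_div_assoc, div_le_one (by linarith)] at h2; exact h2
    apply le_of_sq_le_sq _ (by linarith)
    rw [mul_pow, Real.sq_sqrt (by linarith)]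
    nlinarith
  have hsum : Summable (fun k : ℕ => (k:ℝ) ^ (-(τ ^ 2 / (2 * V)))) := by
    rw [Real.summable_nat_rpow]
    have : 1 < τ ^ 2 / (2 * V) := by rw [one_lt_div (by positivity)]; exact hτV
    linarith
  have := S.maxBC θ hθ (Nk θ) M (fun k => k ^ 4) (fun k => k ^ 4 + 2 * k ^ 2)
    (fun k => Nk θ k / (k ^ 4 + 2 * k ^ 2))
    (fun k => sg * ((τ / V) * Real.sqrt (Real.log k / Nk θ k))) (fun k => τ ^ 2 / V * Real.log k)
    (Nk_ge' θ hθ) (Nk_le' θ hθ) hM (Eventually.of_forall fun k => le_rfl)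
    (Eventually.of_forall fun k => le_rfl)
    (Eventually.of_forall fun k => Nat.div_le_self _ _) ?_ _ hsum ?_
  · filter_upwards [this] with x hx hxI
    filter_upwards [hx hxI, hev] with k hk hlog j hj
    have h1 := hk j hj
    rw [← Finset.mul_sum] at h1
    have hN := Nk_pos θ hθ k
    set Y := ∑ l ∈ Finset.range (j + 1), S.T (M k) (k ^ 4) (k ^ 4 + 2 * k ^ 2) l x
    have hq : 0 < Real.sqrt (Real.log k / Nk θ k) := Real.sqrt_pos.2 (by positivity)
    have e1 : Real.sqrt (Real.log k / Nk θ k) * Real.sqrt (Nk θ k * Real.log k) = Real.log k := by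
      rw [← Real.sqrt_mul (by positivity)]
      have : Real.log k / Nk θ k * (Nk θ k * Real.log k) = Real.log k ^ 2 := by field_simp
      rw [this, Real.sqrt_sq (by linarith)]
    have e2 : (τ / V * Real.sqrt (Real.log k / Nk θ k)) * (sg * Y) <
        (τ / V * Real.sqrt (Real.log k / Nk θ k)) * (τ * Real.sqrt (Nk θ k * Real.log k)) := by
      calc _ = sg * (τ / V * Real.sqrt (Real.log k / Nk θ k)) * Y := by ring
        _ < τ ^ 2 / V * Real.log k := h1
        _ = τ ^ 2 / V * (Real.sqrt (Real.log k / Nk θ k) * Real.sqrt (Nk θ k * Real.log k)) := by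
            rw [e1]
        _ = _ := by ring
    exact lt_of_mul_lt_mul_left e2 (by positivity)
  · filter_upwards [hlk, hev] with k h1 h2
    rw [abs_mul, hsg, one_mul, abs_of_nonneg (by positivity), Real.sqrt_div (by linarith),
      ← mul_div_assoc]
    gcongr
  · filter_upwards [hev, eventually_ge_atTop 1] with k h2 h3
    have hk : (0:ℝ) < k := by exact_mod_cast h3
    rw [Real.rpow_def_of_pos hk]
    apply Real.exp_le_exp.2
    have hN := Nk_pos θ hθ k
    have hsg2 : sg ^ 2 = 1 := by rw [← sq_abs, hsg]; norm_num
    have hmm : ((Nk θ k / (k ^ 4 + 2 * k ^ 2) : ℕ) : ℝ) * ((k ^ 4 : ℕ) : ℝ) ≤ Nk θ k := by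
      have : Nk θ k / (k ^ 4 + 2 * k ^ 2) * k ^ 4 ≤ Nk θ k :=
        le_trans (Nat.mul_le_mul_left _ (by omega)) (Nat.div_mul_le_self _ (k ^ 4 + 2 * k ^ 2))
      exact_mod_cast this
    rw [mul_pow, hsg2, one_mul, mul_pow, Real.sq_sqrt (by positivity)]
    have hv := S.v0
    calc _ ≤ -(τ ^ 2 / V * Real.log k) + (τ / V) ^ 2 * (Real.log k / Nk θ k) *
        (V * Nk θ k) / 2 := by gcongr
      _ = _ := by field_simp; ring

lemma gapBC1 (θ : ℝ) (hθ : 1 < θ) (M : ℕ → ℕ) (hM : ∀ᶠ k in atTop, k ^ 4 ≤ M k) (sg : ℝ)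
    (hsg : |sg| = 1) :
    ∀ᵐ x ∂volume, x ∈ Set.Icc S.α S.β → ∀ᶠ k in atTop, ∀ j < Nk θ k / (k ^ 4 + 2 * k ^ 2),
      sg * ∑ l ∈ Finset.range (j + 1), S.T (M k + k ^ 4) (2 * k ^ 2) (k ^ 4 + 2 * k ^ 2) l x <
        Real.sqrt (Nk θ k) := by
  have hsum : Summable (fun k : ℕ => Real.exp S.v * Real.exp (-k)) :=
    Real.summable_exp_neg_nat.mul_left _
  have hk2 : ∀ k : ℕ, 2 ≤ k → 2 * k ^ 2 ≤ k ^ 4 := fun k hk => by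
    calc 2 * k ^ 2 ≤ k ^ 2 * k ^ 2 := by gcongr; nlinarith
      _ = k ^ 4 := by ring
  have := S.maxBC θ hθ (Nk θ) (fun k => M k + k ^ 4) (fun k => 2 * k ^ 2)
    (fun k => k ^ 4 + 2 * k ^ 2)
    (fun k => Nk θ k / (k ^ 4 + 2 * k ^ 2))
    (fun k => sg * (k / Real.sqrt (Nk θ k))) (fun k => k)
    (Nk_ge' θ hθ) (Nk_le' θ hθ) (Eventually.of_forall fun k => by simp) 
    (by filter_upwards [eventually_ge_atTop 2] with k hk using hk2 k hk)
    (by filter_upwards [eventually_ge_atTop 2] with k hk; have := hk2 k hk; omega)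
    (Eventually.of_forall fun k => Nat.div_le_self _ _) ?_ _ hsum ?_
  · filter_upwards [this] with x hx hxI
    filter_upwards [hx hxI, eventually_ge_atTop 1] with k hk hk1 j hj
    have h1 := hk j hj
    rw [← Finset.mul_sum] at h1
    have hN := Nk_pos θ hθ k
    have hkp : (0:ℝ) < k := by exact_mod_cast hk1
    have hs : 0 < Real.sqrt (Nk θ k) := Real.sqrt_pos.2 hN
    set Y := ∑ l ∈ Finset.range (j + 1), S.T (M k + k ^ 4) (2 * k ^ 2) (k ^ 4 + 2 * k ^ 2) l x
    have e2 : (k / Real.sqrt (Nk θ k)) * (sg * Y) < (k / Real.sqrt (Nk θ k)) * Real.sqrt (Nk θ k) := by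
      calc _ = sg * (k / Real.sqrt (Nk θ k)) * Y := by ring
        _ < k := h1
        _ = _ := by field_simp
    exact lt_of_mul_lt_mul_left e2 (by positivity)
  · refine Eventually.of_forall fun k => ?_
    rw [abs_mul, hsg, one_mul, abs_of_nonneg (by positivity)]
  · filter_upwards [eventually_ge_atTop 1] with k h3
    have hk : (0:ℝ) < k := by exact_mod_cast h3
    rw [← Real.exp_add]
    apply Real.exp_le_exp.2
    have hN := Nk_pos θ hθ k
    have hsg2 : sg ^ 2 = 1 := by rw [← sq_abs, hsg]; norm_num
    have hmm : (k:ℝ) ^ 2 * (((Nk θ k / (k ^ 4 + 2 * k ^ 2) : ℕ) : ℝ) * ((2 * k ^ 2 : ℕ) : ℝ))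
        ≤ 2 * Nk θ k := by
      have : k ^ 2 * (Nk θ k / (k ^ 4 + 2 * k ^ 2) * (2 * k ^ 2)) ≤ 2 * Nk θ k := by
        calc _ = 2 * (Nk θ k / (k ^ 4 + 2 * k ^ 2) * k ^ 4) := by ring
          _ ≤ _ := Nat.mul_le_mul_left _ (le_trans (Nat.mul_le_mul_left _ (by omega))
            (Nat.div_mul_le_self _ (k ^ 4 + 2 * k ^ 2)))
      exact_mod_cast this
    rw [mul_pow, hsg2, one_mul, div_pow, Real.sq_sqrt (by positivity)]
    have hv := S.v0
    have : (k:ℝ) ^ 2 / (Nk θ k) * (S.v * (((Nk θ k / (k ^ 4 + 2 * k ^ 2) : ℕ) : ℝ) *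
        ((2 * k ^ 2 : ℕ) : ℝ))) / 2 ≤ S.v := by
      calc _ = S.v / (2 * Nk θ k) * ((k:ℝ) ^ 2 * (((Nk θ k / (k ^ 4 + 2 * k ^ 2) : ℕ) : ℝ) *
        ((2 * k ^ 2 : ℕ) : ℝ))) := by field_simp
        _ ≤ S.v / (2 * Nk θ k) * (2 * Nk θ k) := by gcongr
        _ = S.v := by field_simp
    linarith

lemma abs_of_two {p : Prop} {y c : ℝ} (h1 : p → 1 * y < c) (h2 : p → -1 * y < c) (hp : p) :
    |y| ≤ c := by
  rw [abs_le]; constructor <;> linarith [h1 hp, h2 hp]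

lemma gapBC (θ : ℝ) (hθ : 1 < θ) (M : ℕ → ℕ) (hM : ∀ᶠ k in atTop, k ^ 4 ≤ M k) :
    ∀ᵐ x ∂volume, x ∈ Set.Icc S.α S.β → ∀ᶠ k in atTop, ∀ j ≤ Nk θ k / (k ^ 4 + 2 * k ^ 2),
      |∑ l ∈ Finset.range j, S.T (M k + k ^ 4) (2 * k ^ 2) (k ^ 4 + 2 * k ^ 2) l x| ≤
        Real.sqrt (Nk θ k) := by
  filter_upwards [S.gapBC1 θ hθ M hM 1 (by simp), S.gapBC1 θ hθ M hM (-1) (by simp)]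
    with x h1 h2 hx
  filter_upwards [h1 hx, h2 hx] with k a1 a2 j hj
  rcases j with _ | j
  · simp
  · exact abs_of_two (a1 j) (a2 j) (by omega)

lemma mainBC (θ : ℝ) (hθ : 1 < θ) (M : ℕ → ℕ) (hM : ∀ᶠ k in atTop, k ^ 4 ≤ M k) (τ V : ℝ)
    (hτ : 0 < τ) (hV : 0 < V) (hvV : S.v ≤ V) (hτV : 2 * V < τ ^ 2) :
    ∀ᵐ x ∂volume, x ∈ Set.Icc S.α S.β → ∀ᶠ k in atTop, ∀ j ≤ Nk θ k / (k ^ 4 + 2 * k ^ 2),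
      |∑ l ∈ Finset.range j, S.T (M k) (k ^ 4) (k ^ 4 + 2 * k ^ 2) l x| ≤
        τ * Real.sqrt (Nk θ k * Real.log k) := by
  filter_upwards [S.mainBC1 θ hθ M hM τ V 1 hτ hV hvV hτV (by simp),
    S.mainBC1 θ hθ M hM τ V (-1) hτ hV hvV hτV (by simp)]
    with x h1 h2 hx
  filter_upwards [h1 hx, h2 hx] with k a1 a2 j hj
  rcases j with _ | j
  · simp; positivity
  · exact abs_of_two (a1 j) (a2 j) (by omega)

/-- partial sums -/
noncomputable def R (n : ℕ) (x : ℝ) : ℝ := ∑ i ∈ Finset.range n, S.f i x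

lemma sum_bd (M n : ℕ) (x : ℝ) : |∑ i ∈ Finset.range n, S.f (M + i) x| ≤ S.C * n := by
  refine (Finset.abs_sum_le_sum_abs _ _).trans ?_
  refine (Finset.sum_le_sum (fun n _ => S.bd _ x)).trans ?_
  simp [mul_comm]

lemma sum_blocks (M L g : ℕ) (j : ℕ) (x : ℝ) :
    ∑ i ∈ Finset.range (j * (L + g)), S.f (M + i) x =
      ∑ l ∈ Finset.range j, S.T M L (L + g) l x +
      ∑ l ∈ Finset.range j, S.T (M + L) g (L + g) l x := by
  induction j with
  | zero => simp
  | succ j ih =>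
    rw [add_mul, one_mul, Finset.sum_range_add, Finset.sum_range_add, ih, Finset.sum_range_succ,
      Finset.sum_range_succ]
    unfold T
    have e1 : ∑ x_1 ∈ Finset.range L, S.f (M + (j * (L + g) + x_1)) x =
      ∑ n ∈ Finset.range L, S.f (M + j * (L + g) + n) x :=
      Finset.sum_congr rfl (fun l _ => by congr 1; ring)
    have e2 : ∑ x_1 ∈ Finset.range g, S.f (M + (j * (L + g) + (L + x_1))) x =
      ∑ n ∈ Finset.range g, S.f (M + L + j * (L + g) + n) x :=
      Finset.sum_congr rfl (fun l _ => by congr 1; ring)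
    rw [e1, e2]; ring

end Sys
end LIL

namespace LIL
namespace Sys
variable (S : Sys)

lemma lower_order (θ : ℝ) (hθ : 1 < θ) (K ε : ℝ) (hK : 0 < K) (hε : 0 < ε) :
    ∀ᶠ k : ℕ in atTop, K * (k:ℝ) ^ 4 + K * Real.sqrt (Nk θ k) ≤
      ε * Real.sqrt (Nk θ k * Real.log k) := by
  have h1 : Tendsto (fun k : ℕ => (k:ℝ) ^ 8 / θ ^ k) atTop (nhds 0) :=
    tendsto_pow_const_div_const_pow_of_one_lt 8 hθ
  filter_upwards [h1.eventually_le_const one_pos,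
    logk_tendsto.eventually_ge_atTop ((2 * K / ε) ^ 2)] with k h1 h2
  have hN := Nk_pos θ hθ k
  have h3 : (k:ℝ) ^ 8 ≤ Nk θ k := by
    rw [div_le_one (by positivity)] at h1
    exact h1.trans (Nk_ge' θ hθ k)
  have h4 : (k:ℝ) ^ 4 ≤ Real.sqrt (Nk θ k) := by
    apply Real.le_sqrt_of_sq_le
    calc _ = (k:ℝ) ^ 8 := by ring
      _ ≤ _ := h3
  have h5 : 2 * K / ε ≤ Real.sqrt (Real.log k) := Real.le_sqrt_of_sq_le h2
  rw [Real.sqrt_mul hN.le]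
  calc _ ≤ K * Real.sqrt (Nk θ k) + K * Real.sqrt (Nk θ k) := by gcongr
    _ = ε * (Real.sqrt (Nk θ k) * (2 * K / ε)) := by field_simp; ring
    _ ≤ _ := by gcongr

lemma exists_mid {v τ : ℝ} (hv : 0 ≤ v) (hτ : 0 < τ) (h : 2 * v < τ ^ 2) :
    ∃ τ1, 0 < τ1 ∧ τ1 < τ ∧ 2 * v < τ1 ^ 2 := by
  have h1 : Real.sqrt (2 * v) < τ := by rw [Real.sqrt_lt' hτ]; exact h
  obtain ⟨τ1, h2, h3⟩ := exists_between h1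
  have h0 := Real.sqrt_nonneg (2 * v)
  refine ⟨τ1, by linarith, h3, ?_⟩
  rwa [Real.sqrt_lt' (by linarith)] at h2

lemma U1 (θ : ℝ) (hθ : 1 < θ) (τ : ℝ) (hτ : 0 < τ) (h : 2 * S.v < τ ^ 2) :
    ∀ᵐ x ∂volume, x ∈ Set.Icc S.α S.β → ∀ᶠ k in atTop, ∀ n ≤ Nk θ k,
      |S.R n x| ≤ τ * Real.sqrt (Nk θ k * Real.log k) := by
  obtain ⟨τ1, h1, h2, h3⟩ := exists_mid S.v0 hτ h
  obtain ⟨V, h4, h5⟩ := exists_between h3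
  have hv0 := S.v0
  have hC := S.hC
  filter_upwards [S.mainBC θ hθ (fun k => k ^ 4) (Eventually.of_forall fun k => le_rfl) τ1 (V / 2) h1
    (by linarith) (by linarith) (by linarith),
    S.gapBC θ hθ (fun k => k ^ 4) (Eventually.of_forall fun k => le_rfl)] with x a1 a2 hx
  filter_upwards [a1 hx, a2 hx, lower_order θ hθ (4 * S.C) (τ - τ1) (by linarith) (by linarith),
    eventually_ge_atTop 1] with k b1 b2 b3 hk n hn
  have hk2 : (k:ℝ) ^ 2 ≤ (k:ℝ) ^ 4 := by
    apply pow_le_pow_right₀ _ (by norm_num); exact_mod_cast hk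
  have hsq := Real.sqrt_nonneg (Nk θ k : ℝ)
  have hsq2 := Real.sqrt_nonneg (Nk θ k * Real.log k : ℝ)
  rcases le_total n (k ^ 4) with hc | hc
  · have := S.sum_bd 0 n x
    simp only [zero_add] at this
    refine this.trans ?_
    have hn' : (n:ℝ) ≤ (k:ℝ) ^ 4 := by exact_mod_cast hc
    have : S.C * n ≤ S.C * (k:ℝ) ^ 4 := by gcongr
    have := mul_nonneg h1.le hsq2
    have : 0 ≤ (k:ℝ) ^ 4 := by positivity
    nlinarith
  · set P := k ^ 4 + 2 * k ^ 2 with hP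
    have hPpos : 0 < P := by positivity
    obtain ⟨j, r, hn2, hjN, hrP⟩ : ∃ j r, n = k ^ 4 + (j * P + r) ∧ j ≤ Nk θ k / P ∧ r < P := by
      refine ⟨(n - k ^ 4) / P, (n - k ^ 4) % P, ?_, Nat.div_le_div_right (by omega),
        Nat.mod_lt _ hPpos⟩
      rw [Nat.div_add_mod']; omega
    have e : S.R n x = ∑ i ∈ Finset.range (k ^ 4), S.f (0 + i) x +
        ((∑ l ∈ Finset.range j, S.T (k ^ 4) (k ^ 4) P l x +
        ∑ l ∈ Finset.range j, S.T (k ^ 4 + k ^ 4) (2 * k ^ 2) P l x) +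
        ∑ i ∈ Finset.range r, S.f (k ^ 4 + j * P + i) x) := by
      rw [← S.sum_blocks (k ^ 4) (k ^ 4) (2 * k ^ 2) j x]
      unfold R
      rw [hn2, Finset.sum_range_add, Finset.sum_range_add]
      simp only [zero_add, add_assoc, hP]
    have c1 := S.sum_bd 0 (k ^ 4) x
    have c2 := S.sum_bd (k ^ 4 + j * P) r x
    have c3 := b1 j hjN
    have c4 := b2 j hjN
    have hr' : (r:ℝ) ≤ 3 * (k:ℝ) ^ 4 := by
      have : (r:ℝ) ≤ (k:ℝ) ^ 4 + 2 * (k:ℝ) ^ 2 := by exact_mod_cast hrP.le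
      linarith
    have c5 : S.C * r ≤ S.C * (3 * (k:ℝ) ^ 4) := by gcongr
    rw [e]
    push_cast at c1
    have : Real.sqrt (Nk θ k) ≤ 4 * S.C * Real.sqrt (Nk θ k) := by nlinarith
    refine (abs_add_le _ _).trans ?_
    refine (add_le_add_right (abs_add_le _ _) _).trans ?_
    refine (add_le_add_right (add_le_add_left (abs_add_le _ _) _) _).trans ?_
    nlinarith

lemma plog_ge_one (x : ℝ) : 1 ≤ plog x := le_max_left _ _

lemma U2 (τ : ℝ) (hτ : 0 < τ) (h : 2 * S.v < τ ^ 2) :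
    ∀ᵐ x ∂volume, x ∈ Set.Icc S.α S.β → ∀ᶠ n : ℕ in atTop,
      |S.R n x| ≤ τ * Real.sqrt (n * plog (plog n)) := by
  obtain ⟨τ1, h1, h2, h3⟩ := exists_mid S.v0 hτ h
  obtain ⟨θ, hθ, hθτ⟩ : ∃ θ : ℝ, 1 < θ ∧ θ ^ 3 * τ1 ^ 2 ≤ τ ^ 2 := by
    have hc : Tendsto (fun θ : ℝ => θ ^ 3 * τ1 ^ 2) (nhds 1) (nhds (1 ^ 3 * τ1 ^ 2)) :=
      (Continuous.tendsto (by fun_prop) _)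
    have hlt : 1 ^ 3 * τ1 ^ 2 < τ ^ 2 := by nlinarith
    have := (hc.eventually_le_const hlt).filter_mono (nhdsWithin_le_nhds (s := Set.Ioi 1))
    obtain ⟨θ, ha, hb⟩ := (this.and self_mem_nhdsWithin).exists
    exact ⟨θ, hb, ha⟩
  filter_upwards [S.U1 θ hθ τ1 h1 h3] with x hx hxI
  have hlθ : 0 < Real.log θ := Real.log_pos hθ
  -- facts about k
  have hK : ∀ᶠ k : ℕ in atTop, (∀ n ≤ Nk θ k, |S.R n x| ≤ τ1 * Real.sqrt (Nk θ k * Real.log k)) ∧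
      (Nk θ k : ℝ) ≤ θ ^ (k + 2) ∧ Real.log k ≤ θ * Real.log (k * Real.log θ) ∧
      1 ≤ k * Real.log θ ∧ 1 ≤ Real.log (k * Real.log θ) ∧ 0 ≤ Real.log k := by
    have t1 : Tendsto (fun k : ℕ => θ ^ (k + 1)) atTop atTop :=
      (tendsto_pow_atTop_atTop_of_one_lt hθ).comp (tendsto_add_atTop_nat 1)
    have t2 : Tendsto (fun k : ℕ => (k:ℝ) * Real.log θ) atTop atTop :=
      tendsto_natCast_atTop_atTop.atTop_mul_const hlθ
    have t3 := Real.tendsto_log_atTop.comp t2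
    filter_upwards [hx hxI, t1.eventually_ge_atTop (1 / (θ - 1)),
      logk_tendsto.eventually_ge_atTop (θ * (-Real.log (Real.log θ)) / (θ - 1)),
      t2.eventually_ge_atTop 1, t3.eventually_ge_atTop 1, logk_tendsto.eventually_ge_atTop 0,
      eventually_ge_atTop 1] with k a1 a2 a3 a4 a5 a6 a7
    refine ⟨a1, ?_, ?_, a4, a5, a6⟩
    · have := Nk_le θ hθ k
      rw [div_le_iff₀ (by linarith)] at a2
      have : θ ^ (k + 2) = θ ^ (k + 1) * θ := by ring
      nlinarith
    · have hk : (k:ℝ) ≠ 0 := by exact_mod_cast (by omega : k ≠ 0)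
      rw [Real.log_mul hk hlθ.ne']
      rw [div_le_iff₀ (by linarith)] at a3
      nlinarith
  have htk : Tendsto (fun n : ℕ => ⌊Real.log n / Real.log θ⌋₊) atTop atTop :=
    tendsto_nat_floor_atTop.comp (logk_tendsto.atTop_div_const hlθ)
  filter_upwards [htk.eventually hK, eventually_ge_atTop 1] with n hn hn1
  set k := ⌊Real.log n / Real.log θ⌋₊
  obtain ⟨b1, b2, b3, b4, b5, b6⟩ := hn
  have hnpos : (0:ℝ) < n := by exact_mod_cast hn1
  have hlogn : 0 ≤ Real.log n := Real.log_natCast_nonneg n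
  have hkle : (k:ℝ) * Real.log θ ≤ Real.log n := by
    have := Nat.floor_le (div_nonneg hlogn hlθ.le)
    rwa [le_div_iff₀ hlθ] at this
  have hklt : Real.log n < (k + 1) * Real.log θ := by
    have := Nat.lt_floor_add_one (Real.log n / Real.log θ)
    rwa [div_lt_iff₀ hlθ] at this
  have hθk : θ ^ k ≤ n := by
    rw [← Real.log_le_log_iff (by positivity) hnpos, Real.log_pow]; exact hkle
  have hθk1 : (n:ℝ) ≤ θ ^ (k + 1) := by
    rw [← Real.log_le_log_iff hnpos (by positivity), Real.log_pow]; push_cast; exact hklt.le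
  have hnN : n ≤ Nk θ k := by exact_mod_cast hθk1.trans (Nk_ge θ k)
  refine (b1 n hnN).trans ?_
  have hpl : Real.log (k * Real.log θ) ≤ plog (plog n) := by
    refine le_trans ?_ (le_max_right _ _)
    apply Real.log_le_log (by linarith)
    exact hkle.trans (le_max_right _ _)
  apply le_of_sq_le_sq _ (by positivity)
  have hpp := plog_ge_one (plog n)
  rw [mul_pow, mul_pow, Real.sq_sqrt (by positivity), Real.sq_sqrt (by positivity)]
  calc τ1 ^ 2 * (Nk θ k * Real.log k) ≤ τ1 ^ 2 * ((θ ^ 2 * n) * (θ * plog (plog n))) := by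
        have : (Nk θ k : ℝ) ≤ θ ^ 2 * n := by
          calc _ ≤ _ := b2
            _ = θ ^ 2 * θ ^ k := by ring
            _ ≤ _ := by gcongr
        have : Real.log k ≤ θ * plog (plog n) := b3.trans (by gcongr)
        gcongr
    _ = (θ ^ 3 * τ1 ^ 2) * (n * plog (plog n)) := by ring
    _ ≤ _ := by gcongr

end Sys
end LIL

namespace LIL

lemma prod_tend (c : ℝ) (hc : 0 < c) (k1 : ℕ) (hc1 : ∀ l : ℕ, c / ((k1 + l : ℕ) : ℝ) ≤ 1) :
    Tendsto (fun m => ∏ l ∈ Finset.range m, (1 - c / ((k1 + l : ℕ) : ℝ))) atTop (nhds 0) := by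
  have hs : Tendsto (fun m => ∑ l ∈ Finset.range m, c / ((k1 + l : ℕ) : ℝ)) atTop atTop := by
    rw [← not_summable_iff_tendsto_nat_atTop_of_nonneg (fun l => by positivity)]
    intro h
    have h2 : Summable (fun l : ℕ => c / ((l + k1 : ℕ) : ℝ)) := by
      simpa [add_comm] using h
    rw [summable_nat_add_iff (f := fun l : ℕ => c / (l : ℝ)) k1] at h2
    have h3 : Summable (fun l : ℕ => 1 / (l:ℝ)) := by
      have := h2.mul_left (1 / c)
      refine this.congr (fun l => ?_)
      field_simp
    exact Real.not_summable_one_div_natCast h3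
  have h0 : Tendsto (fun m => Real.exp (-∑ l ∈ Finset.range m, c / ((k1 + l : ℕ) : ℝ))) atTop
      (nhds 0) := Real.tendsto_exp_neg_atTop_nhds_zero.comp hs
  refine squeeze_zero (fun m => Finset.prod_nonneg fun l _ => by linarith [hc1 l]) (fun m => ?_) h0
  rw [← Finset.sum_neg_distrib, Real.exp_sum]
  refine Finset.prod_le_prod (fun l _ => by linarith [hc1 l]) (fun l _ => ?_)
  have := Real.add_one_le_exp (-(c / ((k1 + l : ℕ) : ℝ)))
  linarith

lemma infOften (α β : ℝ) (hαβ : α ≤ β) (E : ℕ → Set ℝ) (hE : ∀ k, MeasurableSet (E k)) (c : ℝ)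
    (hc : 0 < c) (K0 : ℕ) (hc1 : ∀ k : ℕ, c / (k:ℝ) ≤ 1)
    (h : ∀ k1 ≥ K0, ∀ m, ∫ x in α..β, ind {x | ∀ l < m, x ∈ E (k1 + l)} x ≤
      (β - α) * ∏ l ∈ Finset.range m, (1 - c / ((k1 + l : ℕ) : ℝ))) :
    ∀ᵐ x ∂volume, x ∈ Set.Icc α β → ∃ᶠ k in atTop, x ∉ E k := by
  have key : ∀ k1, ∀ᵐ x ∂volume, x ∈ Set.Icc α β → k1 ≥ K0 → ∃ l, x ∉ E (k1 + l) := by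
    intro k1
    by_cases hk1 : k1 ≥ K0
    swap
    · exact Eventually.of_forall fun x _ hx => absurd hx hk1
    have hm : ∀ m, MeasurableSet {x | ∀ l < m, x ∈ E (k1 + l)} := by
      intro m
      have : {x | ∀ l < m, x ∈ E (k1 + l)} = ⋂ l ∈ Finset.range m, E (k1 + l) := by
        ext x; simp
      rw [this]
      exact Finset.measurableSet_biInter _ (fun j _ => hE _)
    set B := {x | ∀ l, x ∈ E (k1 + l)} with hB
    have hBm : MeasurableSet B := by
      have : B = ⋂ l, E (k1 + l) := by ext x; simp [hB]
      rw [this]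
      exact MeasurableSet.iInter (fun l => hE _)
    have h1 : ∀ m, ∫ x in α..β, ind B x ≤
        (β - α) * ∏ l ∈ Finset.range m, (1 - c / ((k1 + l : ℕ) : ℝ)) := by
      intro m
      refine le_trans ?_ (h k1 hk1 m)
      refine intervalIntegral.integral_mono_on hαβ (ind_ii hBm _ _) (ind_ii (hm m) _ _) ?_
      intro x _
      unfold ind
      exact Set.indicator_le_indicator_of_subset (show B ⊆ {x | ∀ l < m, x ∈ E (k1 + l)} from fun x hx l _ => hx l) (fun _ => zero_le_one) x
    have h2 : ∫ x in α..β, ind B x ≤ 0 := by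
      have := (prod_tend c hc k1 (fun l => hc1 _)).const_mul (β - α)
      rw [mul_zero] at this
      exact ge_of_tendsto' this h1
    rw [intervalIntegral.integral_of_le hαβ, ← integral_Icc_eq_integral_Ioc] at h2
    unfold ind at h2
    rw [integral_indicator hBm] at h2
    simp only [integral_const, smul_eq_mul, mul_one] at h2
    rw [Measure.restrict_restrict hBm] at h2
    have h3 : volume (B ∩ Set.Icc α β) = 0 := by
      have hf : volume (B ∩ Set.Icc α β) ≠ ⊤ :=
        ((measure_mono Set.inter_subset_right).trans_lt (by simp)).ne
      have : (volume (B ∩ Set.Icc α β)).toReal ≤ 0 := by simpa [Measure.real] using h2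
      have h4 := le_antisymm this ENNReal.toReal_nonneg
      rcases (ENNReal.toReal_eq_zero_iff _).1 h4 with h5 | h5
      · exact h5
      · exact absurd h5 hf
    have h4 := measure_eq_zero_iff_ae_notMem.1 h3
    filter_upwards [h4] with x hx hxI _
    by_contra hcon
    push Not at hcon
    exact hx ⟨hcon, hxI⟩
  filter_upwards [ae_all_iff.2 key] with x hx hxI
  rw [frequently_atTop]
  intro n
  obtain ⟨l, hl⟩ := hx (max n K0) hxI (le_max_right _ _)
  exact ⟨_, (le_max_left n K0).trans (Nat.le_add_right _ _), hl⟩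

namespace Sys
variable (S : Sys)

/-- starting index of superblock -/
noncomputable def ak (θ : ℝ) (k : ℕ) : ℕ := ⌈θ ^ k⌉₊ + 2 * k ^ 2

/-- number of blocks -/
noncomputable def nb (θ : ℝ) (k : ℕ) : ℕ := (Nk θ k - ak θ k) / (k ^ 4 + 2 * k ^ 2)

/-- superblock sum -/
noncomputable def LX (θ : ℝ) (k : ℕ) (x : ℝ) : ℝ :=
  ∑ l ∈ Finset.range (nb θ k), S.T (ak θ k) (k ^ 4) (k ^ 4 + 2 * k ^ 2) l x

lemma cLX (θ : ℝ) (k : ℕ) : Continuous (S.LX θ k) :=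
  continuous_finsetSum _ (fun n _ => S.cT _ _ _ _)

lemma ak_ge (θ : ℝ) (hθ : 1 < θ) : ∀ᶠ k : ℕ in atTop, k ^ 4 ≤ ak θ k := by
  have h1 : Tendsto (fun k : ℕ => (k:ℝ) ^ 4 / θ ^ k) atTop (nhds 0) :=
    tendsto_pow_const_div_const_pow_of_one_lt 4 hθ
  filter_upwards [h1.eventually_le_const one_pos] with k h1
  rw [div_le_one (by positivity)] at h1
  have : (k:ℝ) ^ 4 ≤ ⌈θ ^ k⌉₊ := h1.trans (Nat.le_ceil _)
  have : k ^ 4 ≤ ⌈θ ^ k⌉₊ := by exact_mod_cast this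
  unfold ak; omega

lemma nb_le (θ : ℝ) (k : ℕ) : nb θ k * k ^ 4 ≤ Nk θ k := by
  unfold nb
  calc _ ≤ (Nk θ k - ak θ k) / (k ^ 4 + 2 * k ^ 2) * (k ^ 4 + 2 * k ^ 2) := by gcongr; omega
    _ ≤ Nk θ k - ak θ k := Nat.div_mul_le_self _ _
    _ ≤ _ := Nat.sub_le _ _

lemma nb_ge (θ : ℝ) (hθ : 1 < θ) : ∀ᶠ k : ℕ in atTop,
    (1 - 4 / θ) * Nk θ k ≤ ((nb θ k * k ^ 4 : ℕ) : ℝ) := by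
  have h1 : Tendsto (fun k : ℕ => (k:ℝ) ^ 4 / θ ^ k) atTop (nhds 0) :=
    tendsto_pow_const_div_const_pow_of_one_lt 4 hθ
  have h2 : Tendsto (fun k : ℕ => 2 / (k:ℝ) ^ 2) atTop (nhds 0) := by
    apply Tendsto.const_div_atTop
    exact (tendsto_pow_atTop (by norm_num)).comp tendsto_natCast_atTop_atTop
  filter_upwards [h1.eventually_le_const (show 0 < 1 / (5 * θ) by positivity),
    h2.eventually_le_const (show 0 < 1 / θ by positivity), eventually_ge_atTop 1] with k a1 a2 a3
  have hN := Nk_pos θ hθ k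
  have hk1 : (1:ℝ) ≤ k := by exact_mod_cast a3
  have hk2 : (k:ℝ) ^ 2 ≤ (k:ℝ) ^ 4 := pow_le_pow_right₀ hk1 (by norm_num)
  have b1 : 5 * (k:ℝ) ^ 4 ≤ 1 / θ * Nk θ k := by
    rw [div_le_iff₀ (by positivity)] at a1
    have := Nk_ge' θ hθ k
    calc 5 * (k:ℝ) ^ 4 ≤ 5 * (1 / (5 * θ) * θ ^ k) := by gcongr
      _ = 1 / θ * θ ^ k := by field_simp
      _ ≤ _ := by gcongr
  have b2 : (⌈θ ^ k⌉₊ : ℝ) ≤ 2 / θ * Nk θ k := by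
    have := Nk_ge θ k
    have h3 : (⌈θ ^ k⌉₊ : ℝ) ≤ θ ^ k + 1 := (Nat.ceil_lt_add_one (by positivity)).le
    have h4 : (1:ℝ) ≤ θ ^ k := one_le_pow₀ hθ.le
    calc _ ≤ 2 * θ ^ k := by linarith
      _ = 2 / θ * θ ^ (k + 1) := by field_simp; ring
      _ ≤ _ := by gcongr
  have b3 : (Nk θ k : ℝ) ≤ nb θ k * ((k:ℝ) ^ 4 + 2 * (k:ℝ) ^ 2) + ((k:ℝ) ^ 4 + 2 * (k:ℝ) ^ 2) +
      (⌈θ ^ k⌉₊ + 2 * (k:ℝ) ^ 2) := by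
    have hPpos : 0 < k ^ 4 + 2 * k ^ 2 := by positivity
    have h3 : Nk θ k - ak θ k ≤ nb θ k * (k ^ 4 + 2 * k ^ 2) + (k ^ 4 + 2 * k ^ 2) := by
      have e1 := Nat.div_add_mod' (Nk θ k - ak θ k) (k ^ 4 + 2 * k ^ 2)
      have e2 := Nat.mod_lt (Nk θ k - ak θ k) hPpos
      unfold nb; omega
    have : Nk θ k ≤ nb θ k * (k ^ 4 + 2 * k ^ 2) + (k ^ 4 + 2 * k ^ 2) + (⌈θ ^ k⌉₊ + 2 * k ^ 2) := by
      have : ak θ k = ⌈θ ^ k⌉₊ + 2 * k ^ 2 := rfl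
      omega
    exact_mod_cast this
  have b4 : (nb θ k : ℝ) * (2 * (k:ℝ) ^ 2) ≤ 1 / θ * Nk θ k := by
    have h3 : (nb θ k : ℝ) * (k:ℝ) ^ 4 ≤ Nk θ k := by exact_mod_cast nb_le θ k
    calc _ = 2 / (k:ℝ) ^ 2 * (nb θ k * (k:ℝ) ^ 4) := by field_simp
      _ ≤ 1 / θ * Nk θ k := by gcongr
  push_cast
  have e : 4 / θ * Nk θ k = 1 / θ * Nk θ k + 1 / θ * Nk θ k + 2 / θ * Nk θ k := by ring
  nlinarith

lemma lowProb (θ τ κ V : ℝ) (hθ : 1 < θ) (hτ : 0 < τ) (hκ : 0 < κ) (hκ1 : κ < 1) (hV : 0 < V)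
    (hVv : V ≤ S.v * (1 - 4 / θ)) (hcond : (1 / 2 + κ) * τ ^ 2 ≤ (1 - κ) ^ 2 * V) :
    ∀ᶠ k : ℕ in atTop, ∀ u w : ℝ, S.α ≤ u → u ≤ w → w ≤ S.β → S.H (ak θ k) (k ^ 2) u ≤ w - u →
      ∫ x in u..w, ind {x | S.LX θ k x < τ * Real.sqrt (Nk θ k * Real.log k)} x ≤
        (w - u) * (1 - Real.exp (-2) / k) := by
  have hv : 0 < S.v := by
    by_contra hcon
    have : S.v = 0 := le_antisymm (not_lt.1 hcon) S.v0
    rw [this, zero_mul] at hVv; linarith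
  set D := (1 + κ) * τ / ((1 - κ) * V) with hD
  have hD0 : 0 < D := by have : 0 < 1 - κ := by linarith
                         positivity
  have hlk : ∀ᶠ k : ℕ in atTop, D * Real.sqrt (Real.log k) ≤ k := by
    have h1 : Tendsto (fun k : ℕ => D ^ 2 * (Real.log k / (k:ℝ))) atTop
        (nhds (D ^ 2 * 0)) := by
      refine Tendsto.const_mul _ ?_
      exact (Real.isLittleO_log_id_atTop.tendsto_div_nhds_zero).comp tendsto_natCast_atTop_atTop
    rw [mul_zero] at h1
    filter_upwards [h1.eventually_le_const one_pos, eventually_ge_atTop 1,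
      logk_tendsto.eventually_ge_atTop 0] with k h2 h3 h4
    have hk : (1:ℝ) ≤ k := by exact_mod_cast h3
    have h5 : D ^ 2 * Real.log k ≤ k := by
      rw [← mul_div_assoc, div_le_one (by linarith)] at h2; exact h2
    apply le_of_sq_le_sq _ (by linarith)
    rw [mul_pow, Real.sq_sqrt (by linarith)]
    nlinarith
  filter_upwards [hlk, S.est2 θ hθ, nb_ge θ hθ, ak_ge θ hθ, logk_tendsto.eventually_ge_atTop 1,
    logk_tendsto.eventually_ge_atTop (8 * S.v * (1 - κ) ^ 2 / (κ ^ 2 * τ ^ 2)),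
    eventually_ge_atTop 1] with k a1 a2 a3 a4 a5 a6 a7 u w hu huw hw hH
  have hk1 : (1:ℝ) ≤ k := by exact_mod_cast a7
  have hN := Nk_pos θ hθ k
  set N : ℝ := (Nk θ k : ℝ) with hNd
  set W : ℝ := S.v * (nb θ k * ((k ^ 4 : ℕ) : ℝ)) with hW
  have hWup : W ≤ S.v * N := by
    have : (nb θ k : ℝ) * ((k ^ 4 : ℕ) : ℝ) ≤ N := by rw [hNd]; exact_mod_cast nb_le θ k
    rw [hW]; gcongr
  have hWlo : V * N ≤ W := by
    calc V * N ≤ S.v * (1 - 4 / θ) * N := by gcongr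
      _ = S.v * ((1 - 4 / θ) * N) := by ring
      _ ≤ W := by rw [hW]; push_cast at a3 ⊢; gcongr
  have hVN : 0 < V * N := by positivity
  have hWpos : 0 < W := by linarith
  have hκ2 : 0 < 1 - κ := by linarith
  set lam := τ * Real.sqrt (N * Real.log k) / ((1 - κ) * W) with hlam
  have hlpos : 0 < lam := by
    have : 0 < Real.sqrt (N * Real.log k) := Real.sqrt_pos.2 (by positivity)
    positivity
  have hlW : lam ^ 2 * W = τ ^ 2 * (N * Real.log k) / ((1 - κ) ^ 2 * W) := by
    rw [hlam, div_pow, mul_pow, Real.sq_sqrt (by positivity)]; field_simp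
  have hbig : (1 + κ) * lam ≤ k / Real.sqrt N := by
    have hs : 0 < Real.sqrt N := Real.sqrt_pos.2 hN
    rw [le_div_iff₀ hs]
    refine le_trans ?_ a1
    have e : Real.sqrt N * Real.sqrt N = N := Real.mul_self_sqrt hN.le
    calc (1 + κ) * lam * Real.sqrt N
        = (1 + κ) * τ * (Real.sqrt N * Real.sqrt N) * Real.sqrt (Real.log k) / ((1 - κ) * W) := by
          rw [hlam, Real.sqrt_mul hN.le]; ring
      _ = (1 + κ) * τ * N * Real.sqrt (Real.log k) / ((1 - κ) * W) := by rw [e]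
      _ ≤ (1 + κ) * τ * N * Real.sqrt (Real.log k) / ((1 - κ) * (V * N)) := by gcongr
      _ = D * Real.sqrt (Real.log k) := by rw [hD]; field_simp
  have hm : nb θ k ≤ Nk θ k := by
    unfold nb; exact (Nat.div_le_self _ _).trans (Nat.sub_le _ _)
  have E : ∀ c : ℝ, 0 ≤ c → c ≤ 1 + κ → _ := fun c hc0 hc1 =>
    (a2 (Nk θ k) (Nk_ge' θ hθ k) (Nk_le' θ hθ k) (ak θ k) (k ^ 4) (k ^ 4 + 2 * k ^ 2) (nb θ k)
      a4 le_rfl le_rfl hm (c * lam) (by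
        rw [abs_of_nonneg (by positivity)]
        exact (mul_le_mul_of_nonneg_right hc1 hlpos.le).trans hbig) u w hu huw hw hH).2
  simp only [← Finset.mul_sum] at E
  have t := tail (S.LX θ k) (S.cLX θ k) u w lam W κ huw hlpos hWpos hκ hκ1 ?_ ?_ ?_ ?_
  · have e1 : (1 - κ) * lam * W = τ * Real.sqrt (N * Real.log k) := by
      rw [hlam]; field_simp
    rw [e1] at t
    refine t.trans ?_
    have hwu : 0 ≤ w - u := by linarith
    gcongr
    rw [Real.exp_sub, div_eq_mul_inv, mul_comm, Real.exp_neg, div_eq_mul_inv]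
    gcongr
    conv_lhs => rw [← Real.exp_log (show (0:ℝ) < k by linarith)]
    rw [← Real.exp_neg]
    apply Real.exp_le_exp.2
    have : (1 / 2 + κ) * (lam ^ 2 * W) ≤ Real.log k := by
      rw [hlW]
      calc _ = ((1 / 2 + κ) * τ ^ 2) * (N * Real.log k) / ((1 - κ) ^ 2 * W) := by ring
        _ ≤ ((1 - κ) ^ 2 * V) * (N * Real.log k) / ((1 - κ) ^ 2 * (V * N)) := by gcongr
        _ = Real.log k := by field_simp
    linarith
  · rw [hlW]
    rw [div_le_iff₀ (by positivity)] at a6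
    calc (8:ℝ) = 8 * S.v * (1 - κ) ^ 2 * N / ((1 - κ) ^ 2 * (S.v * N)) := by field_simp
      _ ≤ 8 * S.v * (1 - κ) ^ 2 * N / ((1 - κ) ^ 2 * W) := by gcongr
      _ ≤ (Real.log k * (κ ^ 2 * τ ^ 2)) * N / ((1 - κ) ^ 2 * W) := by gcongr
      _ = _ := by ring
  · have := (E 1 zero_le_one (by linarith)).2
    rw [one_mul] at this; exact this
  · exact (E (1 - κ) (by linarith) (by linarith)).1
  · exact (E (1 + κ) (by linarith) le_rfl).1

/-- oscillation error -/
noncomputable def dk (θ : ℝ) (k : ℕ) : ℝ := nb θ k * (((k ^ 4 : ℕ) : ℝ) * (S.C * S.ρ ^ ((k + 1) ^ 2)))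

lemma oscLX (θ : ℝ) (hθ : 1 < θ) (k : ℕ) (hk : S.n0 ≤ ak θ (k + 1)) (u w : ℝ) (hu : S.α ≤ u)
    (hw : w ≤ S.β) (h : w - u ≤ 2 * S.H (ak θ (k + 1)) ((k + 1) ^ 2) u) :
    ∀ x ∈ Set.Icc u w, ∀ y ∈ Set.Icc u w, |S.LX θ k x - S.LX θ k y| ≤ S.dk θ k := by
  intro x hx y hy
  unfold LX dk
  rw [← Finset.sum_sub_distrib]
  refine (Finset.abs_sum_le_sum_abs _ _).trans ?_
  refine (Finset.sum_le_sum (g := fun _ => ((k ^ 4 : ℕ) : ℝ) * (S.C * S.ρ ^ ((k + 1) ^ 2)))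
    (fun l hl => ?_)).trans (by simp)
  unfold T
  rw [← Finset.sum_sub_distrib]
  refine (Finset.abs_sum_le_sum_abs _ _).trans ?_
  refine (Finset.sum_le_sum (g := fun _ => S.C * S.ρ ^ ((k + 1) ^ 2)) (fun n hn => ?_)).trans
    (by simp)
  refine S.osc (ak θ (k + 1)) _ _ u w hk ?_ hu hw h x hx y hy
  have hn := Finset.mem_range.1 hn
  have hl := Finset.mem_range.1 hl
  have h1 : nb θ k * (k ^ 4 + 2 * k ^ 2) ≤ Nk θ k - ak θ k := Nat.div_mul_le_self _ _
  have h2 : (l + 1) * (k ^ 4 + 2 * k ^ 2) ≤ nb θ k * (k ^ 4 + 2 * k ^ 2) :=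
    Nat.mul_le_mul_right _ hl
  rw [add_mul, one_mul] at h2
  have h3 : ak θ (k + 1) = Nk θ k + 2 * (k + 1) ^ 2 := rfl
  rw [h3]
  omega

lemma ak_mono (θ : ℝ) (hθ : 1 < θ) : Monotone (ak θ) := by
  intro a b hab
  unfold ak
  gcongr
  exact hθ.le

lemma lowFreq (θ τ κ V : ℝ) (hθ : 1 < θ) (hτ : 0 < τ) (hκ : 0 < κ) (hκ1 : κ < 1) (hV : 0 < V)
    (hVv : V ≤ S.v * (1 - 4 / θ)) (hcond : (1 / 2 + κ) * τ ^ 2 ≤ (1 - κ) ^ 2 * V) :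
    ∀ᵐ x ∂volume, x ∈ Set.Icc S.α S.β → ∃ᶠ k : ℕ in atTop,
      τ * Real.sqrt (Nk θ k * Real.log k) - S.dk θ k ≤ S.LX θ k x := by
  have hn0 : ∀ᶠ k : ℕ in atTop, S.n0 ≤ ak θ k := by
    filter_upwards [ak_ge θ hθ, eventually_ge_atTop S.n0] with k h1 h2
    have : k ≤ k ^ 4 := Nat.le_self_pow (by norm_num) k
    omega
  obtain ⟨K0, hK0⟩ := eventually_atTop.1
    ((S.lowProb θ τ κ V hθ hτ hκ hκ1 hV hVv hcond).and (hn0.and ((ak_ge θ hθ).and S.Hsmall)))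
  have hc1 : ∀ k : ℕ, Real.exp (-2) / (k:ℝ) ≤ 1 := by
    intro k
    rcases Nat.eq_zero_or_pos k with rfl | hk
    · simp
    · have hk1 : (1:ℝ) ≤ k := by exact_mod_cast hk
      rw [div_le_one (by linarith)]
      have : Real.exp (-2) ≤ 1 := Real.exp_le_one_iff.2 (by norm_num)
      linarith
  have := infOften S.α S.β S.hαβ.le
    (fun k => {x | S.LX θ k x < τ * Real.sqrt (Nk θ k * Real.log k) - S.dk θ k})
    (fun k => measurableSet_lt (S.cLX θ k).measurable measurable_const) (Real.exp (-2))
    (Real.exp_pos _) K0 hc1 ?_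
  · filter_upwards [this] with x hx hxI
    refine (hx hxI).mono (fun k hk => ?_)
    simpa using hk
  intro k1 hk1 m
  have := chainBad (fun i => S.LX θ (k1 + i)) (fun i => S.cLX θ _)
    (fun i => S.H (ak θ (k1 + i)) ((k1 + i) ^ 2)) S.α S.β
    (fun i u h1 h2 => S.Hpos _ _ _ h1 h2) (fun i => S.Hanti _ _)
    (fun i u h1 h2 => S.Hmono _ _ _ _ _ (ak_mono θ hθ (by omega)) ?_ h1 h2)
    (fun i => τ * Real.sqrt (Nk θ (k1 + i) * Real.log (k1 + i : ℕ)) - S.dk θ (k1 + i))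
    (fun i => S.dk θ (k1 + i)) (fun i => Real.exp (-2) / ((k1 + i : ℕ) : ℝ)) (fun i => hc1 _)
    ?_ ?_ m 0 S.α S.β le_rfl S.hαβ.le le_rfl ?_
  · simpa using this
  · have : ⌈θ ^ (k1 + i)⌉₊ ≤ ⌈θ ^ (k1 + (i + 1))⌉₊ := by gcongr; exact hθ.le; omega
    unfold ak
    have h2 : (k1 + i) ^ 2 ≤ (k1 + (i + 1)) ^ 2 := by gcongr; omega
    omega
  · intro i u w hu hw h
    exact S.oscLX θ hθ (k1 + i) (hK0 _ (by omega)).2.1 u w hu hw h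
  · intro i u w hu huw hw h
    have := (hK0 (k1 + i) (by omega)).1 u w hu huw hw h
    simpa using this
  · exact (hK0 k1 hk1).2.2.2 _ (hK0 k1 hk1).2.2.1

end Sys
end LIL

namespace LIL
namespace Sys
variable (S : Sys)

lemma dk_le (θ : ℝ) (hθ : 1 < θ) : ∀ᶠ k : ℕ in atTop, S.dk θ k ≤ 2 * S.C := by
  have h1 : Tendsto (fun k : ℕ => θ * S.ρ ^ (k + 1)) atTop (nhds (θ * 0)) :=
    ((tendsto_pow_atTop_nhds_zero_of_lt_one S.ρ0.le S.ρ1).comp (tendsto_add_atTop_nat 1)).const_mul θ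
  rw [mul_zero] at h1
  filter_upwards [h1.eventually_le_const one_pos] with k hk
  have hC := S.hC
  have hρ := S.ρ0
  have h2 : (nb θ k : ℝ) * ((k ^ 4 : ℕ) : ℝ) ≤ 2 * θ ^ (k + 1) := by
    refine le_trans ?_ (Nk_le' θ hθ k)
    exact_mod_cast nb_le θ k
  unfold dk
  calc _ = ((nb θ k : ℝ) * ((k ^ 4 : ℕ) : ℝ)) * (S.C * S.ρ ^ ((k + 1) ^ 2)) := by ring
    _ ≤ (2 * θ ^ (k + 1)) * (S.C * S.ρ ^ ((k + 1) ^ 2)) := by gcongr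
    _ = 2 * S.C * (θ * S.ρ ^ (k + 1)) ^ (k + 1) := by
        rw [mul_pow, ← pow_mul, sq]; ring
    _ ≤ 2 * S.C * 1 := by
        gcongr
        exact pow_le_one₀ (by positivity) hk
    _ = _ := by ring

lemma plog_Nk (θ : ℝ) (hθ : 1 < θ) (η : ℝ) (hη : 1 < η) :
    ∀ᶠ k : ℕ in atTop, plog (plog (Nk θ k)) ≤ η * Real.log k := by
  have hlθ : 0 < Real.log θ := Real.log_pos hθ
  set D := 1 + 2 * Real.log θ with hD
  have hD1 : 1 ≤ D := by linarith
  filter_upwards [logk_tendsto.eventually_ge_atTop 1,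
    logk_tendsto.eventually_ge_atTop (Real.log D / (η - 1)), eventually_ge_atTop 1] with k a1 a2 a3
  have hk : (1:ℝ) ≤ k := by exact_mod_cast a3
  have h1 : plog (Nk θ k) ≤ k * D := by
    unfold plog
    apply max_le
    · nlinarith
    · have : Real.log (Nk θ k) ≤ Real.log (2 * θ ^ (k + 1)) :=
        Real.log_le_log (Nk_pos θ hθ k) (Nk_le' θ hθ k)
      rw [Real.log_mul (by norm_num) (by positivity), Real.log_pow] at this
      have h2 : Real.log 2 ≤ 1 := by linarith [Real.log_two_lt_d9]
      push_cast at this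
      nlinarith
  have h0 := plog_ge_one (Nk θ k)
  rw [div_le_iff₀ (by linarith)] at a2
  unfold plog at h1 h0 ⊢
  apply max_le
  · nlinarith
  · have := Real.log_le_log (by linarith) h1
    rw [Real.log_mul (by linarith) (by linarith)] at this
    linarith

set_option maxHeartbeats 1000000 in
lemma lower (τ : ℝ) (hτ : 0 < τ) (h : τ ^ 2 < 2 * S.v) :
    ∀ᵐ x ∂volume, x ∈ Set.Icc S.α S.β → ∃ᶠ n : ℕ in atTop,
      τ * Real.sqrt (n * plog (plog n)) ≤ |S.R n x| := by
  have hv : 0 < S.v := by nlinarith [sq_nonneg τ]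
  have hC := S.hC
  obtain ⟨τ1, ht1, ht2⟩ : ∃ τ1, τ < τ1 ∧ τ1 ^ 2 < 2 * S.v := by
    obtain ⟨τ1, h1, h2⟩ := exists_between (Real.lt_sqrt_of_sq_lt h)
    exact ⟨τ1, h1, (Real.lt_sqrt (by linarith)).1 h2⟩
  have hτ1 : 0 < τ1 := by linarith
  obtain ⟨κ, hκ, hκ1, hκc⟩ : ∃ κ : ℝ, 0 < κ ∧ κ < 1 ∧
      (1 / 2 + κ) * τ1 ^ 2 ≤ (1 - κ) ^ 2 * (S.v * (1 - κ)) := by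
    have c1 : Tendsto (fun κ : ℝ => (1 / 2 + κ) * τ1 ^ 2 - (1 - κ) ^ 2 * (S.v * (1 - κ))) (nhds 0)
        (nhds ((1 / 2 + 0) * τ1 ^ 2 - (1 - 0) ^ 2 * (S.v * (1 - 0)))) :=
      Continuous.tendsto (by fun_prop) _
    have c2 := (c1.eventually_le_const (u := 0) (by linarith)).and (eventually_lt_nhds (zero_lt_one' ℝ))
    have c3 := c2.filter_mono (nhdsWithin_le_nhds (s := Set.Ioi 0))
    obtain ⟨κ, ⟨a, b⟩, c⟩ := (c3.and self_mem_nhdsWithin).exists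
    exact ⟨κ, c, b, by linarith⟩
  set ε := (τ1 - τ) / 4 with hε
  have hε0 : 0 < ε := by rw [hε]; linarith
  set τ0 := 2 * S.v + 1 with hτ0
  have hτ0p : 0 < τ0 := by linarith
  set θ := 4 / κ + 2 * τ0 ^ 2 / ε ^ 2 + 2 with hθd
  have hq1 : 0 < 4 / κ := by positivity
  have hq2 : 0 < 2 * τ0 ^ 2 / ε ^ 2 := by positivity
  have hθ : 1 < θ := by linarith
  have hθ0 : 0 < θ := by linarith
  have hθ1 : 4 / θ ≤ κ := by
    rw [div_le_iff₀ hθ0]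
    have : 4 / κ ≤ θ := by linarith
    rw [div_le_iff₀ hκ] at this; linarith
  have hθ2 : τ0 ^ 2 * (2 / θ) ≤ ε ^ 2 := by
    have : 2 * τ0 ^ 2 / ε ^ 2 ≤ θ := by linarith
    rw [div_le_iff₀ (by positivity)] at this
    rw [← mul_div_assoc, div_le_iff₀ hθ0]; linarith
  have hVv : S.v * (1 - κ) ≤ S.v * (1 - 4 / θ) := by gcongr
  have hη : 1 < ((τ + ε) / τ) ^ 2 := by
    apply one_lt_pow₀ _ (by norm_num)
    rw [one_lt_div hτ]; linarith
  filter_upwards [S.lowFreq θ τ1 κ (S.v * (1 - κ)) hθ hτ1 hκ hκ1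
    (mul_pos hv (by linarith)) hVv hκc, S.U1 θ hθ τ0 hτ0p (by nlinarith),
    S.gapBC θ hθ (ak θ) (ak_ge θ hθ)] with x f1 f2 f3 hx
  have f2' := (tendsto_sub_atTop_nat 1).eventually (f2 hx)
  have hNt : Tendsto (Nk θ) atTop atTop := by
    apply tendsto_nat_ceil_atTop.comp
    exact (tendsto_pow_atTop_atTop_of_one_lt hθ).comp (tendsto_add_atTop_nat 1)
  refine hNt.frequently (p := fun n : ℕ => τ * Real.sqrt (n * plog (plog n)) ≤ |S.R n x|) ?_
  refine ((f1 hx).and_eventually (f2'.and ((f3 hx).and ((S.dk_le θ hθ).and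
    ((plog_Nk θ hθ _ hη).and ((nb_ge θ hθ).and
    ((lower_order θ hθ (7 * S.C) ε (by linarith) hε0).and ((logk_tendsto.eventually_ge_atTop 1).and
    (eventually_ge_atTop 2))))))))).mono ?_
  rintro k ⟨g1, g2, g3, g4, g5, g6, g7, g8, g9⟩
  have hk1 : (2:ℝ) ≤ k := by exact_mod_cast g9
  have hk2 : (k:ℝ) ^ 2 ≤ (k:ℝ) ^ 4 := pow_le_pow_right₀ (by linarith) (by norm_num)
  have hk4 : (1:ℝ) ≤ (k:ℝ) ^ 4 := one_le_pow₀ (by linarith)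
  have hN := Nk_pos θ hθ k
  have hnbpos : 0 < nb θ k := by
    by_contra hcon
    have : nb θ k = 0 := by omega
    rw [this] at g6
    have : 0 < (1 - 4 / θ) * (Nk θ k : ℝ) := mul_pos (by linarith) hN
    simp at g6; linarith
  have hakN : ak θ k ≤ Nk θ k := by
    by_contra hcon
    have : Nk θ k - ak θ k = 0 := by omega
    unfold nb at hnbpos
    rw [this] at hnbpos; simp at hnbpos
  -- first part
  have hA : Nk θ (k - 1) = ⌈θ ^ k⌉₊ := by
    unfold Nk; rw [Nat.sub_add_cancel (by omega)]
  have b2 : (⌈θ ^ k⌉₊ : ℝ) ≤ 2 / θ * Nk θ k := by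
    have := Nk_ge θ k
    have h3 : (⌈θ ^ k⌉₊ : ℝ) ≤ θ ^ k + 1 := (Nat.ceil_lt_add_one (by positivity)).le
    have h4 : (1:ℝ) ≤ θ ^ k := one_le_pow₀ hθ.le
    calc _ ≤ 2 * θ ^ k := by linarith
      _ = 2 / θ * θ ^ (k + 1) := by field_simp; ring
      _ ≤ _ := by gcongr
  have r1 : |S.R ⌈θ ^ k⌉₊ x| ≤ ε * Real.sqrt (Nk θ k * Real.log k) := by
    have := g2 (Nk θ (k - 1)) le_rfl
    rw [hA] at this
    refine this.trans ?_
    have hl0 : 0 ≤ Real.log ((k - 1 : ℕ) : ℝ) := Real.log_natCast_nonneg _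
    have hl1 : Real.log ((k - 1 : ℕ) : ℝ) ≤ Real.log k := by
      apply Real.log_le_log
      · exact_mod_cast (by omega : 0 < k - 1)
      · exact_mod_cast Nat.sub_le _ _
    apply le_of_sq_le_sq _ (by positivity)
    rw [mul_pow, mul_pow, Real.sq_sqrt (by positivity), Real.sq_sqrt (by positivity)]
    calc _ ≤ τ0 ^ 2 * ((2 / θ * Nk θ k) * Real.log k) := by gcongr
      _ = (τ0 ^ 2 * (2 / θ)) * (Nk θ k * Real.log k) := by ring
      _ ≤ _ := by gcongr
  set P := k ^ 4 + 2 * k ^ 2 with hP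
  obtain ⟨r, hr, hrP⟩ : ∃ r, Nk θ k = ⌈θ ^ k⌉₊ + (2 * k ^ 2 + (nb θ k * P + r)) ∧ r < P := by
    refine ⟨(Nk θ k - ak θ k) % P, ?_, Nat.mod_lt _ (by positivity)⟩
    have := Nat.div_add_mod' (Nk θ k - ak θ k) P
    have h2 : nb θ k = (Nk θ k - ak θ k) / P := rfl
    have h3 : ak θ k = ⌈θ ^ k⌉₊ + 2 * k ^ 2 := rfl
    rw [← h2] at this
    omega
  have e : S.R (Nk θ k) x = S.R ⌈θ ^ k⌉₊ x + (∑ i ∈ Finset.range (2 * k ^ 2), S.f (⌈θ ^ k⌉₊ + i) x +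
      ((S.LX θ k x + ∑ l ∈ Finset.range (nb θ k), S.T (ak θ k + k ^ 4) (2 * k ^ 2) P l x) +
      ∑ i ∈ Finset.range r, S.f (ak θ k + nb θ k * P + i) x)) := by
    have := S.sum_blocks (ak θ k) (k ^ 4) (2 * k ^ 2) (nb θ k) x
    unfold LX
    rw [← hP] at this ⊢
    rw [← this]
    unfold R
    rw [hr, Finset.sum_range_add, Finset.sum_range_add, Finset.sum_range_add]
    have h3 : ak θ k = ⌈θ ^ k⌉₊ + 2 * k ^ 2 := rfl
    simp only [add_assoc, h3]
  have r2 := S.sum_bd ⌈θ ^ k⌉₊ (2 * k ^ 2) x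
  have r3 := S.sum_bd (ak θ k + nb θ k * P) r x
  have r4 := g3 (nb θ k) (Nat.div_le_div_right (Nat.sub_le _ _))
  have hr' : (r:ℝ) ≤ 3 * (k:ℝ) ^ 4 := by
    have : (r:ℝ) ≤ (k:ℝ) ^ 4 + 2 * (k:ℝ) ^ 2 := by exact_mod_cast hrP.le
    linarith
  have c5 : S.C * r ≤ S.C * (3 * (k:ℝ) ^ 4) := by gcongr
  have c6 : S.C * ((2 * k ^ 2 : ℕ) : ℝ) ≤ S.C * (2 * (k:ℝ) ^ 4) := by push_cast; gcongr
  have hsq := Real.sqrt_nonneg (Nk θ k : ℝ)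
  have c7 : Real.sqrt (Nk θ k) ≤ 7 * S.C * Real.sqrt (Nk θ k) :=
    le_mul_of_one_le_left hsq (by linarith)
  have c8 : 2 * S.C ≤ S.C * (2 * (k:ℝ) ^ 4) := by
    have := mul_le_mul_of_nonneg_left hk4 (show 0 ≤ S.C by linarith)
    linarith
  have key : (τ + ε) * Real.sqrt (Nk θ k * Real.log k) ≤ S.R (Nk θ k) x := by
    rw [e]
    have e4 : τ1 = τ + 4 * ε := by rw [hε]; ring
    rw [e4] at g1
    have := (abs_le.1 r1).1
    have := (abs_le.1 r2).1
    have := (abs_le.1 r3).1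
    have := (abs_le.1 r4).1
    have hnn : 0 ≤ ε * Real.sqrt (Nk θ k * Real.log k) := by positivity
    linarith
  refine le_trans ?_ (key.trans (le_abs_self _))
  apply le_of_sq_le_sq _ (by positivity)
  have hpp := plog_ge_one (plog (Nk θ k))
  rw [mul_pow, mul_pow, Real.sq_sqrt (by positivity), Real.sq_sqrt (by positivity)]
  calc _ ≤ τ ^ 2 * (Nk θ k * (((τ + ε) / τ) ^ 2 * Real.log k)) := by gcongr
    _ = _ := by field_simp

end Sys
end LIL

namespace LIL

lemma osc_int (B D γ c K u w : ℝ) (s t : ℕ) (hs : 1 ≤ s) (ht : t ≤ s) (hu : 1 ≤ u) (huw : u ≤ w)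
    (hc : 0 < c) (hB : |B| ≤ K) (hD : |D| ≤ K)
    (h : ∀ x ∈ Set.Icc u w, c * (s * x ^ (s - 1)) ≤
      |B * (s * x ^ (s - 1)) + D * (t * x ^ (t - 1))|) :
    |∫ x in u..w, Real.cos (B * x ^ s + D * x ^ t + γ)| ≤
      2 / (c * (s * u ^ (s - 1))) + 2 * K / c ^ 2 / u ^ (s - 1) * (w - u) := by
  have hs' : (1:ℝ) ≤ s := by exact_mod_cast hs
  have ht' : (t:ℝ) ≤ s := by exact_mod_cast ht
  have hK : 0 ≤ K := (abs_nonneg _).trans hB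
  set Φ : ℝ → ℝ := fun x => B * x ^ s + D * x ^ t + γ with hΦ
  set Ψ : ℝ → ℝ := fun x => B * (s * x ^ (s - 1)) + D * (t * x ^ (t - 1)) with hΨ
  set Ψ' : ℝ → ℝ := fun x => B * (s * (((s - 1 : ℕ) : ℝ) * x ^ (s - 1 - 1))) +
    D * (t * (((t - 1 : ℕ) : ℝ) * x ^ (t - 1 - 1))) with hΨ'
  have dΦ : ∀ x, HasDerivAt Φ (Ψ x) x := by
    intro x
    exact (((hasDerivAt_pow s x).const_mul B).add ((hasDerivAt_pow t x).const_mul D)).add_const γ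
  have dΨ : ∀ x, HasDerivAt Ψ (Ψ' x) x := by
    intro x
    exact (((hasDerivAt_pow (s - 1) x).const_mul (s:ℝ)).const_mul B).add
      (((hasDerivAt_pow (t - 1) x).const_mul (t:ℝ)).const_mul D)
  have cΦ : Continuous Φ := by fun_prop
  have cΨ : Continuous Ψ := by fun_prop
  have cΨ' : Continuous Ψ' := by fun_prop
  have hx1 : ∀ x ∈ Set.Icc u w, (1:ℝ) ≤ x := fun x hx => hu.trans hx.1
  have hpos : ∀ x ∈ Set.Icc u w, 0 < c * (s * x ^ (s - 1)) := by
    intro x hx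
    have := hx1 x hx
    positivity
  have hne : ∀ x ∈ Set.Icc u w, Ψ x ≠ 0 := by
    intro x hx
    exact abs_pos.1 ((hpos x hx).trans_le (h x hx))
  have dG : ∀ x ∈ Set.Icc u w, HasDerivAt (fun x => Real.sin (Φ x) / Ψ x)
      (Real.cos (Φ x) - Real.sin (Φ x) * Ψ' x / Ψ x ^ 2) x := by
    intro x hx
    have h0 := hne x hx
    have := ((dΦ x).sin).div (dΨ x) h0
    have e : Real.cos (Φ x) - Real.sin (Φ x) * Ψ' x / Ψ x ^ 2 =
        (Real.cos (Φ x) * Ψ x * Ψ x - Real.sin (Φ x) * Ψ' x) / Ψ x ^ 2 := by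
      field_simp
    rw [e]
    exact this
  have cont1 : ContinuousOn (fun x => Real.sin (Φ x) * Ψ' x / Ψ x ^ 2) (Set.Icc u w) := by
    apply ContinuousOn.div
    · exact ((Real.continuous_sin.comp cΦ).mul cΨ').continuousOn
    · exact (cΨ.pow 2).continuousOn
    · intro x hx; exact pow_ne_zero _ (hne x hx)
  have ii1 : IntervalIntegrable (fun x => Real.sin (Φ x) * Ψ' x / Ψ x ^ 2) volume u w := by
    apply ContinuousOn.intervalIntegrable
    rwa [Set.uIcc_of_le huw]
  have ii2 : IntervalIntegrable (fun x => Real.cos (Φ x)) volume u w :=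
    (Real.continuous_cos.comp cΦ).intervalIntegrable _ _
  have e := intervalIntegral.integral_eq_sub_of_hasDerivAt
    (f := fun x => Real.sin (Φ x) / Ψ x)
    (f' := fun x => Real.cos (Φ x) - Real.sin (Φ x) * Ψ' x / Ψ x ^ 2) (a := u) (b := w)
    (by rw [Set.uIcc_of_le huw]; exact dG) (ii2.sub ii1)
  rw [intervalIntegral.integral_sub ii2 ii1] at e
  have hup : 0 < u ^ (s - 1) := by positivity
  have bG : ∀ x ∈ Set.Icc u w, |Real.sin (Φ x) / Ψ x| ≤ 1 / (c * (s * u ^ (s - 1))) := by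
    intro x hx
    rw [abs_div]
    have h1 := hpos u ⟨le_rfl, huw⟩
    apply div_le_div₀ zero_le_one (Real.abs_sin_le_one _) h1
    refine le_trans ?_ (h x hx)
    have := hx.1
    gcongr
  have b2 : ∀ x ∈ Set.Icc u w, |Real.sin (Φ x) * Ψ' x / Ψ x ^ 2| ≤ 2 * K / c ^ 2 / u ^ (s - 1) := by
    intro x hx
    have hx1' := hx1 x hx
    have q1 : |Ψ' x| ≤ 2 * K * s ^ 2 * x ^ (s - 1) := by
      have r1 : ((s - 1 : ℕ) : ℝ) ≤ s := by exact_mod_cast Nat.sub_le _ _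
      have r2 : ((t - 1 : ℕ) : ℝ) ≤ s := by exact_mod_cast (by omega : t - 1 ≤ s)
      have p1 : x ^ (s - 1 - 1) ≤ x ^ (s - 1) := pow_le_pow_right₀ hx1' (by omega)
      have p2 : x ^ (t - 1 - 1) ≤ x ^ (s - 1) := pow_le_pow_right₀ hx1' (by omega)
      rw [hΨ']
      refine (abs_add_le _ _).trans ?_
      rw [abs_mul, abs_mul D, abs_of_nonneg (a := (s:ℝ) * _) (by positivity),
        abs_of_nonneg (a := (t:ℝ) * _) (by positivity)]
      calc _ ≤ K * (s * (s * x ^ (s - 1))) + K * (s * (s * x ^ (s - 1))) := by gcongr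
        _ = _ := by ring
    have q2 : (c * (s * x ^ (s - 1))) ^ 2 ≤ Ψ x ^ 2 := by
      rw [← sq_abs (Ψ x)]
      have := (hpos x hx).le
      gcongr
      exact h x hx
    have hp0 := hpos x hx
    rw [abs_div, abs_mul, abs_of_nonneg (sq_nonneg (Ψ x))]
    have hux := hx.1
    calc _ ≤ 1 * (2 * K * s ^ 2 * x ^ (s - 1)) / (c * (s * x ^ (s - 1))) ^ 2 := by
          gcongr
          exact Real.abs_sin_le_one _
      _ = 2 * K / c ^ 2 / x ^ (s - 1) := by
          have : x ^ (s - 1) ≠ 0 := by positivity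
          field_simp
      _ ≤ _ := by gcongr
  have b3 := intervalIntegral.norm_integral_le_of_norm_le_const (a := u) (b := w)
    (f := fun x => Real.sin (Φ x) * Ψ' x / Ψ x ^ 2) (C := 2 * K / c ^ 2 / u ^ (s - 1))
    (fun x hx => by
      rw [Set.uIoc_of_le huw] at hx
      exact b2 x ⟨hx.1.le, hx.2⟩)
  rw [Real.norm_eq_abs, abs_of_nonneg (show 0 ≤ w - u by linarith)] at b3
  have e2 : ∫ x in u..w, Real.cos (Φ x) = Real.sin (Φ w) / Ψ w - Real.sin (Φ u) / Ψ u +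
      ∫ x in u..w, Real.sin (Φ x) * Ψ' x / Ψ x ^ 2 := by linarith
  rw [e2]
  have g1 := bG w ⟨huw, le_rfl⟩
  have g2 := bG u ⟨le_rfl, huw⟩
  refine (abs_add_le _ _).trans ?_
  refine add_le_add ((abs_sub _ _).trans ?_) b3
  calc _ ≤ _ := add_le_add g1 g2
    _ = _ := by ring

lemma osc_fin (B D γ c K u w α β : ℝ) (s t sa g : ℕ) (hsa : 1 ≤ sa) (hs : sa ≤ s) (ht : t ≤ s)
    (hα : 1 < α) (hu : α ≤ u) (huw : u ≤ w) (hwβ : w ≤ β)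
    (hc : 0 < c) (hB : |B| ≤ K) (hD : |D| ≤ K) (hg : g + 1 ≤ sa)
    (hH : 1 / (sa * u ^ (sa - g)) ≤ w - u)
    (h : ∀ x ∈ Set.Icc u w, c * (s * x ^ (s - 1)) ≤
      |B * (s * x ^ (s - 1)) + D * (t * x ^ (t - 1))|) :
    |∫ x in u..w, Real.cos (B * x ^ s + D * x ^ t + γ)| ≤
      (2 * β / c + 2 * K / c ^ 2) * (1 / α) ^ g * (w - u) := by
  have hu1 : 1 ≤ u := by linarith
  have hs' : (1:ℝ) ≤ s := by exact_mod_cast hsa.trans hs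
  have hsa' : (1:ℝ) ≤ sa := by exact_mod_cast hsa
  have hsa2 : (sa:ℝ) ≤ s := by exact_mod_cast hs
  have hK : 0 ≤ K := (abs_nonneg _).trans hB
  have hwu : 0 ≤ w - u := by linarith
  have hβ : 0 < β := by linarith
  refine (osc_int B D γ c K u w s t (hsa.trans hs) ht hu1 huw hc hB hD h).trans ?_
  have hg' : (1 / α) ^ g = 1 / α ^ g := by rw [div_pow, one_pow]
  have h1 : 2 / (c * (s * u ^ (s - 1))) ≤ 2 * β / c * (1 / α) ^ g * (w - u) := by
    have p1 : u ^ (sa - g) * α ^ g ≤ β * u ^ (s - 1) := by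
      calc u ^ (sa - g) * α ^ g ≤ u ^ (sa - g) * u ^ g := by gcongr
        _ = u * u ^ (sa - 1) := by
            rw [← pow_add, ← pow_succ']; congr 1; omega
        _ ≤ β * u ^ (s - 1) := by
            have : u ^ (sa - 1) ≤ u ^ (s - 1) := pow_le_pow_right₀ hu1 (by omega)
            gcongr
            linarith
    calc 2 / (c * (s * u ^ (s - 1))) ≤ 2 * β / c * (1 / α) ^ g * (1 / (sa * u ^ (sa - g))) := by
          rw [hg']
          have : 2 * β / c * (1 / α ^ g) * (1 / (sa * u ^ (sa - g))) =
            2 * β / (c * (sa * (u ^ (sa - g) * α ^ g))) := by field_simp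
          rw [this, div_le_div_iff₀ (by positivity) (by positivity)]
          calc 2 * (c * (sa * (u ^ (sa - g) * α ^ g))) ≤ 2 * (c * (s * (β * u ^ (s - 1)))) := by
                gcongr
            _ = _ := by ring
      _ ≤ _ := by gcongr
  have h2 : 2 * K / c ^ 2 / u ^ (s - 1) * (w - u) ≤ 2 * K / c ^ 2 * (1 / α) ^ g * (w - u) := by
    gcongr
    rw [hg', div_eq_mul_one_div]
    gcongr
    calc α ^ g ≤ u ^ g := by gcongr
      _ ≤ u ^ (s - 1) := pow_le_pow_right₀ hu1 (by omega)
  calc _ ≤ _ := add_le_add h1 h2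
    _ = _ := by ring

lemma nonres (x0 : ℝ) (hx0 : 1 < x0) (d : ℕ)
    (hr : ∀ r j j' : ℕ, 1 ≤ r → 1 ≤ j → (j:ℝ) * x0 ^ r ≠ j') :
    ∃ c > 0, ∃ n0 : ℕ, ∃ δ > 0, 1 < x0 - δ ∧ c ≤ 1 ∧ ∀ x, x0 - δ ≤ x → x ≤ x0 + δ → ∀ s t : ℕ,
      n0 ≤ s → t < s → ∀ j j' : ℕ, 1 ≤ j → j ≤ d → j' ≤ d →
      c * (s * x ^ (s - 1)) ≤ |j * (s * x ^ (s - 1)) - j' * (t * x ^ (t - 1))| := by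
  set α0 := (1 + x0) / 2 with hα0
  have h1 : 1 < α0 := by rw [hα0]; linarith
  obtain ⟨r0, hr0⟩ : ∃ r0 : ℕ, ∀ r ≥ r0, 2 * (d:ℝ) ≤ α0 ^ r :=
    eventually_atTop.1 ((tendsto_pow_atTop_atTop_of_one_lt h1).eventually_ge_atTop _)
  let F : ℕ → ℕ → ℕ → ℝ × ℝ → ℝ := fun r j j' z => |j - j' * (1 - r * z.2) / z.1 ^ r|
  have key : ∀ᶠ c in nhdsWithin (0:ℝ) (Set.Ioi 0), ∀ r ∈ Finset.Ico 1 (r0 + 1),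
      ∀ j ∈ Finset.Icc 1 d, ∀ j' ∈ Finset.range (d + 1), ∀ᶠ z in nhds (x0, (0:ℝ)), c ≤ F r j j' z := by
    refine (eventually_all_finset _).2 fun r hrm => (eventually_all_finset _).2 fun j hj =>
      (eventually_all_finset _).2 fun j' hj' => ?_
    have hxp : x0 ^ r ≠ 0 := by positivity
    have cF : ContinuousAt (F r j j') (x0, 0) := by
      have : ContinuousAt (fun z : ℝ × ℝ => (j:ℝ) - j' * (1 - r * z.2) / z.1 ^ r) (x0, 0) := by
        apply ContinuousAt.sub continuousAt_const
        refine ContinuousAt.div (f := fun z : ℝ × ℝ => (j':ℝ) * (1 - r * z.2))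
          (g := fun z : ℝ × ℝ => z.1 ^ r) (by fun_prop) (by fun_prop) hxp
      exact this.abs
    have hFpos : 0 < F r j j' (x0, 0) := by
      apply abs_pos.2
      simp only [mul_zero, sub_zero, mul_one]
      intro hcon
      have h3 := hr r j j' (Finset.mem_Ico.1 hrm).1 (Finset.mem_Icc.1 hj).1
      apply h3
      have : (j:ℝ) = j' / x0 ^ r := by linarith
      rw [this]; field_simp
    filter_upwards [(eventually_lt_nhds hFpos).filter_mono nhdsWithin_le_nhds] with c hc
    exact cF.eventually_const_le hc
  have key2 := key.and ((eventually_le_nhds (show (0:ℝ) < 1 / 2 by norm_num)).filter_mono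
    (nhdsWithin_le_nhds (s := Set.Ioi 0)))
  obtain ⟨c, ⟨hc, hc2⟩, hc0⟩ := (key2.and self_mem_nhdsWithin).exists
  have hz : ∀ᶠ z in nhds (x0, (0:ℝ)), ∀ r ∈ Finset.Ico 1 (r0 + 1),
      ∀ j ∈ Finset.Icc 1 d, ∀ j' ∈ Finset.range (d + 1), c ≤ F r j j' z :=
    (eventually_all_finset _).2 fun r hrm => (eventually_all_finset _).2 fun j hj =>
      (eventually_all_finset _).2 fun j' hj' => hc r hrm j hj j' hj'
  rw [nhds_prod_eq] at hz
  obtain ⟨pa, hpa, pb, hpb, hpp⟩ := eventually_prod_iff.1 hz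
  obtain ⟨δ, hδ, hδp⟩ := Metric.eventually_nhds_iff.1 hpa
  have hn : ∀ᶠ n : ℕ in atTop, pb (1 / (n:ℝ)) := tendsto_one_div_atTop_nhds_zero_nat.eventually hpb
  obtain ⟨n0, hn0⟩ := eventually_atTop.1 hn
  have hδ2 : 0 < min (δ / 2) ((x0 - 1) / 2) := by
    apply lt_min <;> linarith
  refine ⟨c, hc0, n0, min (δ / 2) ((x0 - 1) / 2), hδ2, ?_, by linarith, ?_⟩
  · have := min_le_right (δ / 2) ((x0 - 1) / 2); linarith
  intro x hx1 hx2 s t hs hts j j' hj1 hjd hj'd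
  have m1 := min_le_left (δ / 2) ((x0 - 1) / 2)
  have m2 := min_le_right (δ / 2) ((x0 - 1) / 2)
  have hxα : α0 ≤ x := by rw [hα0]; linarith
  have hx0' : 0 < x := by linarith
  have hs0 : (0:ℝ) < s := by exact_mod_cast (by omega : 0 < s)
  set r := s - t with hrd
  have hr1 : 1 ≤ r := by omega
  have hrs : (t:ℝ) = s - r := by
    rw [hrd, Nat.cast_sub hts.le]; ring
  have e1 : (t:ℝ) * x ^ (t - 1) = (s * x ^ (s - 1)) * ((1 - r * (1 / (s:ℝ))) / x ^ r) := by
    have e2 : (1 - r * (1 / (s:ℝ))) = t / s := by rw [hrs]; field_simp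
    rw [e2]
    rcases Nat.eq_zero_or_pos t with h0 | h0
    · rw [h0]; simp
    · have : x ^ (s - 1) = x ^ (t - 1) * x ^ r := by rw [← pow_add]; congr 1; omega
      rw [this]; field_simp
  have hpos : 0 < (s:ℝ) * x ^ (s - 1) := by positivity
  have e3 : |j * (s * x ^ (s - 1)) - j' * (t * x ^ (t - 1))| =
      (s * x ^ (s - 1)) * |j - j' * (1 - r * (1 / (s:ℝ))) / x ^ r| := by
    rw [e1, ← abs_of_pos hpos, ← abs_mul, abs_of_pos hpos]
    congr 1; ring
  rw [e3, mul_comm c]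
  apply mul_le_mul_of_nonneg_left _ hpos.le
  rcases le_total r r0 with hc' | hc'
  · have := hpp (hδp (show dist x x0 < δ by
      rw [Real.dist_eq, abs_lt]; constructor <;> linarith)) (hn0 s hs) r
        (Finset.mem_Ico.2 ⟨hr1, by omega⟩) j (Finset.mem_Icc.2 ⟨hj1, hjd⟩) j'
        (Finset.mem_range.2 (by omega))
    exact this
  · refine hc2.trans ?_
    refine le_trans ?_ (le_abs_self _)
    have hj1' : (1:ℝ) ≤ j := by exact_mod_cast hj1
    have hj'd' : (j':ℝ) ≤ d := by exact_mod_cast hj'd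
    have q1 : 2 * (d:ℝ) ≤ x ^ r := (hr0 r hc').trans (by gcongr)
    have q2 : 1 - r * (1 / (s:ℝ)) ≤ 1 := by
      have : 0 ≤ r * (1 / (s:ℝ)) := by positivity
      linarith
    have q3 : j' * (1 - r * (1 / (s:ℝ))) / x ^ r ≤ 1 / 2 := by
      rw [div_le_iff₀ (by positivity)]
      have : (j':ℝ) * (1 - r * (1 / (s:ℝ))) ≤ j' * 1 := by gcongr
      linarith
    linarith

lemma res_countable : {x : ℝ | 0 ≤ x ∧ ∃ r j j' : ℕ, 1 ≤ r ∧ 1 ≤ j ∧ (j:ℝ) * x ^ r = j'}.Countable := by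
  have : {x : ℝ | 0 ≤ x ∧ ∃ r j j' : ℕ, 1 ≤ r ∧ 1 ≤ j ∧ (j:ℝ) * x ^ r = j'} =
      ⋃ r : ℕ, ⋃ j : ℕ, ⋃ j' : ℕ, {x : ℝ | 0 ≤ x ∧ 1 ≤ r ∧ 1 ≤ j ∧ (j:ℝ) * x ^ r = j'} := by
    ext x; simp
  rw [this]
  refine Set.countable_iUnion fun r => Set.countable_iUnion fun j => Set.countable_iUnion fun j' => ?_
  apply Set.Subsingleton.countable
  rintro x ⟨h1, h2, h3, h4⟩ y ⟨k1, k2, k3, k4⟩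
  have hj : (0:ℝ) < j := by exact_mod_cast h3
  have : x ^ r = y ^ r := by
    have := h4.trans k4.symm
    exact mul_left_cancel₀ hj.ne' this
  exact (pow_left_inj₀ h1 k1 (by omega)).1 this

end LIL

namespace LIL

section
variable (ξ α β c : ℝ) (n0 d : ℕ) 

/-- oscillation constant -/
noncomputable def Ko (ξ β c : ℝ) (d : ℕ) : ℝ :=
  2 * β / (2 * Real.pi * ξ * c) + 2 * (2 * Real.pi * ξ * (2 * d)) / (2 * Real.pi * ξ * c) ^ 2

lemma Ko_nonneg (hξ : 0 < ξ) (hβ : 0 < β) (hc : 0 < c) : 0 ≤ Ko ξ β c d := by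
  unfold Ko; have := Real.pi_pos; positivity

lemma single (hξ : 0 < ξ) (hc : 0 < c) (hc1 : c ≤ 1) (hα : 1 < α) (b γ u w : ℝ) (s sa g : ℕ)
    (hb : 1 ≤ |b|) (hb2 : |b| ≤ 2 * d)
    (hsa : 1 ≤ sa) (hs : sa ≤ s) (hg : g + 1 ≤ sa)
    (hu : α ≤ u) (huw : u ≤ w) (hwβ : w ≤ β) (hH : 1 / (sa * u ^ (sa - g)) ≤ w - u) :
    |∫ x in u..w, Real.cos (2 * Real.pi * b * (ξ * x ^ s) + γ)| ≤
      Ko ξ β c d * (1 / α) ^ g * (w - u) := by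
  have hpi := Real.pi_pos
  have := osc_fin (2 * Real.pi * ξ * b) 0 γ (2 * Real.pi * ξ * c) (2 * Real.pi * ξ * (2 * d)) u w α β
    s 0 sa g hsa hs (by omega) hα hu huw hwβ (by positivity)
    (by rw [abs_mul, abs_of_pos (by positivity)]; gcongr) (by rw [abs_zero]; positivity) hg hH ?_
  · refine le_trans (le_of_eq ?_) this
    congr 1
    apply intervalIntegral.integral_congr
    intro x _
    simp only
    congr 1; ring
  · intro x hx
    have hx0 : 0 < x := by linarith [hx.1]
    rw [zero_mul, add_zero, abs_mul, abs_mul, abs_of_pos (show 0 < 2 * Real.pi * ξ by positivity),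
      abs_of_nonneg (a := (s:ℝ) * x ^ (s - 1)) (by positivity)]
    have : c ≤ |b| := by linarith
    gcongr

variable (hnr : ∀ x, α ≤ x → x ≤ β → ∀ s t : ℕ, n0 ≤ s → t < s → ∀ j j' : ℕ, 1 ≤ j → j ≤ d →
  j' ≤ d → c * (s * x ^ (s - 1)) ≤ |j * (s * x ^ (s - 1)) - j' * (t * x ^ (t - 1))|)

include hnr in
lemma two (hξ : 0 < ξ) (hc : 0 < c) (hc1 : c ≤ 1) (hα : 1 < α) (γ u w sg : ℝ) (s t sa g j j' : ℕ)
    (hsg : sg = 1 ∨ sg = -1) (hts : t < s) (hn : n0 ≤ s) (hj : 1 ≤ j) (hjd : j ≤ d) (hjd' : j' ≤ d)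
    (hsa : 1 ≤ sa) (hs : sa ≤ s) (hg : g + 1 ≤ sa)
    (hu : α ≤ u) (huw : u ≤ w) (hwβ : w ≤ β) (hH : 1 / (sa * u ^ (sa - g)) ≤ w - u) :
    |∫ x in u..w, Real.cos (2 * Real.pi * j * (ξ * x ^ s) + sg * (2 * Real.pi * j' * (ξ * x ^ t)) + γ)| ≤
      Ko ξ β c d * (1 / α) ^ g * (w - u) := by
  have hpi := Real.pi_pos
  have hjd2 : (j:ℝ) ≤ d := by exact_mod_cast hjd
  have hjd2' : (j':ℝ) ≤ d := by exact_mod_cast hjd'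
  have hj2 : (1:ℝ) ≤ j := by exact_mod_cast hj
  have hd0 : (0:ℝ) ≤ d := by positivity
  have hsga : |sg| = 1 := by rcases hsg with h | h <;> simp [h]
  have := osc_fin (2 * Real.pi * ξ * j) (2 * Real.pi * ξ * (sg * j')) γ (2 * Real.pi * ξ * c)
    (2 * Real.pi * ξ * (2 * d)) u w α β
    s t sa g hsa hs hts.le hα hu huw hwβ (by positivity)
    (by rw [abs_of_nonneg (by positivity)]; gcongr; linarith)
    (by rw [abs_mul, abs_of_pos (show 0 < 2 * Real.pi * ξ by positivity), abs_mul sg, hsga, one_mul, Nat.abs_cast]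
        gcongr; linarith) hg hH ?_
  · refine le_trans (le_of_eq ?_) this
    congr 1
    apply intervalIntegral.integral_congr
    intro x _
    simp only
    congr 1; ring
  · intro x hx
    have hx0 : 0 < x := by linarith [hx.1]
    have e : 2 * Real.pi * ξ * j * (s * x ^ (s - 1)) + 2 * Real.pi * ξ * (sg * j') * (t * x ^ (t - 1))
      = (2 * Real.pi * ξ) * (j * (s * x ^ (s - 1)) + sg * (j' * (t * x ^ (t - 1)))) := by ring
    rw [e, abs_mul, abs_of_pos (show 0 < 2 * Real.pi * ξ by positivity), mul_assoc (2 * Real.pi * ξ) c]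
    gcongr
    rcases hsg with h | h
    · rw [h, one_mul, abs_of_nonneg (by positivity)]
      have h1 : c * (s * x ^ (s - 1)) ≤ j * (s * x ^ (s - 1)) := by
        gcongr; linarith
      have : 0 ≤ (j':ℝ) * (t * x ^ (t - 1)) := by positivity
      linarith
    · rw [h, neg_one_mul, ← sub_eq_add_neg]
      exact hnr x (by linarith [hx.1]) (by linarith [hx.2]) s t hn hts j j' hj hjd hjd'

lemma half_bound (F G : ℝ → ℝ) (cF : Continuous F) (cG : Continuous G) (u w z K : ℝ)
    (h1 : |(∫ x in u..w, Real.cos (F x - G x)) - 2 * z| ≤ K)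
    (h2 : |∫ x in u..w, Real.cos (F x + G x)| ≤ K) :
    |(∫ x in u..w, Real.cos (F x) * Real.cos (G x)) - z| ≤ K := by
  have e : ∀ x, Real.cos (F x) * Real.cos (G x) =
      (1 / 2) * (Real.cos (F x - G x) + Real.cos (F x + G x)) := by
    intro x; rw [Real.cos_sub, Real.cos_add]; ring
  simp_rw [e]
  rw [intervalIntegral.integral_const_mul, intervalIntegral.integral_add]
  · rw [abs_le] at *
    constructor <;> linarith [h1.1, h1.2, h2.1, h2.2]
  · exact (Real.continuous_cos.comp (cF.sub cG)).intervalIntegrable _ _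
  · exact (Real.continuous_cos.comp (cF.add cG)).intervalIntegrable _ _

include hnr in
lemma pair_lt (hξ : 0 < ξ) (hc : 0 < c) (hc1 : c ≤ 1) (hα : 1 < α) (φ φ' u w : ℝ) (s t sa g j j' : ℕ)
    (hts : t < s) (hn : n0 ≤ s) (hj : 1 ≤ j) (hjd : j ≤ d) (hjd' : j' ≤ d)
    (hsa : 1 ≤ sa) (hs : sa ≤ s) (hg : g + 1 ≤ sa)
    (hu : α ≤ u) (huw : u ≤ w) (hwβ : w ≤ β) (hH : 1 / (sa * u ^ (sa - g)) ≤ w - u) :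
    |∫ x in u..w, Real.cos (2 * Real.pi * j * (ξ * x ^ s) + φ) *
      Real.cos (2 * Real.pi * j' * (ξ * x ^ t) + φ')| ≤ Ko ξ β c d * (1 / α) ^ g * (w - u) := by
  have := half_bound (fun x => 2 * Real.pi * j * (ξ * x ^ s) + φ)
    (fun x => 2 * Real.pi * j' * (ξ * x ^ t) + φ') (by fun_prop) (by fun_prop) u w 0
    (Ko ξ β c d * (1 / α) ^ g * (w - u)) ?_ ?_
  · simpa using this
  · have := two ξ α β c n0 d hnr hξ hc hc1 hα (φ - φ') u w (-1) s t sa g j j' (Or.inr rfl) hts hn hj hjd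
      hjd' hsa hs hg hu huw hwβ hH
    rw [mul_zero, sub_zero]
    refine le_trans (le_of_eq ?_) this
    congr 1
    apply intervalIntegral.integral_congr
    intro x _
    simp only
    congr 1; ring
  · have := two ξ α β c n0 d hnr hξ hc hc1 hα (φ + φ') u w 1 s t sa g j j' (Or.inl rfl) hts hn hj hjd
      hjd' hsa hs hg hu huw hwβ hH
    refine le_trans (le_of_eq ?_) this
    congr 1
    apply intervalIntegral.integral_congr
    intro x _
    simp only
    congr 1; ring

include hnr in
lemma pair (hξ : 0 < ξ) (hc : 0 < c) (hc1 : c ≤ 1) (hα : 1 < α) (φ φ' u w : ℝ) (s t sa g j j' : ℕ)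
    (hn : n0 ≤ sa) (hj : 1 ≤ j) (hjd : j ≤ d) (hj' : 1 ≤ j') (hjd' : j' ≤ d)
    (hsa : 1 ≤ sa) (hs : sa ≤ s) (ht : sa ≤ t) (hg : g + 1 ≤ sa)
    (hu : α ≤ u) (huw : u ≤ w) (hwβ : w ≤ β) (hH : 1 / (sa * u ^ (sa - g)) ≤ w - u) :
    |(∫ x in u..w, Real.cos (2 * Real.pi * j * (ξ * x ^ s) + φ) *
      Real.cos (2 * Real.pi * j' * (ξ * x ^ t) + φ')) -
      (if s = t ∧ j = j' then Real.cos (φ - φ') / 2 else 0) * (w - u)|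
      ≤ Ko ξ β c d * (1 / α) ^ g * (w - u) := by
  have hjd2 : (j:ℝ) ≤ d := by exact_mod_cast hjd
  have hjd2' : (j':ℝ) ≤ d := by exact_mod_cast hjd'
  have hj2 : (1:ℝ) ≤ j := by exact_mod_cast hj
  have hj2' : (1:ℝ) ≤ j' := by exact_mod_cast hj'
  have hK : 0 ≤ Ko ξ β c d * (1 / α) ^ g * (w - u) := by
    have := Ko_nonneg ξ β c d hξ (by linarith) hc
    have : 0 ≤ w - u := by linarith
    have : 0 < α := by linarith
    positivity
  rcases lt_trichotomy s t with h | h | h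
  · rw [if_neg (fun hh => h.ne hh.1), zero_mul, sub_zero]
    have := pair_lt ξ α β c n0 d hnr hξ hc hc1 hα φ' φ u w t s sa g j' j h (hn.trans ht) hj' hjd' hjd
      hsa ht hg hu huw hwβ hH
    refine le_trans (le_of_eq ?_) this
    congr 1
    apply intervalIntegral.integral_congr
    intro x _
    simp only
    ring
  · subst h
    apply half_bound (fun x => 2 * Real.pi * j * (ξ * x ^ s) + φ)
      (fun x => 2 * Real.pi * j' * (ξ * x ^ s) + φ') (by fun_prop) (by fun_prop)
    · by_cases hjj : j = j'
      · subst hjj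
        simp only [true_and, if_true, add_sub_add_left_eq_sub, intervalIntegral.integral_const,
          smul_eq_mul]
        refine le_trans (le_of_eq ?_) hK
        rw [abs_eq_zero]; ring
      · rw [if_neg (fun hh => hjj hh.2), zero_mul, mul_zero, sub_zero]
        have := single ξ α β c d hξ hc hc1 hα ((j:ℝ) - j') (φ - φ') u w s sa g ?_ ?_ hsa hs hg
          hu huw hwβ hH
        · refine le_trans (le_of_eq ?_) this
          congr 1
          apply intervalIntegral.integral_congr
          intro x _
          simp only
          congr 1; ring
        · have h1 : (1:ℤ) ≤ |(j:ℤ) - j'| := Int.one_le_abs (by omega)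
          exact_mod_cast h1
        · rw [abs_le]; constructor <;> linarith
    · have := single ξ α β c d hξ hc hc1 hα ((j:ℝ) + j') (φ + φ') u w s sa g ?_ ?_ hsa hs hg
          hu huw hwβ hH
      · refine le_trans (le_of_eq ?_) this
        congr 1
        apply intervalIntegral.integral_congr
        intro x _
        simp only
        congr 1; ring
      · rw [abs_of_nonneg (by positivity)]; linarith
      · rw [abs_of_nonneg (by positivity)]; linarith
  · rw [if_neg (fun hh => h.ne' hh.1), zero_mul, sub_zero]
    exact pair_lt ξ α β c n0 d hnr hξ hc hc1 hα φ φ' u w s t sa g j j' h (hn.trans hs) hj hjd hjd'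
      hsa hs hg hu huw hwβ hH

end

lemma pow_diff (s : ℕ) (x y z : ℝ) (hx : 1 ≤ x) (hy : 1 ≤ y) (hxz : x ≤ z) (hyz : y ≤ z) :
    |x ^ s - y ^ s| ≤ s * z ^ s * |x - y| := by
  have := Convex.norm_image_sub_le_of_norm_deriv_le (f := fun x : ℝ => x ^ s) (C := s * z ^ s)
    (s := Set.Icc 1 z) (x := y) (y := x) (fun _ _ => by fun_prop) (fun t ht => ?_) (convex_Icc _ _)
    ⟨hy, hyz⟩ ⟨hx, hxz⟩
  · simpa using this
  · have h0 : 0 ≤ t := by linarith [ht.1]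
    have e : deriv (fun x : ℝ => x ^ s) t = s * t ^ (s - 1) := by simp
    rw [e, Real.norm_eq_abs, abs_of_nonneg (by positivity)]
    gcongr
    calc t ^ (s - 1) ≤ t ^ s := pow_le_pow_right₀ ht.1 (by omega)
      _ ≤ z ^ s := by gcongr; exact ht.2

lemma pow_osc (s sa g : ℕ) (α u w : ℝ) (hα : 1 < α) (hsa : 1 ≤ sa) (hs : s + 2 * g ≤ sa)
    (hu : α ≤ u) (hH : w - u ≤ 2 * (1 / (sa * u ^ (sa - g)))) (x y : ℝ) (hx : x ∈ Set.Icc u w)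
    (hy : y ∈ Set.Icc u w) : |x ^ s - y ^ s| ≤ 2 * Real.exp 2 * (1 / α) ^ g := by
  have huw : u ≤ w := hx.1.trans hx.2
  have hu1 : 1 ≤ u := by linarith
  have hsa' : (1:ℝ) ≤ sa := by exact_mod_cast hsa
  have hss : (s:ℝ) ≤ sa := by exact_mod_cast (by omega : s ≤ sa)
  have h1 := pow_diff s x y w (by linarith [hx.1]) (by linarith [hy.1]) hx.2 hy.2
  have h2 : |x - y| ≤ w - u := by rw [abs_le]; constructor <;> linarith [hx.1, hx.2, hy.1, hy.2]
  have hpow : (1:ℝ) ≤ u ^ (sa - g) := one_le_pow₀ hu1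
  have h3 : s * (w - u) ≤ 2 := by
    have : s * (w - u) ≤ sa * (2 * (1 / (sa * 1))) := by
      have hwu : 0 ≤ w - u := by linarith
      refine mul_le_mul hss (hH.trans ?_) hwu (by positivity)
      gcongr
    refine this.trans (le_of_eq ?_)
    field_simp
  have h4 : w ^ s ≤ Real.exp 2 * u ^ s := by
    have : w ≤ u * Real.exp (w - u) := by
      have := Real.add_one_le_exp (w - u)
      nlinarith
    calc w ^ s ≤ (u * Real.exp (w - u)) ^ s := by gcongr; linarith
      _ = Real.exp (s * (w - u)) * u ^ s := by rw [mul_pow, ← Real.exp_nat_mul]; ring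
      _ ≤ _ := by gcongr
  have hg' : (1 / α) ^ g = 1 / α ^ g := by rw [div_pow, one_pow]
  calc |x ^ s - y ^ s| ≤ s * w ^ s * |x - y| := h1
    _ ≤ sa * (Real.exp 2 * u ^ s) * (2 * (1 / (sa * u ^ (sa - g)))) := by
        have := h2.trans hH
        have hw0 : 0 ≤ w := by linarith
        have hw1 : 0 ≤ w ^ s := by positivity
        gcongr
    _ = 2 * Real.exp 2 * (u ^ s / u ^ (sa - g)) := by field_simp
    _ ≤ 2 * Real.exp 2 * (1 / α) ^ g := by
        gcongr
        rw [hg', div_le_div_iff₀ (by positivity) (by positivity), one_mul]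
        calc u ^ s * α ^ g ≤ u ^ s * u ^ g := by gcongr
          _ = u ^ (s + g) := by rw [pow_add]
          _ ≤ u ^ (sa - g) := pow_le_pow_right₀ hu1 (by omega)

end LIL

namespace LIL

section
variable {ι : Type} (I : Finset ι) (q φ : ι → ℝ) (j : ι → ℕ)

noncomputable def Pf (y : ℝ) : ℝ := ∑ i ∈ I, q i * Real.cos (2 * Real.pi * j i * y + φ i)
noncomputable def Qs : ℝ := ∑ i ∈ I, |q i|
noncomputable def Vs : ℝ :=
  ∑ i ∈ I, ∑ i' ∈ I, q i * q i' * (if j i = j i' then Real.cos (φ i - φ i') / 2 else 0)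

lemma Qs_nonneg : 0 ≤ Qs I q := Finset.sum_nonneg fun _ _ => abs_nonneg _

lemma Pf_cont : Continuous (Pf I q φ j) := by unfold Pf; fun_prop

lemma Pf_bd (y : ℝ) : |Pf I q φ j y| ≤ Qs I q := by
  refine (Finset.abs_sum_le_sum_abs _ _).trans (Finset.sum_le_sum fun i _ => ?_)
  rw [abs_mul]
  exact mul_le_of_le_one_right (abs_nonneg _) (Real.abs_cos_le_one _)

lemma cos_lip (x y : ℝ) : |Real.cos x - Real.cos y| ≤ |x - y| := by
  have := Real.cos_sub_cos x y
  rw [this, abs_mul, abs_mul]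
  have h1 := Real.abs_sin_le_one ((x + y) / 2)
  have h2 : |Real.sin ((x - y) / 2)| ≤ |(x - y) / 2| := Real.abs_sin_le_abs
  rw [abs_div, abs_two] at h2
  have h3 := abs_nonneg (Real.sin ((x + y) / 2))
  have h4 := abs_nonneg (Real.sin ((x - y) / 2))
  have h5 : |(-2:ℝ)| = 2 := by norm_num
  rw [h5]
  nlinarith

lemma Pf_lip (d : ℕ) (hjd : ∀ i ∈ I, j i ≤ d) (y z : ℝ) :
    |Pf I q φ j y - Pf I q φ j z| ≤ Qs I q * (2 * Real.pi * d) * |y - z| := by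
  have hpi := Real.pi_pos
  unfold Pf Qs
  rw [← Finset.sum_sub_distrib, mul_assoc, Finset.sum_mul]
  refine (Finset.abs_sum_le_sum_abs _ _).trans (Finset.sum_le_sum fun i hi => ?_)
  have hd : (j i : ℝ) ≤ d := by exact_mod_cast hjd i hi
  rw [← mul_sub, abs_mul]
  gcongr
  refine (cos_lip _ _).trans ?_
  have e : 2 * Real.pi * j i * y + φ i - (2 * Real.pi * j i * z + φ i) = 2 * Real.pi * j i * (y - z) := by ring
  rw [e, abs_mul, abs_of_nonneg (by positivity)]
  gcongr

lemma Pf_i1 (ξ α β c : ℝ) (d : ℕ) (hξ : 0 < ξ) (hc : 0 < c) (hc1 : c ≤ 1) (hα : 1 < α)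
    (hj1 : ∀ i ∈ I, 1 ≤ j i) (hjd : ∀ i ∈ I, j i ≤ d) (u w : ℝ) (s sa g : ℕ)
    (hsa : 1 ≤ sa) (hs : sa ≤ s) (hg : g + 1 ≤ sa)
    (hu : α ≤ u) (huw : u ≤ w) (hwβ : w ≤ β) (hH : 1 / (sa * u ^ (sa - g)) ≤ w - u) :
    |∫ x in u..w, Pf I q φ j (ξ * x ^ s)| ≤ (Qs I q * Ko ξ β c d) * (1 / α) ^ g * (w - u) := by
  unfold Pf Qs
  rw [intervalIntegral.integral_finsetSum
    (fun i _ => Continuous.intervalIntegrable (by fun_prop) _ _), mul_assoc, mul_assoc, Finset.sum_mul]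
  refine (Finset.abs_sum_le_sum_abs _ _).trans (Finset.sum_le_sum fun i hi => ?_)
  rw [intervalIntegral.integral_const_mul, abs_mul]
  have h1 : (1:ℝ) ≤ j i := by exact_mod_cast hj1 i hi
  have hd : (j i : ℝ) ≤ d := by exact_mod_cast hjd i hi
  gcongr
  rw [← mul_assoc]
  exact single ξ α β c d hξ hc hc1 hα (j i) (φ i) u w s sa g (by rw [Nat.abs_cast]; exact h1)
    (by rw [Nat.abs_cast]; linarith) hsa hs hg hu huw hwβ hH

lemma Pf_i2 (ξ α β c : ℝ) (n0 d : ℕ) (hnr : ∀ x, α ≤ x → x ≤ β → ∀ s t : ℕ, n0 ≤ s → t < s →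
      ∀ j j' : ℕ, 1 ≤ j → j ≤ d →
      j' ≤ d → c * (s * x ^ (s - 1)) ≤ |j * (s * x ^ (s - 1)) - j' * (t * x ^ (t - 1))|)
    (hξ : 0 < ξ) (hc : 0 < c) (hc1 : c ≤ 1) (hα : 1 < α)
    (hj1 : ∀ i ∈ I, 1 ≤ j i) (hjd : ∀ i ∈ I, j i ≤ d) (u w : ℝ) (s t sa g : ℕ) (hn : n0 ≤ sa)
    (hsa : 1 ≤ sa) (hs : sa ≤ s) (ht : sa ≤ t) (hg : g + 1 ≤ sa)
    (hu : α ≤ u) (huw : u ≤ w) (hwβ : w ≤ β) (hH : 1 / (sa * u ^ (sa - g)) ≤ w - u) :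
    |(∫ x in u..w, Pf I q φ j (ξ * x ^ s) * Pf I q φ j (ξ * x ^ t))
      - (if s = t then Vs I q φ j else 0) * (w - u)| ≤
      (Qs I q ^ 2 * Ko ξ β c d) * (1 / α) ^ g * (w - u) := by
  have e1 : ∀ x, Pf I q φ j (ξ * x ^ s) * Pf I q φ j (ξ * x ^ t) = ∑ i ∈ I, ∑ i' ∈ I,
      q i * q i' * (Real.cos (2 * Real.pi * j i * (ξ * x ^ s) + φ i) *
        Real.cos (2 * Real.pi * j i' * (ξ * x ^ t) + φ i')) := by
    intro x
    unfold Pf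
    rw [Finset.sum_mul_sum]
    refine Finset.sum_congr rfl fun i _ => Finset.sum_congr rfl fun i' _ => ?_
    ring
  have e2 : (if s = t then Vs I q φ j else 0) = ∑ i ∈ I, ∑ i' ∈ I,
      q i * q i' * (if s = t ∧ j i = j i' then Real.cos (φ i - φ i') / 2 else 0) := by
    by_cases h : s = t
    · simp [h, Vs]
    · simp [h]
  have e3 : Qs I q ^ 2 = ∑ i ∈ I, ∑ i' ∈ I, |q i| * |q i'| := by
    unfold Qs; rw [sq, Finset.sum_mul_sum]
  simp_rw [e1]
  rw [e2, e3, intervalIntegral.integral_finsetSum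
    (fun i _ => Continuous.intervalIntegrable (by fun_prop) _ _), mul_assoc, mul_assoc,
    Finset.sum_mul, Finset.sum_mul, ← Finset.sum_sub_distrib]
  refine (Finset.abs_sum_le_sum_abs _ _).trans (Finset.sum_le_sum fun i hi => ?_)
  rw [intervalIntegral.integral_finsetSum
    (fun i _ => Continuous.intervalIntegrable (by fun_prop) _ _),
    Finset.sum_mul, Finset.sum_mul, ← Finset.sum_sub_distrib]
  refine (Finset.abs_sum_le_sum_abs _ _).trans (Finset.sum_le_sum fun i' hi' => ?_)
  rw [intervalIntegral.integral_const_mul, mul_assoc (q i * q i'), ← mul_sub, abs_mul, abs_mul]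
  gcongr
  rw [← mul_assoc]
  exact pair ξ α β c n0 d hnr hξ hc hc1 hα (φ i) (φ i') u w s t sa g (j i) (j i') hn
    (hj1 i hi) (hjd i hi) (hj1 i' hi') (hjd i' hi') hsa hs ht hg hu huw hwβ hH

lemma cos_unit (A γ : ℝ) (k : ℤ) : ∫ y in A..(A + 1), Real.cos (2 * Real.pi * k * y + γ) =
    if k = 0 then Real.cos γ else 0 := by
  by_cases hk : k = 0
  · simp [hk]
  · have hk' : (k:ℝ) ≠ 0 := by exact_mod_cast hk
    have h2 : 2 * Real.pi * k ≠ 0 := by have := Real.pi_pos; positivity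
    rw [if_neg hk, intervalIntegral.integral_comp_mul_add (f := Real.cos) (c := 2 * Real.pi * k) h2 γ, integral_cos]
    have : 2 * Real.pi * k * (A + 1) + γ = (2 * Real.pi * k * A + γ) + k * (2 * Real.pi) := by ring
    rw [this, Real.sin_add_int_mul_two_pi, sub_self, smul_zero]

lemma Pf_var (A : ℝ) (hj1 : ∀ i ∈ I, 1 ≤ j i) :
    ∫ y in A..(A + 1), Pf I q φ j y ^ 2 = Vs I q φ j := by
  have e1 : ∀ x, Pf I q φ j x ^ 2 = ∑ i ∈ I, ∑ i' ∈ I,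
      q i * q i' * (Real.cos (2 * Real.pi * ((j i + j i' : ℤ) : ℝ) * x + (φ i + φ i')) / 2 +
        Real.cos (2 * Real.pi * ((j i - j i' : ℤ):ℝ) * x + (φ i - φ i')) / 2) := by
    intro x
    unfold Pf
    rw [sq, Finset.sum_mul_sum]
    refine Finset.sum_congr rfl fun i _ => Finset.sum_congr rfl fun i' _ => ?_
    have ea : 2 * Real.pi * ((j i + j i' : ℤ) : ℝ) * x + (φ i + φ i') =
      (2 * Real.pi * j i * x + φ i) + (2 * Real.pi * j i' * x + φ i') := by push_cast; ring
    have eb : 2 * Real.pi * ((j i - j i' : ℤ) : ℝ) * x + (φ i - φ i') =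
      (2 * Real.pi * j i * x + φ i) - (2 * Real.pi * j i' * x + φ i') := by push_cast; ring
    rw [ea, eb]
    generalize 2 * Real.pi * j i * x + φ i = X
    generalize 2 * Real.pi * j i' * x + φ i' = Y
    rw [Real.cos_add, Real.cos_sub]
    ring
  simp_rw [e1]
  rw [intervalIntegral.integral_finsetSum
    (fun i _ => Continuous.intervalIntegrable (by fun_prop) _ _)]
  unfold Vs
  refine Finset.sum_congr rfl fun i hi => ?_
  rw [intervalIntegral.integral_finsetSum
    (fun i _ => Continuous.intervalIntegrable (by fun_prop) _ _)]
  refine Finset.sum_congr rfl fun i' hi' => ?_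
  rw [intervalIntegral.integral_const_mul, intervalIntegral.integral_add
    (Continuous.intervalIntegrable (by fun_prop) _ _)
    (Continuous.intervalIntegrable (by fun_prop) _ _), intervalIntegral.integral_div,
    intervalIntegral.integral_div, cos_unit, cos_unit]
  have h1 := hj1 i hi
  rw [if_neg (by omega)]
  by_cases h : j i = j i'
  · simp [h]
  · rw [if_neg h, if_neg (by omega)]; simp

end

end LIL

namespace LIL

section
variable {ι : Type} (I : Finset ι) (q φ : ι → ℝ) (j : ι → ℕ)

lemma Vs_nonneg (hj1 : ∀ i ∈ I, 1 ≤ j i) : 0 ≤ Vs I q φ j := by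
  rw [← Pf_var I q φ j 0 hj1]
  exact intervalIntegral.integral_nonneg (by norm_num) fun _ _ => sq_nonneg _

lemma exists_sys (ξ x0 : ℝ) (d : ℕ) (hξ : 0 < ξ) (hx0 : 1 < x0)
    (hr : ∀ r j j' : ℕ, 1 ≤ r → 1 ≤ j → (j:ℝ) * x0 ^ r ≠ j')
    (hj1 : ∀ i ∈ I, 1 ≤ j i) (hjd : ∀ i ∈ I, j i ≤ d)
    (σ : ℕ → ℕ) (hσ : StrictMono σ) (hσ1 : ∀ n, n + 1 ≤ σ n) :
    ∃ S : Sys, ∃ δ > 0, S.f = (fun n x => Pf I q φ j (ξ * x ^ σ n)) ∧ S.α = x0 - δ ∧ S.β = x0 + δ ∧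
      S.v = Vs I q φ j := by
  obtain ⟨c, hc, n0, δ, hδ, hα, hc1, hnr⟩ := nonres x0 hx0 d hr
  have hσd : ∀ a k, σ a + k ≤ σ (a + k) := by
    intro a k
    induction k with
    | zero => simp
    | succ k ih =>
      have : σ (a + k) < σ (a + (k + 1)) := hσ (by omega)
      omega
  have hβ : 0 < x0 + δ := by linarith
  have hK := Ko_nonneg ξ (x0 + δ) c d hξ hβ hc
  have hQ := Qs_nonneg I q
  have hpi := Real.pi_pos
  have he := Real.exp_pos 2
  obtain ⟨K, hKdef⟩ : ∃ K, K = Ko ξ (x0 + δ) c d := ⟨_, rfl⟩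
  obtain ⟨Q, hQdef⟩ : ∃ Q, Q = Qs I q := ⟨_, rfl⟩
  rw [← hKdef] at hK
  rw [← hQdef] at hQ
  have t1 : 0 ≤ Q * (2 * Real.pi * d) * (ξ * (2 * Real.exp 2)) := by positivity
  have t2 : 0 ≤ Q * K := by positivity
  have t3 : 0 ≤ Q ^ 2 * K := by positivity
  obtain ⟨C, hC⟩ : ∃ C, C = 1 + Q + Q * (2 * Real.pi * d) * (ξ * (2 * Real.exp 2)) + Q * K + Q ^ 2 * K :=
    ⟨_, rfl⟩
  have hα0 : 0 < x0 - δ := by linarith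
  have hρ : ∀ g : ℕ, 0 ≤ (1 / (x0 - δ)) ^ g := fun g => by positivity
  refine ⟨{ f := fun n x => Pf I q φ j (ξ * x ^ σ n)
            cf := fun n => (Pf_cont I q φ j).comp (by fun_prop)
            α := x0 - δ
            β := x0 + δ
            hαβ := by linarith
            C := C
            hC := by linarith
            bd := fun n x => (Pf_bd I q φ j _).trans (by rw [← hQdef]; linarith)
            ρ := 1 / (x0 - δ)
            ρ0 := by positivity
            ρ1 := by rw [div_lt_one hα0]; exact hα
            v := Vs I q φ j
            v0 := Vs_nonneg I q φ j hj1
            n0 := n0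
            H := fun a g u => 1 / (σ a * u ^ (σ a - g))
            Hpos := ?_
            Hanti := ?_
            Hmono := ?_
            osc := ?_
            i1 := ?_
            i2 := ?_
            Hsmall := ?_ }, δ, hδ, rfl, rfl, rfl, rfl⟩
  · intro a g u hu _
    have : (0:ℝ) < σ a := by exact_mod_cast (by have := hσ1 a; omega)
    have : 0 < u := by linarith
    positivity
  · intro a g u hu w hw huw
    have : (0:ℝ) < σ a := by exact_mod_cast (by have := hσ1 a; omega)
    have : 0 < u := by linarith [hu.1]
    show 1 / ((σ a : ℝ) * w ^ (σ a - g)) ≤ 1 / (σ a * u ^ (σ a - g))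
    gcongr
  · intro a a' g g' u haa hg hu _
    have h1 : (0:ℝ) < σ a := by exact_mod_cast (by have := hσ1 a; omega)
    have h2 : (1:ℝ) ≤ u := by linarith
    have h3 := hσd a (a' - a)
    rw [show a + (a' - a) = a' by omega] at h3
    have h4 : (σ a : ℝ) ≤ σ a' := by exact_mod_cast (by omega)
    show 1 / ((σ a' : ℝ) * u ^ (σ a' - g')) ≤ 1 / (σ a * u ^ (σ a - g))
    have h5 : u ^ (σ a - g) ≤ u ^ (σ a' - g') := pow_le_pow_right₀ h2 (by omega)
    gcongr
  · intro a g n u w hn hng hu hw hH x hx y hy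
    have h3 := hσd n (2 * g)
    have h4 : σ (n + 2 * g) ≤ σ a := hσ.monotone hng
    have h1 := hσ1 a
    have h5 := pow_osc (σ n) (σ a) g (x0 - δ) u w hα (by omega) (by omega) hu hH x y hx hy
    refine (Pf_lip I q φ j d hjd _ _).trans ?_
    rw [← mul_sub, abs_mul, abs_of_pos hξ, ← hQdef]
    calc Q * (2 * Real.pi * d) * (ξ * |x ^ σ n - y ^ σ n|)
        ≤ Q * (2 * Real.pi * d) * (ξ * (2 * Real.exp 2 * (1 / (x0 - δ)) ^ g)) := by gcongr
      _ = Q * (2 * Real.pi * d) * (ξ * (2 * Real.exp 2)) * (1 / (x0 - δ)) ^ g := by ring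
      _ ≤ _ := mul_le_mul_of_nonneg_right (by linarith) (hρ g)
  · intro a g n u w hn hg han hu huw hw hH
    have h1 := hσ1 a
    refine (Pf_i1 I q φ j ξ (x0 - δ) (x0 + δ) c d hξ hc hc1 hα hj1 hjd u w (σ n) (σ a) g (by omega)
      (hσ.monotone han) (by omega) hu huw hw hH).trans ?_
    rw [← hQdef, ← hKdef]
    exact mul_le_mul_of_nonneg_right (mul_le_mul_of_nonneg_right (by linarith) (hρ g)) (by linarith)
  · intro a g n m u w hn hg han ham hu huw hw hH
    have h1 := hσ1 a
    have := Pf_i2 I q φ j ξ (x0 - δ) (x0 + δ) c n0 d hnr hξ hc hc1 hα hj1 hjd u w (σ n) (σ m) (σ a) g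
      (by omega) (by omega)
      (hσ.monotone han) (hσ.monotone ham) (by omega) hu huw hw hH
    simp only [hσ.injective.eq_iff] at this
    refine this.trans ?_
    rw [← hQdef, ← hKdef]
    exact mul_le_mul_of_nonneg_right (mul_le_mul_of_nonneg_right (by linarith) (hρ g)) (by linarith)
  · obtain ⟨k0, hk0⟩ := exists_nat_gt (1 / (2 * δ))
    filter_upwards [eventually_ge_atTop (k0 + 1)] with k hk a ha
    have hka : k ≤ a := by
      have : k ^ 1 ≤ k ^ 4 := Nat.pow_le_pow_right (by omega) (by norm_num)
      simp at this; omega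
    have h1 := hσ1 a
    have h2 : (k0:ℝ) ≤ σ a := by exact_mod_cast (by omega)
    have h3 : (0:ℝ) < σ a := by exact_mod_cast (by omega)
    have h4 : (1:ℝ) ≤ (x0 - δ) ^ (σ a - k ^ 2) := one_le_pow₀ hα.le
    show 1 / ((σ a:ℝ) * (x0 - δ) ^ (σ a - k ^ 2)) ≤ _
    calc 1 / ((σ a:ℝ) * (x0 - δ) ^ (σ a - k ^ 2)) ≤ 1 / (σ a * 1) := by gcongr
      _ ≤ 2 * δ := by
        rw [mul_one, div_le_iff₀ h3]
        have := hk0.le.trans h2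
        rw [div_le_iff₀ (by positivity)] at this
        linarith
      _ = _ := by ring

end

/-- limsup identification from the two bounds -/
lemma limsup_of (u : ℕ → ℝ) (L : ℝ) (h0 : ∀ n, 0 ≤ u n) (hL : 0 ≤ L)
    (hup : ∀ k : ℕ, ∀ᶠ n in atTop, u n ≤ L + 1 / (k + 1))
    (hlo : ∀ k : ℕ, 0 < L - 1 / (k + 1) → ∃ᶠ n in atTop, L - 1 / (k + 1) ≤ u n) :
    atTop.limsup u = L := by
  have b1 : IsBoundedUnder (· ≤ ·) atTop u := ⟨_, eventually_map.2 (hup 0)⟩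
  have b2 : IsCoboundedUnder (· ≤ ·) atTop u :=
    IsBoundedUnder.isCoboundedUnder_le ⟨0, eventually_map.2 (Eventually.of_forall h0)⟩
  have hz : Tendsto (fun k : ℕ => (1:ℝ) / (k + 1)) atTop (nhds 0) := tendsto_one_div_add_atTop_nhds_zero_nat
  apply le_antisymm
  · have : Tendsto (fun k : ℕ => L + (1:ℝ) / (k + 1)) atTop (nhds (L + 0)) := tendsto_const_nhds.add hz
    rw [add_zero] at this
    exact ge_of_tendsto' this fun k => limsup_le_of_le b2 (hup k)
  · have : Tendsto (fun k : ℕ => L - (1:ℝ) / (k + 1)) atTop (nhds (L - 0)) := tendsto_const_nhds.sub hz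
    rw [sub_zero] at this
    refine le_of_tendsto' this fun k => ?_
    by_cases h : 0 < L - 1 / ((k:ℝ) + 1)
    · exact le_limsup_of_frequently_le (hlo k h) b1
    · refine (not_lt.1 h).trans ?_
      exact le_limsup_of_frequently_le (Frequently.of_forall h0) b1

lemma Sys.lim (S : Sys) : ∀ᵐ x : ℝ, x ∈ Set.Icc S.α S.β →
    atTop.limsup (fun n : ℕ => |S.R n x| / √((n:ℝ) * plog (plog n))) = √(2 * S.v) := by
  have hv := S.v0
  have hL := Real.sqrt_nonneg (2 * S.v)
  have hsq : √(2 * S.v) ^ 2 = 2 * S.v := Real.sq_sqrt (by positivity)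
  have hk : ∀ k : ℕ, 0 < 1 / ((k:ℝ) + 1) := fun k => by positivity
  have h1 : ∀ᵐ x : ℝ, ∀ k : ℕ, x ∈ Set.Icc S.α S.β → ∀ᶠ n : ℕ in atTop,
      |S.R n x| ≤ (√(2 * S.v) + 1 / (k + 1)) * √(n * plog (plog n)) :=
    ae_all_iff.2 fun k => S.U2 _ (by have := hk k; positivity) (by have := hk k; nlinarith)
  have h2 : ∀ᵐ x : ℝ, ∀ k : ℕ, 0 < √(2 * S.v) - 1 / (k + 1) → x ∈ Set.Icc S.α S.β → ∃ᶠ n : ℕ in atTop,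
      (√(2 * S.v) - 1 / (k + 1)) * √(n * plog (plog n)) ≤ |S.R n x| := by
    refine ae_all_iff.2 fun k => ?_
    by_cases h : 0 < √(2 * S.v) - 1 / ((k:ℝ) + 1)
    · filter_upwards [S.lower _ h (by have := hk k; nlinarith)] with x hx _ using hx
    · exact Eventually.of_forall fun x h' => absurd h' h
  have hp : ∀ n : ℕ, 1 ≤ n → 0 < √((n:ℝ) * plog (plog n)) := by
    intro n hn
    have : (0:ℝ) < n := by exact_mod_cast hn
    have h3 : 0 < plog (plog n) := lt_of_lt_of_le one_pos (le_max_left _ _)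
    positivity
  filter_upwards [h1, h2] with x hx1 hx2 hx
  refine limsup_of _ _ (fun n => by positivity) hL ?_ ?_
  · intro k
    filter_upwards [hx1 k hx, eventually_ge_atTop 1] with n hn h1
    rw [div_le_iff₀ (hp n h1)]; exact hn
  · intro k h
    refine ((hx2 k h hx).and_eventually (eventually_ge_atTop 1)).mono ?_
    rintro n ⟨hn, h1⟩
    rw [le_div_iff₀ (hp n h1)]; exact hn

lemma main {ι : Type} (I : Finset ι) (q φ : ι → ℝ) (j : ι → ℕ) (ξ : ℝ) (d : ℕ) (hξ : 0 < ξ)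
    (hj1 : ∀ i ∈ I, 1 ≤ j i) (hjd : ∀ i ∈ I, j i ≤ d)
    (σ : ℕ → ℕ) (hσ : StrictMono σ) (hσ1 : ∀ n, n + 1 ≤ σ n) :
    ∀ᵐ x : ℝ, 1 < x →
    atTop.limsup (fun n : ℕ => |∑ i ∈ Finset.range n, Pf I q φ j (ξ * x ^ σ i)| /
      √((n:ℝ) * plog (plog n))) = √(2 * Vs I q φ j) := by
  set Z : Set ℝ := {x | 1 < x ∧ ¬ (atTop.limsup (fun n : ℕ =>
    |∑ i ∈ Finset.range n, Pf I q φ j (ξ * x ^ σ i)| /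
      √((n:ℝ) * plog (plog n))) = √(2 * Vs I q φ j))} with hZ
  set E : Set ℝ := {x:ℝ | 0 ≤ x ∧ ∃ r j j' : ℕ, 1 ≤ r ∧ 1 ≤ j ∧ (j:ℝ) * x ^ r = j'} with hE
  have hE0 : volume E = 0 := res_countable.measure_zero _
  have hW : volume (Z \ E) = 0 := by
    refine measure_null_of_locally_null _ fun x0 hx0 => ?_
    obtain ⟨⟨h1, _⟩, h2⟩ := hx0
    obtain ⟨S, δ, hδ, hf, hα, hβ, hv⟩ := exists_sys I q φ j ξ x0 d hξ h1 (fun r j j' hr hj he =>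
      h2 ⟨by linarith, r, j, j', hr, hj, he⟩) hj1 hjd σ hσ hσ1
    refine ⟨(Z \ E) ∩ Set.Icc (x0 - δ) (x0 + δ), Filter.inter_mem self_mem_nhdsWithin
      (mem_nhdsWithin_of_mem_nhds (Icc_mem_nhds (by linarith) (by linarith))), ?_⟩
    refine measure_mono_null ?_ (ae_iff.1 S.lim)
    rintro x ⟨⟨hxZ, _⟩, hxI⟩ hcon
    apply hxZ.2
    rw [hα, hβ] at hcon
    have := hcon hxI
    simp only [Sys.R, hf, hv] at this
    exact this
  have : volume Z = 0 := by
    refine measure_mono_null (t := (Z \ E) ∪ E) (fun x hx => ?_) (measure_union_null hW hE0)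
    by_cases h : x ∈ E
    · exact Or.inr h
    · exact Or.inl ⟨hx, h⟩
  rw [ae_iff]
  refine measure_mono_null (fun x hx => ?_) this
  simp only [Set.mem_setOf_eq, Classical.not_imp] at hx
  exact hx

end LIL

theorem stmt16 (ξ A B : ℝ) (hξ : 0 < ξ) (hA : 1 < A) (hAB : B - A = 1)
    (s : ℕ → ℕ) (hmono : StrictMono s) (hpos : ∀ n, 1 ≤ n → 1 ≤ s n)
    (d : ℕ) (a b : ℕ → ℝ) (p : ℝ → ℝ)
    (hp : p = fun x => ∑ j ∈ Finset.Icc 1 d,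
        (a j * Real.cos (2 * Real.pi * j * x) + b j * Real.sin (2 * Real.pi * j * x)))
    (hint : (∫ x in (0:ℝ)..1, p x) = 0) :
    ∀ᵐ x : ℝ ∂volume, x ∈ Set.Icc A B →
      Filter.atTop.limsup (fun N : ℕ =>
          |∑ n ∈ Finset.Icc 1 N, p (ξ * x ^ s n)| /
            Real.sqrt ((N : ℝ) * plog (plog N))) =
        Real.sqrt 2 * fnorm A B p := by
  set I : Finset (ℕ × Bool) := Finset.Icc 1 d ×ˢ Finset.univ with hI
  set q : ℕ × Bool → ℝ := fun i => if i.2 then a i.1 else b i.1 with hq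
  set φ : ℕ × Bool → ℝ := fun i => if i.2 then 0 else - (Real.pi / 2) with hφ
  set j : ℕ × Bool → ℕ := fun i => i.1 with hj
  have hpP : p = LIL.Pf I q φ j := by
    rw [hp]
    funext x
    unfold LIL.Pf
    rw [hI, Finset.sum_product]
    refine Finset.sum_congr rfl fun k _ => ?_
    rw [Fintype.sum_bool]
    simp only [hq, hφ, hj, if_true, add_zero, Bool.false_eq_true, if_false, ← sub_eq_add_neg,
      Real.cos_sub_pi_div_two]
  have hj1 : ∀ i ∈ I, 1 ≤ j i := by
    intro i hi
    rw [hI, Finset.mem_product, Finset.mem_Icc] at hi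
    exact hi.1.1
  have hjd : ∀ i ∈ I, j i ≤ d := by
    intro i hi
    rw [hI, Finset.mem_product, Finset.mem_Icc] at hi
    exact hi.1.2
  have hσ : StrictMono (fun n => s (n + 1)) := fun x y h => hmono (by omega)
  have hσ1 : ∀ n, n + 1 ≤ s (n + 1) := fun n => hmono.id_le (n + 1)
  have hfn : Real.sqrt 2 * fnorm A B p = √(2 * LIL.Vs I q φ j) := by
    rw [Real.sqrt_mul (by norm_num), fnorm, show B = A + 1 by linarith, hpP, LIL.Pf_var I q φ j A hj1]
  filter_upwards [LIL.main I q φ j ξ d hξ hj1 hjd _ hσ hσ1] with x hx hxA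
  rw [hfn, ← hx (by linarith [hxA.1]), ← hpP]
  congr 1
  funext N
  congr 2
  rw [Finset.range_eq_Ico, Finset.sum_Ico_add' (fun n => p (ξ * x ^ s n)) 0 N 1, zero_add]
  rfl
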